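/- Fix k ≥ 1. For a uniformly random alternating sign matrix of size N, the probability that the number of −1 entries in the first k rows is maximal possible (i.e., for each j = 2,…,k the j-th row contains exactly j−1 entries equal to −1, so in particular the j-th row contains exactly j entries equal to 1 for each j = 1,…,k) tends to 1 as N → ∞. -/

import Mathlib

/-- An alternating sign matrix: entries in `{-1,0,1}`, every row and column sums to `1`,
and every partial sum of a row (from the left) or of a column (from the top) equals `0` or `1`
(this is equivalent to the alternation of signs of the nonzero entries). -/
def IsASM {N : ℕ} (M : Matrix (Fin N) (Fin N) ℤ) : Prop :=
  (∀ i j, M i j = -1 ∨ M i j = 0 ∨ M i j = 1) ∧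
  (∀ i : Fin N, ∑ j, M i j = 1) ∧
  (∀ j : Fin N, ∑ i, M i j = 1) ∧
  (∀ i m : Fin N, (∑ j ∈ Finset.univ.filter (fun j : Fin N => j ≤ m), M i j) = 0 ∨
                  (∑ j ∈ Finset.univ.filter (fun j : Fin N => j ≤ m), M i j) = 1) ∧
  (∀ j m : Fin N, (∑ i ∈ Finset.univ.filter (fun i : Fin N => i ≤ m), M i j) = 0 ∨
                  (∑ i ∈ Finset.univ.filter (fun i : Fin N => i ≤ m), M i j) = 1)

/-! ### The six-vertex model with domain wall boundary conditions -/

/-- The vertex operator of the six-vertex model acting on the horizontal line, for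
prescribed vertical edge states `s` (above) and `t` (below). -/
def vertexOp (a b c : ℂ) (s t : Bool) : Matrix Bool Bool ℂ := fun h k =>
  if s = t then (if h = k then (if h = s then a else b) else 0)
  else if h = s ∧ k = t then c else 0

/-- The six-vertex `R`-matrix acting on two horizontal lines. -/
def rMat (r p q : ℂ) : Matrix (Bool × Bool) (Bool × Bool) ℂ := fun h k =>
  if h = k then (if h.1 = h.2 then r else p) else if h.1 = k.2 ∧ h.2 = k.1 then q else 0

theorem yang_baxter {a b a' b' c r p : ℂ} (s u : Bool) (h1 : p * c = a * b' - b * a')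
    (h2 : r * a = b * p + c * a') (h3 : r * b' = a' * p + c * b) :
    rMat r p c * (∑ t, Matrix.kronecker (vertexOp a b c s t) (vertexOp a' b' c t u)) =
    (∑ t, Matrix.kronecker (vertexOp a b c t u) (vertexOp a' b' c s t)) * rMat r p c := by
  ext ⟨i1, i2⟩ ⟨k1, k2⟩
  cases s <;> cases u <;> cases i1 <;> cases i2 <;> cases k1 <;> cases k2 <;>
  simp [Matrix.mul_apply, Fintype.sum_prod_type, rMat, vertexOp] <;>
  first
  | ring1
  | linear_combination c * h1
  | linear_combination (-c) * h1
  | linear_combination c * h2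
  | linear_combination (-c) * h2
  | linear_combination c * h3
  | linear_combination (-c) * h3

theorem sum_prod_ofFn {R ι : Type*} [Semiring R] [Fintype ι] {n : ℕ} (f : Fin n → ι → R) :
    ∑ τ : Fin n → ι, (List.ofFn fun l => f l (τ l)).prod
      = (List.ofFn fun l => ∑ t, f l t).prod := by
  induction n with
  | zero => simp
  | succ n ih =>
    rw [← (Fin.consEquiv (fun _ : Fin (n + 1) => ι)).sum_comp, Fintype.sum_prod_type]
    simp only [Fin.consEquiv_apply, List.ofFn_succ, List.prod_cons, Fin.cons_zero, Fin.cons_succ]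
    rw [← ih fun l => f l.succ, Finset.sum_mul_sum]

/-- The entries of the row-to-row transfer matrix with domain wall boundary conditions on the
left and on the right. -/
def rowOp {n : ℕ} (a b : Fin n → ℂ) (c : ℂ) : Matrix (Fin n → Bool) (Fin n → Bool) ℂ :=
  fun s t => (List.ofFn fun l => vertexOp (a l) (b l) c (s l) (t l)).prod false true

theorem kronecker_prod_ofFn {n : ℕ} (A B : Fin n → Matrix Bool Bool ℂ) :
    Matrix.kronecker (List.ofFn A).prod (List.ofFn B).prod
      = (List.ofFn fun l => Matrix.kronecker (A l) (B l)).prod := by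
  induction n with
  | zero => simp [Matrix.kronecker]
  | succ n ih =>
    simp only [List.ofFn_succ, List.prod_cons, ← ih]
    exact Matrix.mul_kronecker_mul _ _ _ _

theorem intertwine_prod_ofFn {R : Type*} [Semiring R] {n : ℕ} (r : R) (A B : Fin n → R)
    (h : ∀ l, r * A l = B l * r) : r * (List.ofFn A).prod = (List.ofFn B).prod * r := by
  induction n with
  | zero => simp
  | succ n ih =>
    simp only [List.ofFn_succ, List.prod_cons]
    rw [← mul_assoc, h, mul_assoc, ih _ _ fun l => h l.succ, mul_assoc]

theorem rowOp_mul_rowOp {n : ℕ} (a b a' b' : Fin n → ℂ) (c : ℂ) (s u : Fin n → Bool) :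
    (rowOp a b c * rowOp a' b' c) s u =
      (List.ofFn fun l => ∑ t, Matrix.kronecker (vertexOp (a l) (b l) c (s l) t)
        (vertexOp (a' l) (b' l) c t (u l))).prod (false, false) (true, true) := by
  rw [← sum_prod_ofFn, Matrix.sum_apply, Matrix.mul_apply]
  refine Finset.sum_congr rfl fun τ _ => ?_
  rw [← kronecker_prod_ofFn]
  rfl

theorem rowOp_commute {n : ℕ} {a b a' b' : Fin n → ℂ} {c r p : ℂ} (hr : r ≠ 0)
    (h1 : ∀ l, p * c = a l * b' l - b l * a' l)
    (h2 : ∀ l, r * a l = b l * p + c * a' l) (h3 : ∀ l, r * b' l = a' l * p + c * b l) :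
    Commute (rowOp a b c) (rowOp a' b' c) := by
  ext s u
  have key := congrFun (congrFun (intertwine_prod_ofFn (rMat r p c) _ _ fun l =>
    yang_baxter (s l) (u l) (h1 l) (h2 l) (h3 l)) (false, false)) (true, true)
  have e2 : (rowOp a' b' c * rowOp a b c) s u =
      (List.ofFn fun l => ∑ t, Matrix.kronecker (vertexOp (a l) (b l) c t (u l))
        (vertexOp (a' l) (b' l) c (s l) t)).prod (false, false) (true, true) := by
    rw [← sum_prod_ofFn, Matrix.sum_apply, Matrix.mul_apply]
    refine Finset.sum_congr rfl fun τ _ => ?_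
    rw [← kronecker_prod_ofFn]
    exact mul_comm _ _
  rw [rowOp_mul_rowOp, e2]
  simp only [Matrix.mul_apply (M := rMat r p c), Matrix.mul_apply (N := rMat r p c),
    Fintype.sum_prod_type, Fintype.sum_bool] at key
  simp [rMat] at key
  rw [mul_comm] at key
  simpa [Matrix.kronecker] using mul_right_cancel₀ hr key

open Complex in
/-- The row operator with row parameter `x` and column parameters `y`, at the combinatorial
point. -/
noncomputable def rowT {n : ℕ} (y : Fin n → ℂ) (x : ℂ) :
    Matrix (Fin n → Bool) (Fin n → Bool) ℂ :=
  rowOp (fun l => sin (Real.pi / 3 + (x - y l))) (fun l => sin (Real.pi / 3 - (x - y l)))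
    (sin (Real.pi / 3))

open Complex in
theorem rowT_commute {n : ℕ} (y : Fin n → ℂ) {x x' : ℂ}
    (h : sin (Real.pi / 3 + (x - x')) ≠ 0) : Commute (rowT y x) (rowT y x') := by
  have c3 : cos ((Real.pi : ℂ) / 3) = 1 / 2 := by
    have := Real.cos_pi_div_three
    have h := congrArg (fun x : ℝ => (x : ℂ)) this
    push_cast at h
    simpa using h
  have s3 : sin ((Real.pi : ℂ) / 3) ^ 2 = 3 / 4 := by
    have := sin_sq_add_cos_sq ((Real.pi : ℂ) / 3)
    rw [c3] at this
    linear_combination this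
  have key : ∀ l, sin (x - x') = sin (x - y l) * cos (x' - y l) - cos (x - y l) * sin (x' - y l) ∧
      cos (x - x') = cos (x - y l) * cos (x' - y l) + sin (x - y l) * sin (x' - y l) := by
    intro l
    rw [← sin_sub, ← cos_sub]
    constructor <;> congr 1 <;> ring
  refine rowOp_commute (r := sin (Real.pi / 3 + (x - x'))) (p := sin (x - x')) h ?_ ?_ ?_ <;>
    intro l <;> obtain ⟨k1, k2⟩ := key l <;> simp only [sin_add, sin_sub (Real.pi / 3 : ℂ), c3] <;>
    have e1 := sin_sq_add_cos_sq (x - y l) <;> have e2 := sin_sq_add_cos_sq (x' - y l) <;>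
    rw [k1] <;> (try rw [k2]) <;>
    generalize sin (x - y l) = S1 at * <;> generalize cos (x - y l) = C1 at * <;>
    generalize sin (x' - y l) = S2 at * <;> generalize cos (x' - y l) = C2 at * <;>
    generalize sin ((Real.pi : ℂ) / 3) = S at *
  · ring
  · linear_combination (S * S2 / 2 + S ^ 2 * C2) * e1 + (S1 * C1 * S2 - C2 * S1 ^ 2) * s3
  · linear_combination (-S * S1 / 2 + S ^ 2 * C1) * e2 + (S1 * C2 * S2 - C1 * S2 ^ 2) * s3

/-! ### Corner sum matrices -/

/-- Corner sum matrices of alternating sign matrices of size `N`, extended by zero. -/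
structure IsCornerSum (N : ℕ) (C : ℕ → ℕ → ℤ) : Prop where
  left : ∀ i, C i 0 = 0
  top : ∀ l, C 0 l = 0
  right : ∀ i ≤ N, C i N = i
  bot : ∀ l ≤ N, C N l = l
  hor : ∀ i ≤ N, ∀ l < N, C i (l + 1) = C i l ∨ C i (l + 1) = C i l + 1
  ver : ∀ i < N, ∀ l ≤ N, C (i + 1) l = C i l ∨ C (i + 1) l = C i l + 1
  out : ∀ i l, N < i ∨ N < l → C i l = 0

/-- The states of the vertical edges. -/
def cornerV (C : ℕ → ℕ → ℤ) (i l : ℕ) : Bool := decide (C i (l + 1) = C i l + 1)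

/-- The states of the horizontal edges. -/
def cornerH (C : ℕ → ℕ → ℤ) (i l : ℕ) : Bool := decide (C (i + 1) l = C i l + 1)

theorem IsCornerSum.transpose {N : ℕ} {C : ℕ → ℕ → ℤ} (h : IsCornerSum N C) :
    IsCornerSum N fun i l => C l i :=
  ⟨h.top, h.left, h.bot, h.right, fun i hi l hl => h.ver l hl i hi,
    fun i hi l hl => h.hor l hl i hi, fun i l hil => h.out l i hil.symm⟩

theorem IsCornerSum.ext_vertical {N : ℕ} {C C' : ℕ → ℕ → ℤ} (h : IsCornerSum N C)
    (h' : IsCornerSum N C')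
    (e : ∀ i ≤ N, ∀ l < N, cornerV C i l = cornerV C' i l) : C = C' := by
  have key : ∀ i ≤ N, ∀ l ≤ N, C i l = C' i l := by
    intro i hi l
    induction l with
    | zero => simp [h.left, h'.left]
    | succ l ih =>
      intro hl
      have := e i hi l hl
      simp only [cornerV, decide_eq_decide] at this
      have h1 := h.hor i hi l hl
      have h2 := h'.hor i hi l hl
      have h3 := ih (by omega)
      omega
  funext i l
  by_cases hil : i ≤ N ∧ l ≤ N
  · exact key i hil.1 l hil.2
  · rw [h.out i l (by omega), h'.out i l (by omega)]

theorem finite_isCornerSum (N : ℕ) : {C | IsCornerSum N C}.Finite := by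
  refine Set.Finite.of_injOn (f := fun C (i : Fin (N + 1)) (l : Fin N) => cornerV C i l)
    (t := Set.univ) (fun _ _ => Set.mem_univ _) ?_ Set.finite_univ
  intro C hC C' hC' e
  refine IsCornerSum.ext_vertical hC hC' fun i hi l hl => ?_
  exact congrFun (congrFun e ⟨i, by omega⟩) ⟨l, hl⟩

/-- The finite set of corner sum matrices of size `N`. -/
noncomputable def corners (N : ℕ) : Finset (ℕ → ℕ → ℤ) := (finite_isCornerSum N).toFinset

theorem mem_corners {N : ℕ} {C : ℕ → ℕ → ℤ} : C ∈ corners N ↔ IsCornerSum N C := by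
  simp [corners]

/-- The local weight of a six-vertex configuration. -/
def vertexWt (a b c : ℂ) (s t h : Bool) : ℂ := if s = t then (if h = s then a else b) else c

theorem vertexOp_row {a b c P : ℂ} {s t k : Bool} {d d' : ℤ} (e : d' = d + t.toInt - s.toInt)
    (h : d = 0 ∨ d = 1) (h' : d' = 0 ∨ d' = 1) :
    (if true = decide (d = 1) then P else 0) * vertexOp a b c s t true k +
      (if false = decide (d = 1) then P else 0) * vertexOp a b c s t false k =
    if k = decide (d' = 1) then P * vertexWt a b c s t (decide (d = 1)) else 0 := by
  rcases h with rfl | rfl <;> rcases h' with rfl | rfl <;> cases s <;> cases t <;>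
    (try norm_num at e) <;> cases k <;> simp [vertexOp, vertexWt]

theorem vertexOp_ne_zero {a b c : ℂ} {s t k : Bool} {d d' : ℤ} (e : d' = d + t.toInt - s.toInt)
    (h : d = 0 ∨ d = 1) (hv : vertexOp a b c s t (decide (d = 1)) k ≠ 0) :
    (d' = 0 ∨ d' = 1) ∧ k = decide (d' = 1) := by
  rcases h with rfl | rfl <;> cases s <;> cases t <;> cases k <;> simp_all [vertexOp]

theorem ne_zero_or_ne_zero_of_mul_add {x y x' y' : ℂ} (h : x * y + x' * y' ≠ 0) :
    (x ≠ 0 ∧ y ≠ 0) ∨ (x' ≠ 0 ∧ y' ≠ 0) := by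
  by_contra! hc
  apply h
  rcases eq_or_ne x 0 with h1 | h1 <;> rcases eq_or_ne x' 0 with h2 | h2
  · simp [h1, h2]
  · simp [h1, hc.2 h2]
  · simp [h2, hc.1 h1]
  · simp [hc.1 h1, hc.2 h2]

theorem prod_vertexOp {n : ℕ} (a b : Fin n → ℂ) (c : ℂ) (s t : Fin n → Bool) (d : ℕ → ℤ)
    (d0 : d 0 = 0) (hd : ∀ l : Fin n, d (l + 1) = d l + (t l).toInt - (s l).toInt) (k : Bool) :
    ((∀ l ≤ n, d l = 0 ∨ d l = 1) → (List.ofFn fun l => vertexOp (a l) (b l) c (s l) (t l)).prod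
      false k = if k = decide (d n = 1) then
        ∏ l : Fin n, vertexWt (a l) (b l) c (s l) (t l) (decide (d l = 1)) else 0) ∧
    ((List.ofFn fun l => vertexOp (a l) (b l) c (s l) (t l)).prod false k ≠ 0 →
      (∀ l ≤ n, d l = 0 ∨ d l = 1) ∧ k = decide (d n = 1)) := by
  induction n generalizing k with
  | zero => cases k <;> simp [d0]
  | succ n ih =>
    have ih' := fun m => ih (fun l => a l.castSucc) (fun l => b l.castSucc) (fun l => s l.castSucc)
      (fun l => t l.castSucc) (fun l => hd l.castSucc) m
    have e := hd (Fin.last n)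
    simp only [Fin.val_last] at e
    rw [List.ofFn_succ', List.concat_eq_append, List.prod_append, List.prod_singleton,
      Matrix.mul_apply, Fintype.sum_bool]
    constructor
    · intro h
      have h1 := (ih' true).1 fun l hl => h l (by omega)
      have h2 := (ih' false).1 fun l hl => h l (by omega)
      rw [h1, h2, Fin.prod_univ_castSucc]
      simp only [Fin.val_castSucc, Fin.val_last]
      exact vertexOp_row e (h n (by omega)) (h (n + 1) (by omega))
    · intro h
      have : ∃ m, (List.ofFn fun l : Fin n => vertexOp (a l.castSucc) (b l.castSucc) c
          (s l.castSucc) (t l.castSucc)).prod false m ≠ 0 ∧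
          vertexOp (a (Fin.last n)) (b (Fin.last n)) c (s (Fin.last n)) (t (Fin.last n)) m k
            ≠ 0 := by
        rcases ne_zero_or_ne_zero_of_mul_add h with h | h
        exacts [⟨true, h⟩, ⟨false, h⟩]
      obtain ⟨m, hm, hv⟩ := this
      obtain ⟨g1, g2⟩ := (ih' m).2 hm
      have g3 := g1 n le_rfl
      have main := vertexOp_ne_zero e g3 (g2 ▸ hv)
      refine ⟨fun l hl => ?_, main.2⟩
      rcases Nat.lt_or_ge n l with hl' | hl'
      · obtain rfl : l = n + 1 := by omega
        exact main.1
      · exact g1 l hl'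

theorem prod_ofFn_apply {α R : Type*} [Fintype α] [DecidableEq α] [CommSemiring R] {m : ℕ}
    (M : Fin m → Matrix α α R) (s t : α) :
    (List.ofFn M).prod s t = ∑ g : Fin (m + 1) → α, if g 0 = s ∧ g (Fin.last m) = t then
      ∏ i : Fin m, M i (g i.castSucc) (g i.succ) else 0 := by
  induction m generalizing s with
  | zero =>
    rw [← (Fin.consEquiv (fun _ : Fin 1 => α)).sum_comp, Fintype.sum_prod_type]
    simp [Matrix.one_apply, Fin.consEquiv_apply, Finset.filter_and,
      Finset.filter_eq']
    split_ifs <;> simp_all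
  | succ m ih =>
    rw [← (Fin.consEquiv (fun _ : Fin (m + 2) => α)).sum_comp, Fintype.sum_prod_type,
      Finset.sum_eq_single s]
    · simp only [List.ofFn_succ, List.prod_cons, Matrix.mul_apply, ih, Fin.consEquiv_apply]
      simp_rw [Finset.mul_sum]
      rw [Finset.sum_comm]
      refine Finset.sum_congr rfl fun g _ => ?_
      rw [Finset.sum_eq_single (g 0)]
      · simp only [Fin.prod_univ_succ, Fin.cons_zero, ← Fin.succ_last, Fin.cons_succ,
          Fin.castSucc_zero, true_and, mul_ite, mul_zero, ← Fin.succ_castSucc]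
      · intro x _ hx
        simp [hx.symm]
      · simp
    · intro x _ hx
      simp [Fin.consEquiv_apply, hx]
    · simp

/-- The Boltzmann weight of a six-vertex configuration with domain wall boundary conditions. -/
noncomputable def cornerWt {N : ℕ} (a b : Fin N → Fin N → ℂ) (c : ℂ) (C : ℕ → ℕ → ℤ) : ℂ :=
  ∏ i : Fin N, ∏ l : Fin N, vertexWt (a i l) (b i l) c (cornerV C i l) (cornerV C (i + 1) l)
    (cornerH C i l)

theorem cornerV_toInt {N : ℕ} {C : ℕ → ℕ → ℤ} (h : IsCornerSum N C) {i l : ℕ} (hi : i ≤ N)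
    (hl : l < N) : (cornerV C i l).toInt = C i (l + 1) - C i l := by
  rcases h.hor i hi l hl with e | e <;> simp [cornerV, e, Bool.toInt]

theorem rowOp_corner {N : ℕ} {C : ℕ → ℕ → ℤ} (h : IsCornerSum N C) (a b : Fin N → ℂ) (c : ℂ)
    (i : Fin N) :
    rowOp a b c (fun l => cornerV C i l) (fun l => cornerV C (i + 1) l) =
      ∏ l : Fin N, vertexWt (a l) (b l) c (cornerV C i l) (cornerV C (i + 1) l)
        (cornerH C i l) := by
  have := (prod_vertexOp a b c (fun l => cornerV C i l) (fun l => cornerV C (i + 1) l)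
    (fun l => C (i + 1) l - C i l) (by simp [h.left]) (fun l => by
      rw [cornerV_toInt h (by omega) l.2, cornerV_toInt h (by omega) l.2]; ring) true).1
    (fun l hl => by
      have := h.ver i i.2 l hl
      omega)
  rw [rowOp, this, if_pos]
  · refine Finset.prod_congr rfl fun l _ => ?_
    congr 1
    simp only [cornerH, decide_eq_decide]
    omega
  · rw [h.right _ (by omega), h.right _ (by omega)]
    simp

/-- Corner sums of a family of vertical edge states. -/
def cornerOf {N : ℕ} (v : Fin (N + 1) → Fin N → Bool) (i l : ℕ) : ℤ :=
  if h : i ≤ N ∧ l ≤ N then ∑ m : Fin l, (v ⟨i, by omega⟩ ⟨m, by omega⟩).toInt else 0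

theorem cornerOf_succ {N : ℕ} (v : Fin (N + 1) → Fin N → Bool) (i : Fin (N + 1)) (l : Fin N) :
    cornerOf v i (l + 1) = cornerOf v i l + (v i l).toInt := by
  have hi := i.2
  have hl := l.2
  rw [cornerOf, cornerOf, dif_pos (by omega), dif_pos (by omega), Fin.sum_univ_castSucc]
  simp

theorem isCornerSum_cornerOf {N : ℕ} {v : Fin (N + 1) → Fin N → Bool} {a b : Fin N → Fin N → ℂ}
    {c : ℂ} (h0 : v 0 = fun _ => false) (h1 : v (Fin.last N) = fun _ => true)
    (hr : ∀ i : Fin N, rowOp (a i) (b i) c (v i.castSucc) (v i.succ) ≠ 0) :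
    IsCornerSum N (cornerOf v) := by
  have row := fun i : Fin N => (prod_vertexOp (a i) (b i) c (v i.castSucc) (v i.succ)
    (fun l => cornerOf v (i + 1) l - cornerOf v i l) (by simp [cornerOf]) (fun l => by
      have e1 := cornerOf_succ v i.castSucc l
      have e2 := cornerOf_succ v i.succ l
      simp only [Fin.val_castSucc, Fin.val_succ] at e1 e2
      rw [e1, e2]; ring) true).2 (hr i)
  have top : ∀ l, cornerOf v 0 l = 0 := fun l => by
    rw [cornerOf]
    split_ifs
    · refine Finset.sum_eq_zero fun m _ => ?_
      have : v ⟨0, by omega⟩ = fun _ => false := h0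
      rw [this]; rfl
    · rfl
  refine ⟨fun i => by simp [cornerOf], top, ?_, ?_, ?_, ?_, ?_⟩
  · intro i
    induction i with
    | zero => simp [top]
    | succ i ih =>
      intro hi
      have := (row ⟨i, by omega⟩).2
      have e := ih (by omega)
      simp only [eq_comm (a := true), decide_eq_true_eq] at this
      push_cast
      omega
  · intro l hl
    rw [cornerOf, dif_pos ⟨le_rfl, hl⟩]
    have : v ⟨N, by omega⟩ = fun _ => true := h1
    simp [this]
  · intro i hi l hl
    have := cornerOf_succ v ⟨i, by omega⟩ ⟨l, hl⟩
    simp only at this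
    rw [this]
    cases v ⟨i, by omega⟩ ⟨l, hl⟩ <;> simp
  · intro i hi l hl
    have := (row ⟨i, hi⟩).1 l hl
    simp only at this
    omega
  · intro i l h
    rw [cornerOf, dif_neg (by omega)]

/-- The partition function as a sum over corner sum matrices. -/
theorem prod_rowOp_eq_sum {N : ℕ} (a b : Fin N → Fin N → ℂ) (c : ℂ) :
    (List.ofFn fun i => rowOp (a i) (b i) c).prod (fun _ => false) (fun _ => true) =
      ∑ C ∈ corners N, cornerWt a b c C := by
  rw [prod_ofFn_apply, eq_comm]
  refine Finset.sum_of_injOn (fun C (i : Fin (N + 1)) (l : Fin N) => cornerV C i l) ?_ ?_ ?_ ?_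
  · intro C hC C' hC' e
    simp only [Finset.mem_coe, mem_corners] at hC hC'
    refine IsCornerSum.ext_vertical hC hC' fun i hi l hl => ?_
    exact congrFun (congrFun e ⟨i, by omega⟩) ⟨l, hl⟩
  · intro C _
    simp
  · intro v _ hv
    by_contra hne
    apply hv
    split_ifs at hne with h01
    have hC := isCornerSum_cornerOf (a := a) (b := b) (c := c) h01.1 h01.2 fun i =>
      Finset.prod_ne_zero_iff.1 hne i (Finset.mem_univ _)
    · refine ⟨cornerOf v, by simpa [mem_corners] using hC, ?_⟩
      funext i l
      simp only [cornerV, cornerOf_succ]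
      cases v i l <;> simp
    · exact absurd rfl hne
  · intro C hC
    rw [mem_corners] at hC
    rw [if_pos]
    · refine Finset.prod_congr rfl fun i _ => (rowOp_corner hC _ _ _ _).symm
    · constructor
      · funext l
        simp [cornerV, hC.top]
      · funext l
        have := l.2
        simp only [cornerV, Fin.val_last, hC.bot l (by omega), hC.bot (l + 1) (by omega)]
        simp

theorem prod_vertexOp_false {n : ℕ} (a b : Fin n → ℂ) (c : ℂ) (t : Fin n → Bool) :
    (List.ofFn fun l => vertexOp (a l) (b l) c false (t l)).prod true true =
      if t = (fun _ => false) then ∏ l, b l else 0 := by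
  induction n with
  | zero => simp [Subsingleton.elim t (fun _ => false)]
  | succ n ih =>
    rw [List.ofFn_succ, List.prod_cons, Matrix.mul_apply, Fintype.sum_bool, ih,
      Fin.prod_univ_succ]
    have : t = (fun _ => false) ↔ t 0 = false ∧ (fun l : Fin n => t l.succ) = fun _ => false := by
      simp only [funext_iff, Fin.forall_fin_succ]
    cases h : t 0 <;> simp [vertexOp, this, h]

theorem prod_vertexOp_true {n : ℕ} (a b : Fin n → ℂ) (c : ℂ) (s : Fin n → Bool) :
    (List.ofFn fun l => vertexOp (a l) (b l) c (s l) true).prod true true =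
      if s = (fun _ => true) then ∏ l, a l else 0 := by
  induction n with
  | zero => simp [Subsingleton.elim s (fun _ => true)]
  | succ n ih =>
    rw [List.ofFn_succ, List.prod_cons, Matrix.mul_apply, Fintype.sum_bool, ih,
      Fin.prod_univ_succ]
    have : s = (fun _ => true) ↔ s 0 = true ∧ (fun l : Fin n => s l.succ) = fun _ => true := by
      simp only [funext_iff, Fin.forall_fin_succ]
    cases h : s 0 <;> simp [vertexOp, this, h]

theorem sum_fin_succ_bool {n : ℕ} {R : Type*} [AddCommMonoid R]
    (f : (Fin (n + 1) → Bool) → R) : ∑ g, f g =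
      ∑ u : Fin n → Bool, f (Fin.cons true u) + ∑ u : Fin n → Bool, f (Fin.cons false u) := by
  rw [← (Fin.consEquiv (fun _ : Fin (n + 1) => Bool)).sum_comp, Fintype.sum_prod_type,
    Fintype.sum_bool]
  rfl

theorem rowOp_cons {n : ℕ} (a b : Fin (n + 1) → ℂ) (c : ℂ) (s0 t0 : Bool) (s t : Fin n → Bool) :
    rowOp a b c (Fin.cons s0 s) (Fin.cons t0 t) =
      if s0 = t0 then (if s0 then b 0 else a 0) *
        rowOp (fun l => a l.succ) (fun l => b l.succ) c s t
      else if t0 then c * (List.ofFn fun l => vertexOp (a l.succ) (b l.succ) c (s l) (t l)).prod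
        true true
      else 0 := by
  rw [rowOp, rowOp, List.ofFn_succ, List.prod_cons, Matrix.mul_apply, Fintype.sum_bool]
  cases s0 <;> cases t0 <;> simp [vertexOp]

section
open Complex

/-- Weight of type `a` at the combinatorial point. -/
noncomputable def wtA (u : ℂ) : ℂ := sin (Real.pi / 3 + u)

/-- Weight of type `b` at the combinatorial point. -/
noncomputable def wtB (u : ℂ) : ℂ := sin (Real.pi / 3 - u)

/-- Weight of type `c` at the combinatorial point. -/
noncomputable def wtC : ℂ := sin (Real.pi / 3)

end

theorem rowT_eq {n : ℕ} (y : Fin n → ℂ) (x : ℂ) :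
    rowT y x = rowOp (fun l => wtA (x - y l)) (fun l => wtB (x - y l)) wtC := rfl

theorem rowT_cons {n : ℕ} (y0 : ℂ) (y : Fin n → ℂ) (x : ℂ) (s0 t0 : Bool) (s t : Fin n → Bool) :
    rowT (Fin.cons y0 y) x (Fin.cons s0 s) (Fin.cons t0 t) =
      if s0 = t0 then (if s0 then wtB (x - y0) else wtA (x - y0)) * rowT y x s t
      else if t0 then wtC * (List.ofFn fun l => vertexOp (wtA (x - y l)) (wtB (x - y l)) wtC
        (s l) (t l)).prod true true
      else 0 := by
  rw [rowT_eq, rowOp_cons]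
  simp [rowT_eq]

theorem prod_rowT_cons_true {n : ℕ} (y0 : ℂ) (y : Fin n → ℂ) (xs : List ℂ) (s t : Fin n → Bool)
    (t0 : Bool) : (xs.map (rowT (Fin.cons y0 y))).prod (Fin.cons true s) (Fin.cons t0 t) =
      if t0 then (xs.map fun x => wtB (x - y0)).prod * (xs.map (rowT y)).prod s t else 0 := by
  induction xs generalizing s with
  | nil => cases t0 <;> simp [Matrix.one_apply, Fin.cons_inj]
  | cons x xs ih =>
    rw [List.map_cons, List.prod_cons, Matrix.mul_apply,
      sum_fin_succ_bool]
    simp only [ih, rowT_cons]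
    cases t0
    · simp
    · simp only [List.map_cons, List.prod_cons, Matrix.mul_apply, Finset.mul_sum]
      simp
      exact Finset.sum_congr rfl fun u _ => by ring

theorem prod_rowT_cons_false {n : ℕ} (y0 : ℂ) (y : Fin n → ℂ) (xs : List ℂ)
    (s t : Fin n → Bool) :
    (xs.map (rowT (Fin.cons y0 y))).prod (Fin.cons false s) (Fin.cons false t) =
      (xs.map fun x => wtA (x - y0)).prod * (xs.map (rowT y)).prod s t := by
  induction xs generalizing s with
  | nil => simp [Matrix.one_apply, Fin.cons_inj]
  | cons x xs ih =>
    rw [List.map_cons, List.prod_cons, Matrix.mul_apply,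
      sum_fin_succ_bool]
    simp only [ih, rowT_cons, prod_rowT_cons_true]
    simp only [List.map_cons, List.prod_cons, Matrix.mul_apply, Finset.mul_sum]
    simp
    exact Finset.sum_congr rfl fun u _ => by ring

/-- The partition function of the six-vertex model with domain wall boundary conditions. -/
noncomputable def dwPart {n : ℕ} (y : Fin n → ℂ) (xs : List ℂ) : ℂ :=
  (xs.map (rowT y)).prod (fun _ => false) (fun _ => true)

theorem cons_const {n : ℕ} (b : Bool) :
    (fun _ : Fin (n + 1) => b) = Fin.cons b (fun _ : Fin n => b) := by
  funext l
  refine Fin.cases ?_ (fun _ => ?_) l <;> simp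

theorem dwPart_cons_of_wtA_eq_zero {n : ℕ} {y0 x : ℂ} (y : Fin n → ℂ) (xs : List ℂ)
    (h : wtA (x - y0) = 0) : dwPart (Fin.cons y0 y) (x :: xs) =
      wtC * (∏ l, wtB (x - y l)) * (xs.map fun x => wtB (x - y0)).prod * dwPart y xs := by
  rw [dwPart, List.map_cons, List.prod_cons, Matrix.mul_apply,
      sum_fin_succ_bool, cons_const, cons_const]
  simp only [rowT_cons, prod_rowT_cons_true]
  simp only [prod_vertexOp_false]
  simp [h, dwPart]
  ring

theorem dwPart_append_of_wtB_eq_zero {n : ℕ} {y0 x : ℂ} (y : Fin n → ℂ) (xs : List ℂ)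
    (h : wtB (x - y0) = 0) : dwPart (Fin.cons y0 y) (xs ++ [x]) =
      wtC * (∏ l, wtA (x - y l)) * (xs.map fun x => wtA (x - y0)).prod * dwPart y xs := by
  rw [dwPart, List.map_append, List.prod_append, Matrix.mul_apply,
      sum_fin_succ_bool, cons_const, cons_const]
  simp only [List.map_cons, List.map_nil, List.prod_singleton, rowT_cons,
    prod_rowT_cons_false]
  simp only [prod_vertexOp_true]
  simp [h, dwPart]
  ring

theorem dwPart_perm {n : ℕ} (y : Fin n → ℂ) {xs xs' : List ℂ} (p : xs.Perm xs')
    (h : ∀ x ∈ xs, ∀ x' ∈ xs, wtA (x - x') ≠ 0) : dwPart y xs = dwPart y xs' := by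
  rw [dwPart, dwPart, (p.map (rowT y)).prod_eq']
  rw [List.pairwise_map]
  exact List.pairwise_of_forall_mem_list fun x hx x' hx' => rowT_commute y (h x hx x' hx')

open Polynomial in
/-- A polynomial with few monomials and a zero of high order at `1` is small near `1` on the
unit circle. -/
theorem norm_eval_exp_le (k : ℕ) (U : ℂ[X]) (S : Finset ℕ) (hS : S.card ≤ k + 1)
    (hU : ((X - 1) ^ k * U).support ⊆ S) {y : ℝ} (hy : 0 ≤ y) :
    ‖((X - 1) ^ k * U).eval (Complex.exp (Complex.I * y))‖ ≤ ‖U.eval 1‖ * y ^ k := by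
  induction k generalizing U S y with
  | zero =>
    obtain ⟨m, hm⟩ := Finset.card_le_one_iff_subset_singleton.1 hS
    simp only [pow_zero, one_mul, mul_one] at *
    have : U = C (U.coeff m) * X ^ m := by
      ext l
      rw [coeff_C_mul_X_pow]
      split_ifs with h
      · rw [h]
      · by_contra hc
        exact h (Finset.mem_singleton.1 (hm (hU (mem_support_iff.2 hc))))
    rw [this]
    simp [← Complex.exp_nat_mul, Complex.norm_exp]
  | succ k ih =>
    set G := (X - 1) ^ (k + 1) * U with hG
    rcases S.eq_empty_or_nonempty with rfl | ⟨m, hm⟩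
    · have : G = 0 := by rwa [Finset.subset_empty, support_eq_empty] at hU
      rw [this]
      simp only [eval_zero, norm_zero]
      positivity
    set U1 : ℂ[X] := C ((k : ℂ) + 1) * X * U + (X - 1) * (X * derivative U - C (m : ℂ) * U) with hU1
    have hG1 : (X - 1) ^ k * U1 = X * derivative G - C (m : ℂ) * G := by
      rw [hG, hU1, derivative_mul, derivative_pow]
      simp only [derivative_sub, derivative_X, derivative_one]
      simp
      ring
    have hsupp : ((X - 1) ^ k * U1).support ⊆ S.erase m := by
      intro l hl
      rw [hG1, mem_support_iff, coeff_sub, coeff_C_mul, ] at hl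
      have : (X * derivative G).coeff l = l * G.coeff l := by
        cases l with
        | zero => simp
        | succ l => rw [coeff_X_mul, coeff_derivative]; push_cast; ring
      rw [this, ← sub_mul] at hl
      refine Finset.mem_erase.2 ⟨?_, hU (mem_support_iff.2 (right_ne_zero_of_mul hl))⟩
      rintro rfl
      simp at hl
    have hcard : (S.erase m).card ≤ k + 1 := by
      rw [Finset.card_erase_of_mem hm]; omega
    have bound := fun {z : ℝ} (hz : 0 ≤ z) => ih U1 (S.erase m) hcard hsupp hz
    have hU1e : ‖U1.eval 1‖ = (k + 1) * ‖U.eval 1‖ := by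
      rw [hU1]
      simp
      left
      norm_cast
    set g : ℝ → ℂ := fun z => Complex.exp (-(m * (Complex.I * z))) *
      G.eval (Complex.exp (Complex.I * z)) with hg
    have hd : ∀ z : ℝ, HasDerivAt g (Complex.I * Complex.exp (-(m * (Complex.I * z))) *
        ((X - 1) ^ k * U1).eval (Complex.exp (Complex.I * z))) z := by
      intro z
      have h0 : HasDerivAt (fun z : ℝ => Complex.I * (z : ℂ)) Complex.I z := by
        simpa using (Complex.ofRealCLM.hasDerivAt (x := z)).const_mul Complex.I
      have h1 := ((h0.const_mul (m : ℂ)).neg).cexp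
      have h2 := (G.hasDerivAt (Complex.exp (Complex.I * z))).comp z h0.cexp
      refine (h1.mul h2).congr_deriv ?_
      rw [hG1]
      simp
      ring
    have ng : ∀ z, ‖g z‖ = ‖G.eval (Complex.exp (Complex.I * z))‖ := by
      intro z
      simp [hg, Complex.norm_exp]
    have := image_norm_le_of_norm_deriv_right_le_deriv_boundary (a := 0) (b := y) (f := g)
      (f' := fun z => Complex.I * Complex.exp (-(m * (Complex.I * z))) *
        ((X - 1) ^ k * U1).eval (Complex.exp (Complex.I * z)))
      (B := fun z => ‖U.eval 1‖ * z ^ (k + 1)) (B' := fun z => ‖U.eval 1‖ * ((k + 1) * z ^ k))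
      (fun z _ => (hd z).continuousAt.continuousWithinAt)
      (fun z _ => (hd z).hasDerivWithinAt)
      (by simp [hg, hG])
      (fun z => by simpa using (hasDerivAt_pow (k + 1) z).const_mul ‖U.eval 1‖)
      (fun z hz => by
        have := bound hz.1
        rw [hU1e] at this
        rw [norm_mul, norm_mul]
        simp only [Complex.norm_I, Complex.norm_exp]
        simp at this ⊢
        linarith)
      (x := y) ⟨hy, le_rfl⟩
    rw [ng] at this
    exact this

open Polynomial in
/-- Averaging over the cube roots of unity. -/
theorem eval_add_cube_roots {n : ℕ} {p : ℂ[X]} (hp : p.natDegree ≤ 3 * n + 1) {ζ : ℂ}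
    (hζ : ζ ^ 2 + ζ + 1 = 0) (w : ℂ) :
    p.eval w + ζ ^ 2 * p.eval (ζ ^ 2 * w) + ζ * p.eval (ζ * w) =
      3 * w ^ 2 * (∑ k ∈ Finset.range n, C (p.coeff (3 * k + 2)) * X ^ k).eval (w ^ 3) := by
  have h3 : ζ ^ 3 = 1 := by linear_combination (ζ - 1) * hζ
  have hsplit : ∀ (n : ℕ) (f : ℕ → ℂ), ∑ l ∈ Finset.range (3 * n + 2), f l =
      ∑ k ∈ Finset.range n, (f (3 * k) + f (3 * k + 1) + f (3 * k + 2)) +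
        f (3 * n) + f (3 * n + 1) := by
    intro n f
    induction n with
    | zero => simp [Finset.sum_range_succ]
    | succ n ih =>
      rw [show 3 * (n + 1) + 2 = 3 * n + 2 + 1 + 1 + 1 by ring, Finset.sum_range_succ,
        Finset.sum_range_succ, Finset.sum_range_succ, ih, Finset.sum_range_succ]
      simp only [show 3 * (n + 1) = 3 * n + 3 by ring]
      ring
  have hev : ∀ z, p.eval z = ∑ l ∈ Finset.range (3 * n + 2), p.coeff l * z ^ l :=
    fun z => eval_eq_sum_range' (by omega) z
  rw [hev, hev, hev, Finset.mul_sum, Finset.mul_sum, ← Finset.sum_add_distrib,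
    ← Finset.sum_add_distrib, hsplit, eval_finsetSum, Finset.mul_sum]
  have z0 : ∀ k, p.coeff (3 * k) * w ^ (3 * k) + ζ ^ 2 * (p.coeff (3 * k) * (ζ ^ 2 * w) ^ (3 * k))
      + ζ * (p.coeff (3 * k) * (ζ * w) ^ (3 * k)) = 0 := by
    intro k
    simp only [mul_pow, pow_mul]
    simp only [← pow_mul ζ, mul_comm 2 3]
    simp only [pow_mul ζ, h3, one_pow]
    linear_combination p.coeff (3 * k) * (w ^ 3) ^ k * hζ
  have z1 : ∀ k, p.coeff (3 * k + 1) * w ^ (3 * k + 1) + ζ ^ 2 * (p.coeff (3 * k + 1) *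
      (ζ ^ 2 * w) ^ (3 * k + 1)) + ζ * (p.coeff (3 * k + 1) * (ζ * w) ^ (3 * k + 1)) = 0 := by
    intro k
    simp only [mul_pow, pow_add, pow_mul, pow_one]
    simp only [← pow_mul ζ, mul_comm 2 3]
    simp only [pow_mul ζ, h3, one_pow]
    linear_combination p.coeff (3 * k + 1) * (w ^ 3) ^ k * w * (hζ + ζ * h3)
  have z2 : ∀ k, p.coeff (3 * k + 2) * w ^ (3 * k + 2) + ζ ^ 2 * (p.coeff (3 * k + 2) *
      (ζ ^ 2 * w) ^ (3 * k + 2)) + ζ * (p.coeff (3 * k + 2) * (ζ * w) ^ (3 * k + 2)) =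
      3 * w ^ 2 * (p.coeff (3 * k + 2) * (w ^ 3) ^ k) := by
    intro k
    simp only [mul_pow, pow_add, pow_mul]
    simp only [← pow_mul ζ, mul_comm 2 3]
    simp only [pow_mul ζ, h3, one_pow]
    linear_combination p.coeff (3 * k + 2) * (w ^ 3) ^ k * w ^ 2 * (h3 + (ζ ^ 3 + 1) * h3)
  simp only [z0, z1, z2]
  simp

open Polynomial Complex in
/-- `f` is a trigonometric polynomial of degree `d` (with the parity of `d`). -/
def IsTrigPoly (d : ℕ) (f : ℂ → ℂ) : Prop :=
  ∃ p : ℂ[X], p.natDegree ≤ d ∧ ∀ y, p.eval (exp (2 * I * y)) = exp (d * I * y) * f y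

theorem IsTrigPoly.mul {d e : ℕ} {f g : ℂ → ℂ} (hf : IsTrigPoly d f) (hg : IsTrigPoly e g) :
    IsTrigPoly (d + e) fun y => f y * g y := by
  obtain ⟨p, hp, h⟩ := hf
  obtain ⟨q, hq, h'⟩ := hg
  refine ⟨p * q, Polynomial.natDegree_mul_le.trans (add_le_add hp hq), fun y => ?_⟩
  rw [Polynomial.eval_mul, h, h', Nat.cast_add, add_mul, add_mul, Complex.exp_add]
  ring

theorem isTrigPoly_const (c : ℂ) : IsTrigPoly 0 fun _ => c :=
  ⟨Polynomial.C c, by simp, fun y => by simp⟩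

theorem isTrigPoly_sum {ι : Type*} (s : Finset ι) {d : ℕ} {f : ι → ℂ → ℂ}
    (h : ∀ i ∈ s, IsTrigPoly d (f i)) : IsTrigPoly d fun y => ∑ i ∈ s, f i y := by
  classical
  induction s using Finset.induction_on with
  | empty => exact ⟨0, by simp, fun y => by simp⟩
  | insert i s hi ih =>
    obtain ⟨p, hp, h1⟩ := h i (Finset.mem_insert_self i s)
    obtain ⟨q, hq, h2⟩ := ih fun j hj => h j (Finset.mem_insert_of_mem hj)
    refine ⟨p + q, Polynomial.natDegree_add_le_of_degree_le hp hq, fun y => ?_⟩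
    simp only [Polynomial.eval_add, h1, h2, Finset.sum_insert hi]
    ring

theorem isTrigPoly_prod {ι : Type*} (s : Finset ι) {d : ι → ℕ} {f : ι → ℂ → ℂ}
    (h : ∀ i ∈ s, IsTrigPoly (d i) (f i)) :
    IsTrigPoly (∑ i ∈ s, d i) fun y => ∏ i ∈ s, f i y := by
  classical
  induction s using Finset.induction_on with
  | empty => simpa using isTrigPoly_const 1
  | insert i s hi ih =>
    simp only [Finset.sum_insert hi, Finset.prod_insert hi]
    exact (h i (Finset.mem_insert_self i s)).mul
      (ih fun j hj => h j (Finset.mem_insert_of_mem hj))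

open Polynomial Complex in
theorem isTrigPoly_sin_sub (α : ℂ) : IsTrigPoly 1 fun y => sin (α - y) := by
  refine ⟨C (-(I / 2) * exp (α * I)) + C (I / 2 * exp (-α * I)) * X,
    (natDegree_add_le_of_degree_le (by rw [natDegree_C]; omega)
      ((natDegree_C_mul_le _ _).trans natDegree_X_le)),
    fun y => ?_⟩
  simp only [eval_add, eval_C, eval_mul, eval_X, sin]
  have e1 : exp (-(α - y) * I) = exp (-α * I) * exp (I * y) := by
    rw [← exp_add]; congr 1; ring
  have e2 : exp ((α - y) * I) = exp (α * I) * exp (-(I * y)) := by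
    rw [← exp_add]; congr 1; ring
  have e3 : exp (2 * I * y) = exp (I * y) ^ 2 := by
    rw [← exp_nat_mul]; congr 1; push_cast; ring
  have e4 : exp (-(I * y)) * exp (I * y) = 1 := by rw [← exp_add]; simp
  rw [e1, e2, e3]
  push_cast
  simp only [one_mul]
  linear_combination (- (I / 2) * exp (α * I)) * (-e4)

theorem isTrigPoly_wtA (x : ℂ) : IsTrigPoly 1 fun y => wtA (x - y) := by
  convert isTrigPoly_sin_sub (Real.pi / 3 + x) using 3
  rw [wtA]
  congr 1
  ring

theorem isTrigPoly_wtB (x : ℂ) : IsTrigPoly 1 fun y => wtB (x - y) := by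
  convert isTrigPoly_sin_sub (2 * Real.pi / 3 + x) using 3 with y
  rw [wtB, ← Complex.sin_pi_sub]
  congr 1
  ring

theorem dwPart_eq_sum {N : ℕ} (y x : Fin N → ℂ) : dwPart y (List.ofFn x) =
    ∑ C ∈ corners N, cornerWt (fun i l => wtA (x i - y l)) (fun i l => wtB (x i - y l)) wtC C := by
  rw [← prod_rowOp_eq_sum, dwPart, List.map_ofFn]
  rfl

/-- The row of the unique nonzero entry in the first column. -/
theorem IsCornerSum.exists_first {n : ℕ} {C : ℕ → ℕ → ℤ} (h : IsCornerSum (n + 1) C) :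
    ∃ a : Fin (n + 1), ∀ i ≤ n + 1, C i 1 = if i ≤ a then 0 else 1 := by
  have h1 : C (n + 1) 1 = 1 := by simpa using h.bot 1 (by omega)
  have hex : ∃ m, C (m + 1) 1 = 1 := ⟨n, h1⟩
  classical
  refine ⟨⟨Nat.find hex, ?_⟩, fun i hi => ?_⟩
  · have := Nat.find_le (n := n) (h := hex) h1
    omega
  · have mono : ∀ j k, j + k ≤ n + 1 → C j 1 ≤ C (j + k) 1 := by
      intro j k
      induction k with
      | zero => simp
      | succ k ih =>
        intro hk
        have := h.ver (j + k) (by omega) 1 (by omega)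
        have := ih (by omega)
        rw [← add_assoc]
        omega
    have h01 : C i 1 = 0 ∨ C i 1 = 1 := by
      have := h.hor i hi 0 (by omega)
      simpa [h.left] using this
    split_ifs with hia
    · rcases h01 with h01 | h01
      · exact h01
      · exfalso
        rcases i with _ | i
        · simp [h.top] at h01
        · have := Nat.find_min' hex h01
          simp only at hia
          omega
    · have h2 := Nat.find_spec hex
      have := mono (Nat.find hex + 1) (i - (Nat.find hex + 1)) (by simp only at hia; omega)
      rw [show Nat.find hex + 1 + (i - (Nat.find hex + 1)) = i by simp only at hia; omega] at this
      omega

theorem vertexWt_first {n : ℕ} {C : ℕ → ℕ → ℤ} (h : IsCornerSum (n + 1) C) {a : Fin (n + 1)}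
    (ha : ∀ i ≤ n + 1, C i 1 = if i ≤ a then 0 else 1) (i : Fin (n + 1)) (p q c : ℂ) :
    vertexWt p q c (cornerV C i 0) (cornerV C (i + 1) 0) (cornerH C i 0) =
      if i < a then p else if i = a then c else q := by
  have h1 := ha i (by omega)
  have h2 := ha (i + 1) (by omega)
  simp only [vertexWt, cornerV, cornerH, h.left, h1, h2, zero_add, Fin.lt_def, Fin.ext_iff]
  have := i.2
  rcases lt_trichotomy (i : ℕ) a with hlt | heq | hgt
  · simp [hlt, hlt.le, Nat.succ_le_of_lt hlt]
  · simp [heq]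
  · simp [hgt.not_gt, hgt.not_ge, hgt.ne']

theorem isTrigPoly_dwPart {n : ℕ} (x : Fin (n + 1) → ℂ) (y : Fin n → ℂ) :
    IsTrigPoly n fun y0 => dwPart (Fin.cons y0 y) (List.ofFn x) := by
  simp only [dwPart_eq_sum]
  refine isTrigPoly_sum _ fun C hC => ?_
  rw [mem_corners] at hC
  obtain ⟨a, ha⟩ := hC.exists_first
  have e : ∑ i : Fin (n + 1), (if i = a then 0 else 1) = n := by
    rw [Finset.sum_ite]
    simp [Finset.filter_ne']
  have main := isTrigPoly_prod Finset.univ (d := fun i : Fin (n + 1) => if i = a then 0 else 1)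
    (f := fun i y0 => if i < a then wtA (x i - y0) else if i = a then wtC else wtB (x i - y0))
    fun i _ => by
      rcases lt_trichotomy i a with hlt | heq | hgt
      · simpa [hlt, hlt.ne] using isTrigPoly_wtA (x i)
      · simpa [heq] using isTrigPoly_const wtC
      · simpa [hgt.not_gt, hgt.ne'] using isTrigPoly_wtB (x i)
  rw [e] at main
  have := main.mul (isTrigPoly_const (∏ i : Fin (n + 1), ∏ l : Fin n, vertexWt (wtA (x i - y l))
    (wtB (x i - y l)) wtC (cornerV C i (l + 1)) (cornerV C (i + 1) (l + 1))
    (cornerH C i (l + 1))))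
  rw [add_zero] at this
  convert this using 2 with y0
  rw [cornerWt, ← Finset.prod_mul_distrib]
  refine Finset.prod_congr rfl fun i _ => ?_
  rw [Fin.prod_univ_succ, Fin.val_zero, vertexWt_first hC ha]
  rfl

open Complex in
/-- The partition function, times the sines which make its shifts by `2π/3` sum to zero. -/
noncomputable def dwAux {n : ℕ} (x : Fin (n + 1) → ℂ) (y : ℂ) : ℂ :=
  dwPart (Fin.cons y (0 : Fin n → ℂ)) (List.ofFn x) * (sin (0 - y) ^ n * ∏ i, sin (x i - y))

theorem ofFn_perm_succAbove {α : Type*} {n : ℕ} (x : Fin (n + 1) → α) (j : Fin (n + 1)) :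
    (List.ofFn x).Perm (x j :: List.ofFn fun i => x (j.succAbove i)) := by
  rw [← Multiset.coe_eq_coe, ← Multiset.cons_coe]
  have (m : ℕ) (f : Fin m → α) : (List.ofFn f : Multiset α) = Finset.univ.val.map f := by
    rw [Fin.univ_val_map]
  rw [this, this, Fin.univ_succAbove n j]
  simp [Function.comp_def]

open Complex in
theorem dwAux_sub_add {n : ℕ} {x : Fin (n + 1) → ℂ} (hx : ∀ i i', wtA (x i - x i') ≠ 0)
    (j : Fin (n + 1)) : dwAux x (x j - Real.pi / 3) = -dwAux x (x j + Real.pi / 3) := by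
  have hx' : ∀ z ∈ List.ofFn x, ∀ z' ∈ List.ofFn x, wtA (z - z') ≠ 0 := by
    simp only [List.mem_ofFn]
    rintro _ ⟨i, rfl⟩ _ ⟨i', rfl⟩
    exact hx i i'
  have perm := ofFn_perm_succAbove x j
  have e1 := dwPart_perm (Fin.cons (x j + Real.pi / 3) (0 : Fin n → ℂ)) perm hx'
  have e2 := dwPart_perm (Fin.cons (x j - Real.pi / 3) (0 : Fin n → ℂ))
    (perm.trans (List.perm_append_singleton _ _).symm) hx'
  rw [dwPart_cons_of_wtA_eq_zero _ _ (by rw [wtA]; ring_nf; simp)] at e1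
  rw [dwPart_append_of_wtB_eq_zero _ _ (by rw [wtB]; ring_nf; simp)] at e2
  rw [dwAux, dwAux, e1, e2, Fin.prod_univ_succAbove _ j, Fin.prod_univ_succAbove _ j]
  simp only [Pi.zero_apply, sub_zero, Finset.prod_const, Finset.card_univ, Fintype.card_fin,
    List.map_ofFn, List.prod_ofFn, Function.comp_def]
  have f1 : ∀ i, wtB (x (j.succAbove i) - (x j + Real.pi / 3)) =
      sin (x (j.succAbove i) - (x j - Real.pi / 3)) := fun i => by
    rw [wtB, ← sin_pi_sub]; congr 1; ring
  have f2 : ∀ i, wtA (x (j.succAbove i) - (x j - Real.pi / 3)) =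
      - sin (x (j.succAbove i) - (x j + Real.pi / 3)) := fun i => by
    rw [wtA, ← sin_neg, ← sin_pi_sub]; congr 1; ring
  have f3 : sin (x j - (x j - Real.pi / 3)) = sin (Real.pi / 3) := by ring_nf
  have f4 : sin (x j - (x j + Real.pi / 3)) = - sin (Real.pi / 3) := by
    rw [← sin_neg]; ring_nf
  have f5 : sin (0 - (x j - Real.pi / 3)) = wtB (x j) := by rw [wtB]; ring_nf
  have f6 : sin (0 - (x j + Real.pi / 3)) = - wtA (x j) := by rw [wtA, ← sin_neg]; ring_nf
  have f7 : (-1 : ℂ) ^ n * (-1) ^ n = 1 := by rw [← mul_pow]; simp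
  simp only [f1, f2, f3, f4, f5, f6, Finset.prod_neg, Finset.card_univ, Fintype.card_fin,
    neg_pow (wtA (x j)) n]
  ring

theorem dwAux_add_pi {n : ℕ} (x : Fin (n + 1) → ℂ) (j : Fin (n + 1)) :
    dwAux x (x j + Real.pi) = 0 := by
  rw [dwAux, Finset.prod_eq_zero (Finset.mem_univ j), mul_zero, mul_zero]
  rw [sub_add_cancel_left, Complex.sin_neg, Complex.sin_pi, neg_zero]

theorem isTrigPoly_dwAux {n : ℕ} (x : Fin (n + 1) → ℂ) : IsTrigPoly (3 * n + 1) (dwAux x) := by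
  have h1 := isTrigPoly_prod Finset.univ (f := fun (_ : Fin n) y => Complex.sin (0 - y))
    fun _ _ => isTrigPoly_sin_sub 0
  have h2 := isTrigPoly_prod Finset.univ fun i _ => isTrigPoly_sin_sub (x i)
  have h := (isTrigPoly_dwPart x 0).mul (h1.mul h2)
  simp only [Finset.sum_const, Finset.card_univ, Fintype.card_fin, Finset.prod_const] at h
  convert h using 1
  · simp
    ring
  · rfl

theorem exp_two_pi_div_three : Complex.exp (2 * Complex.I * (Real.pi / 3)) ^ 2 +
    Complex.exp (2 * Complex.I * (Real.pi / 3)) + 1 = 0 := by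
  have h3 : Complex.exp (2 * Complex.I * (Real.pi / 3)) ^ 3 = 1 := by
    rw [← Complex.exp_nat_mul, ← Complex.exp_two_pi_mul_I]
    congr 1
    push_cast
    ring
  have h1 : Complex.exp (2 * Complex.I * (Real.pi / 3)) ≠ 1 := by
    intro h
    have := congrArg Complex.im h
    rw [show 2 * Complex.I * (Real.pi / 3) = ((2 * Real.pi / 3 : ℝ) : ℂ) * Complex.I by
      push_cast; ring, Complex.exp_ofReal_mul_I_im, Complex.one_im] at this
    have := Real.sin_pos_of_pos_of_lt_pi (x := 2 * Real.pi / 3) (by positivity)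
      (by linarith [Real.pi_pos])
    linarith
  have : (Complex.exp (2 * Complex.I * (Real.pi / 3)) - 1) *
    (Complex.exp (2 * Complex.I * (Real.pi / 3)) ^ 2 +
      Complex.exp (2 * Complex.I * (Real.pi / 3)) + 1) = 0 := by
    linear_combination h3
  exact (mul_eq_zero.1 this).resolve_left (sub_ne_zero.2 h1)

open Polynomial Complex in
/-- The sum of the shifts of a trigonometric polynomial by multiples of `2π/3`. -/
theorem IsTrigPoly.exists_sum_shift {n : ℕ} {f : ℂ → ℂ} (hf : IsTrigPoly (3 * n + 1) f) :
    ∃ p : ℂ[X], p.natDegree ≤ 3 * n + 1 ∧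
      (∀ y, p.eval (exp (2 * I * y)) = exp ((3 * n + 1 : ℕ) * I * y) * f y) ∧
      ∀ y, exp ((3 * n + 1 : ℕ) * I * y) *
        (f y + f (y + 2 * Real.pi / 3) + f (y + 4 * Real.pi / 3)) =
      3 * exp (2 * I * y) ^ 2 *
        (∑ k ∈ Finset.range n, C (p.coeff (3 * k + 2)) * X ^ k).eval (exp (2 * I * y) ^ 3) := by
  obtain ⟨p, hp, h⟩ := hf
  refine ⟨p, hp, h, fun y => ?_⟩
  rw [← eval_add_cube_roots hp exp_two_pi_div_three]
  set ζ := exp (2 * I * (Real.pi / 3)) with hζ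
  have h3 : ζ ^ 3 = 1 := by linear_combination (ζ - 1) * exp_two_pi_div_three
  have e1 : ζ ^ 2 * exp (2 * I * y) = exp (2 * I * (y + 2 * Real.pi / 3)) := by
    rw [hζ, ← exp_nat_mul, ← exp_add]
    congr 1; push_cast; ring
  have e2 : ζ * exp (2 * I * y) = exp (2 * I * (y + 4 * Real.pi / 3)) := by
    rw [← one_mul (ζ * _), ← exp_two_pi_mul_I, hζ, ← exp_add, ← exp_add]
    congr 1; ring
  have e3 : exp ((3 * n + 1 : ℕ) * I * (y + 2 * Real.pi / 3)) =
      ζ * exp ((3 * n + 1 : ℕ) * I * y) := by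
    rw [← one_mul (ζ * _), ← exp_nat_mul_two_pi_mul_I n, hζ, ← exp_add, ← exp_add]
    congr 1; push_cast; ring
  have e4 : exp ((3 * n + 1 : ℕ) * I * (y + 4 * Real.pi / 3)) =
      ζ ^ 2 * exp ((3 * n + 1 : ℕ) * I * y) := by
    rw [← one_mul (ζ ^ 2 * _), ← exp_nat_mul_two_pi_mul_I (2 * n), hζ, ← exp_nat_mul, ← exp_add,
      ← exp_add]
    congr 1; push_cast; ring
  rw [e1, e2, h, h, h, e3, e4]
  linear_combination (- exp ((3 * n + 1 : ℕ) * I * y) *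
        (f (y + 2 * Real.pi / 3) + f (y + 4 * Real.pi / 3))) * h3

open Polynomial Complex in
theorem eq_zero_of_eval_exp {n : ℕ} {c : ℕ → ℂ} {ε : ℝ} (h0 : 0 < ε) (h1 : ε * (n + 1) ≤ 1 / 2)
    (h : ∀ j : Fin (n + 1),
      (∑ k ∈ Finset.range n, C (c k) * X ^ k).eval (exp (2 * I * (ε * j - Real.pi / 3)) ^ 3) = 0) :
    ∀ k < n, c k = 0 := by
  have hz : ∑ k ∈ Finset.range n, C (c k) * X ^ k = 0 := by
    refine eq_zero_of_natDegree_lt_card_of_eval_eq_zero _ ?_ h ?_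
    · intro i j hij
      have e : ∀ j : Fin (n + 1), exp (2 * I * (ε * j - Real.pi / 3)) ^ 3 =
          exp (((6 * ε * j : ℝ) : ℂ) * I) := fun j => by
        rw [← one_mul (exp _ ^ 3), ← exp_two_pi_mul_I, ← exp_nat_mul, ← exp_add]
        congr 1; push_cast; ring
      have b : ∀ j : Fin (n + 1), 0 ≤ 6 * ε * j ∧ 6 * ε * j ≤ 3 := fun j => by
        have : (j : ℝ) ≤ n + 1 := by exact_mod_cast j.2.le
        constructor
        · positivity
        · nlinarith
      simp only [e] at hij
      have := exp_inj_of_neg_pi_lt_of_le_pi (x := ((6 * ε * i : ℝ) : ℂ) * I)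
        (y := ((6 * ε * j : ℝ) : ℂ) * I) ?_ ?_ ?_ ?_ hij
      · have h2 := mul_right_cancel₀ I_ne_zero this
        have h2 : 6 * ε * (i : ℝ) = 6 * ε * j := by exact_mod_cast h2
        have h3 := mul_left_cancel₀ (by positivity) h2
        exact Fin.ext (by exact_mod_cast h3)
      all_goals
        have := b i
        have := b j
        have := Real.pi_gt_three
        simp
        linarith
    · rw [Fintype.card_fin]
      refine Nat.lt_succ_of_le (natDegree_sum_le_of_forall_le _ _ fun k hk => ?_)
      exact (natDegree_C_mul_X_pow_le _ _).trans (Finset.mem_range.1 hk).le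
  intro k hk
  have := congrArg (coeff · k) hz
  simpa [finsetSum_coeff, coeff_C_mul, coeff_X_pow, hk] using this

theorem wtA_ofReal_ne_zero {u : ℝ} (h1 : -(1 / 2) ≤ u) (h2 : u ≤ 1 / 2) : wtA u ≠ 0 := by
  rw [wtA, show (Real.pi : ℂ) / 3 + u = ((Real.pi / 3 + u : ℝ) : ℂ) by push_cast; ring,
    ← Complex.ofReal_sin]
  exact_mod_cast (Real.sin_pos_of_pos_of_lt_pi (by linarith [Real.pi_gt_three])
    (by linarith [Real.pi_gt_three])).ne'

theorem sum_dwAux_shift {n : ℕ} {ε : ℝ} (h0 : 0 < ε) (h1 : ε * (n + 1) ≤ 1 / 2) (y : ℂ) :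
    dwAux (fun i : Fin (n + 1) => (ε * i : ℂ)) y +
      dwAux (fun i : Fin (n + 1) => (ε * i : ℂ)) (y + 2 * Real.pi / 3) +
      dwAux (fun i : Fin (n + 1) => (ε * i : ℂ)) (y + 4 * Real.pi / 3) = 0 := by
  obtain ⟨p, -, -, hT⟩ := (isTrigPoly_dwAux fun i : Fin (n + 1) => (ε * i : ℂ)).exists_sum_shift
  have hx : ∀ i i' : Fin (n + 1), wtA ((ε * i : ℂ) - ε * i') ≠ 0 := by
    intro i i'
    have b : ∀ j : Fin (n + 1), 0 ≤ ε * j ∧ ε * j ≤ 1 / 2 := fun j => by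
      have : (j : ℝ) ≤ n + 1 := by exact_mod_cast j.2.le
      constructor
      · positivity
      · nlinarith
    have := b i
    have := b i'
    have := wtA_ofReal_ne_zero (u := ε * i - ε * i') (by linarith) (by linarith)
    push_cast at this
    exact this
  have hc := eq_zero_of_eval_exp (c := fun k => p.coeff (3 * k + 2)) h0 h1 fun j => by
    have e := hT (ε * j - Real.pi / 3)
    have e1 := dwAux_sub_add hx j
    have e2 := dwAux_add_pi (fun i : Fin (n + 1) => (ε * i : ℂ)) j
    rw [e1, show (ε * j - Real.pi / 3 + 2 * Real.pi / 3 : ℂ) = ε * j + Real.pi / 3 by ring,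
      show (ε * j - Real.pi / 3 + 4 * Real.pi / 3 : ℂ) = ε * j + Real.pi by ring, e2] at e
    rw [neg_add_cancel, zero_add, mul_zero] at e
    refine (mul_eq_zero.1 e.symm).resolve_left ?_
    simp [Complex.exp_ne_zero]
  have e := hT y
  rw [Finset.sum_eq_zero fun k hk => by rw [hc k (Finset.mem_range.1 hk)]; simp] at e
  rw [Polynomial.eval_zero, mul_zero] at e
  exact (mul_eq_zero.1 e).resolve_left (Complex.exp_ne_zero _)

theorem continuous_vertexWt {α : Type*} [TopologicalSpace α] {f g : α → ℂ} (hf : Continuous f)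
    (hg : Continuous g) (c : ℂ) (s t h : Bool) :
    Continuous fun z => vertexWt (f z) (g z) c s t h := by
  unfold vertexWt
  split_ifs
  exacts [hf, hg, continuous_const]

theorem continuous_dwAux {n : ℕ} (y : ℂ) :
    Continuous fun x : Fin (n + 1) → ℂ => dwAux x y := by
  simp only [dwAux, dwPart_eq_sum, cornerWt]
  refine .mul (continuous_finsetSum _ fun C _ => continuous_finsetProd _ fun i _ =>
    continuous_finsetProd _ fun l _ => continuous_vertexWt ?_ ?_ _ _ _ _) ?_
  · unfold wtA; fun_prop
  · unfold wtB; fun_prop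
  · fun_prop

theorem sum_dwAux_zero_shift (n : ℕ) (y : ℂ) : dwAux (0 : Fin (n + 1) → ℂ) y +
    dwAux (0 : Fin (n + 1) → ℂ) (y + 2 * Real.pi / 3) +
      dwAux (0 : Fin (n + 1) → ℂ) (y + 4 * Real.pi / 3) = 0 := by
  have hcont : Continuous fun ε : ℝ => dwAux (fun i : Fin (n + 1) => (ε * i : ℂ)) y +
      dwAux (fun i : Fin (n + 1) => (ε * i : ℂ)) (y + 2 * Real.pi / 3) +
      dwAux (fun i : Fin (n + 1) => (ε * i : ℂ)) (y + 4 * Real.pi / 3) := by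
    have hx : Continuous fun (ε : ℝ) (i : Fin (n + 1)) => (ε * i : ℂ) := by fun_prop
    exact (((continuous_dwAux _).comp hx).add ((continuous_dwAux _).comp hx)).add
      ((continuous_dwAux _).comp hx)
  have h1 := (hcont.tendsto 0).mono_left (nhdsWithin_le_nhds (s := Set.Ioi 0))
  have h2 : ∀ᶠ ε : ℝ in nhdsWithin 0 (Set.Ioi 0), ε * (n + 1) ≤ 1 / 2 := by
    have : Filter.Tendsto (fun ε : ℝ => ε * (n + 1)) (nhdsWithin 0 (Set.Ioi 0)) (nhds 0) := by
      have h : Continuous fun ε : ℝ => ε * ((n : ℝ) + 1) := by fun_prop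
      have := (h.tendsto 0).mono_left (nhdsWithin_le_nhds (s := Set.Ioi 0))
      rwa [zero_mul] at this
    exact this.eventually (Iic_mem_nhds (by norm_num))
  have h3 := h1.congr' (f₂ := fun _ => 0) (by
    filter_upwards [h2, self_mem_nhdsWithin] with ε h h'
    exact sum_dwAux_shift h' h y)
  have h4 := tendsto_nhds_unique h3 tendsto_const_nhds
  have e : (fun i : Fin (n + 1) => (((0 : ℝ) : ℂ) * ((i : ℕ) : ℂ))) = 0 := by
    funext i; simp
  simpa only [e] using h4

/-- The bound on the homogeneous partition function with one inhomogeneous column. -/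
theorem norm_dwPart_mul_le (n : ℕ) {y : ℝ} (hy : 0 ≤ y) :
    ‖dwPart (Fin.cons (y : ℂ) (0 : Fin n → ℂ)) (List.ofFn (0 : Fin (n + 1) → ℂ))‖ *
        |Real.sin y| ^ (2 * n + 1) ≤
      ‖dwPart (Fin.cons 0 (0 : Fin n → ℂ)) (List.ofFn (0 : Fin (n + 1) → ℂ))‖ *
        y ^ (2 * n + 1) := by
  open Polynomial Complex in
  obtain ⟨p, hp, h, hT⟩ := (isTrigPoly_dwAux (0 : Fin (n + 1) → ℂ)).exists_sum_shift
  simp only [sum_dwAux_zero_shift, mul_zero] at hT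
  have hc := eq_zero_of_eval_exp (c := fun k => p.coeff (3 * k + 2)) (n := n)
    (ε := 1 / (2 * (n + 1))) (by positivity) (le_of_eq (by field_simp)) fun j => by
    refine (mul_eq_zero.1 (hT _).symm).resolve_left ?_
    simp [Complex.exp_ne_zero]
  obtain ⟨U, hU, hUe⟩ := isTrigPoly_dwPart (0 : Fin (n + 1) → ℂ) (0 : Fin n → ℂ)
  set Z : ℂ → ℂ := fun y => dwPart (Fin.cons y (0 : Fin n → ℂ))
    (List.ofFn (0 : Fin (n + 1) → ℂ)) with hZ
  -- `2 I exp (I y) sin y = exp (2 I y) - 1`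
  have hsin : ∀ y : ℂ, exp (2 * I * y) - 1 = -(2 * I * exp (I * y)) * sin (0 - y) := fun y => by
    rw [zero_sub, sin_neg, sin]
    have e1 : exp (2 * I * y) = exp (I * y) * exp (I * y) := by
      rw [← exp_add]; congr 1; ring
    have e2 : exp (-y * I) * exp (I * y) = 1 := by rw [← exp_add]; ring_nf; simp
    have e3 : exp (y * I) = exp (I * y) := by rw [mul_comm]
    rw [e3, e1]
    linear_combination e2 - (exp (-y * I) * exp (I * y) - exp (I * y) * exp (I * y)) * I_sq
  have hpU : ∀ y : ℂ, ((X - 1) ^ (2 * n + 1) * U).eval (exp (2 * I * y)) =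
      (C ((-(2 * I)) ^ (2 * n + 1)) * p).eval (exp (2 * I * y)) := fun y => by
    have e : exp ((3 * n + 1 : ℕ) * I * y) = exp (I * y) ^ (2 * n + 1) * exp (n * I * y) := by
      rw [← exp_nat_mul, ← exp_add]; congr 1; push_cast; ring
    simp only [eval_mul, eval_pow, eval_sub, eval_X, eval_one, eval_C, h, hUe, hsin, dwAux, e,
      Pi.zero_apply, Finset.prod_const, Finset.card_univ, Fintype.card_fin]
    ring
  have heq : (X - 1) ^ (2 * n + 1) * U = C ((-(2 * I)) ^ (2 * n + 1)) * p := by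
    refine Polynomial.eq_of_infinite_eval_eq _ _ (Set.Infinite.mono ?_
      ((Set.finite_singleton (0 : ℂ)).infinite_compl))
    intro z hz
    have : z = exp (2 * I * (log z / (2 * I))) := by
      rw [mul_div_cancel₀ _ (by simp), exp_log hz]
    rw [this]
    exact hpU _
  have key := norm_eval_exp_le (2 * n + 1) U ((Finset.range (n + 1)).image (3 * ·) ∪
    (Finset.range (n + 1)).image (3 * · + 1)) ?_ ?_ (show 0 ≤ 2 * y by positivity)
  · have e1 : exp (I * ((2 * y : ℝ) : ℂ)) = exp (2 * I * y) := by
      congr 1; push_cast; ring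
    have e2 : U.eval 1 = Z 0 := by simpa using hUe 0
    have e3 : ‖exp (2 * I * y) - 1‖ = 2 * |Real.sin y| := by
      rw [hsin, show I * (y : ℂ) = y * I by ring]
      simp only [zero_sub, sin_neg, norm_mul, norm_neg, norm_exp_ofReal_mul_I]
      simp [← ofReal_sin, norm_real]
    rw [e1, e2, eval_mul, hUe] at key
    simp only [eval_pow, eval_sub, eval_X, eval_one, norm_mul, norm_pow, e3] at key
    rw [show (n : ℂ) * I * y = ((n * y : ℝ) : ℂ) * I by push_cast; ring, norm_exp_ofReal_mul_I,
      one_mul, mul_pow, mul_pow] at key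
    have h2 : (0 : ℝ) < 2 ^ (2 * n + 1) := by positivity
    refine le_of_mul_le_mul_left ?_ h2
    calc _ = 2 ^ (2 * n + 1) * |Real.sin y| ^ (2 * n + 1) * ‖Z y‖ := by ring
      _ ≤ _ := key
      _ = _ := by ring
  · refine (Finset.card_union_le _ _).trans ?_
    have h1 := Finset.card_image_le (s := Finset.range (n + 1)) (f := (3 * ·))
    have h2 := Finset.card_image_le (s := Finset.range (n + 1)) (f := (3 * · + 1))
    rw [Finset.card_range] at h1 h2
    omega
  · intro l hl
    rw [heq, mem_support_iff, coeff_C_mul] at hl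
    have hl := right_ne_zero_of_mul hl
    have h1 : l ≤ 3 * n + 1 := (le_natDegree_of_ne_zero hl).trans hp
    have h2 : l % 3 ≠ 2 := fun h3 => hl (by
      have := hc (l / 3) (by omega)
      rwa [show 3 * (l / 3) + 2 = l by omega] at this)
    simp only [Finset.mem_union, Finset.mem_image, Finset.mem_range]
    rcases (by omega : l % 3 = 0 ∨ l % 3 = 1) with h3 | h3
    · exact Or.inl ⟨l / 3, by omega, by omega⟩
    · exact Or.inr ⟨l / 3, by omega, by omega⟩

/-! ### Monotone triangles -/

/-- Monotone triangles: `X a b` is entry number `a` of the row with `a + b + 1` entries. -/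
structure IsMonotoneTriangle (N : ℕ) (X : ℕ → ℕ → ℤ) : Prop where
  le_left : ∀ a b, a + b + 1 < N → X a (b + 1) ≤ X a b
  le_right : ∀ a b, a + b + 1 < N → X a b ≤ X (a + 1) b
  lt : ∀ a b, a + b + 1 < N → X a (b + 1) < X (a + 1) b
  bot : ∀ a b, a + b + 1 = N → X a b = a
  out : ∀ a b, N ≤ a + b → X a b = 0

theorem lt_card_filter_range_iff {P : ℕ → Prop} [DecidablePred P] {N : ℕ}
    (hP : ∀ m, m + 1 < N → P (m + 1) → P m) {m : ℕ} (hm : m < N) :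
    m < ((Finset.range N).filter P).card ↔ P m := by
  induction N with
  | zero => omega
  | succ N ih =>
    rw [Finset.range_add_one, Finset.filter_insert]
    have ih' := ih fun m hm => hP m (by omega)
    split_ifs with h
    · have all : ∀ k ≤ N, P (N - k) := by
        intro k
        induction k with
        | zero => simpa using h
        | succ k ihk =>
          intro hk
          refine hP _ (by omega) ?_
          rw [show N - (k + 1) + 1 = N - k by omega]
          exact ihk (by omega)
      rw [Finset.card_insert_of_notMem (by simp), Finset.filter_true_of_mem, Finset.card_range]
      · simpa [hm] using (by simpa [show N - (N - m) = m by omega] using all (N - m) (by omega))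
      · intro k hk
        have := Finset.mem_range.1 hk
        simpa [show N - (N - k) = k by omega] using all (N - k) (by omega)
    · rcases Nat.lt_succ_iff_lt_or_eq.1 hm with hm | rfl
      · exact ih' hm
      · refine iff_of_false ?_ h
        have := Finset.card_filter_le (Finset.range m) P
        rw [Finset.card_range] at this
        omega

theorem IsCornerSum.nonneg {N : ℕ} {C : ℕ → ℕ → ℤ} (h : IsCornerSum N C) {j m : ℕ} (hj : j ≤ N)
    (hm : m ≤ N) : 0 ≤ C j m := by
  induction m with
  | zero => rw [h.left]
  | succ m ih =>
    have := h.hor j hj m (by omega)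
    have := ih (by omega)
    omega

theorem IsCornerSum.le {N : ℕ} {C : ℕ → ℕ → ℤ} (h : IsCornerSum N C) {j m : ℕ} (hj : j ≤ N)
    (hm : m ≤ N) : C j m ≤ j := by
  induction j with
  | zero => simp [h.top]
  | succ j ih =>
    have := h.ver j (by omega) m hm
    have := ih (by omega)
    push_cast
    omega

/-- The monotone triangle of a corner sum matrix. -/
def triangleOf (N : ℕ) (C : ℕ → ℕ → ℤ) (a b : ℕ) : ℤ :=
  if a + b < N then ((Finset.range N).filter fun m => C (a + b + 1) (m + 1) ≤ a).card else 0

theorem IsCornerSum.triangleOf_nonneg (N : ℕ) (C : ℕ → ℕ → ℤ) (a b : ℕ) :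
    0 ≤ triangleOf N C a b := by
  unfold triangleOf
  split_ifs <;> simp

theorem IsCornerSum.triangleOf_lt_iff {N : ℕ} {C : ℕ → ℕ → ℤ} (h : IsCornerSum N C) {a b m : ℕ}
    (hab : a + b < N) (hm : m ≤ N) : triangleOf N C a b < m ↔ (a : ℤ) < C (a + b + 1) m := by
  rcases m with _ | m
  · have := IsCornerSum.triangleOf_nonneg N C a b
    simp only [h.left, Nat.cast_zero]
    omega
  · have := lt_card_filter_range_iff (P := fun m => C (a + b + 1) (m + 1) ≤ a) (N := N)
      (fun m hm' h' => by
        have := h.hor (a + b + 1) (by omega) (m + 1) (by omega)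
        omega) (m := m) (by omega)
    rw [triangleOf, if_pos hab, ← not_le (a := C _ _), ← this]
    omega

theorem IsCornerSum.isMonotoneTriangle {N : ℕ} {C : ℕ → ℕ → ℤ} (h : IsCornerSum N C) :
    IsMonotoneTriangle N (triangleOf N C) := by
  have bound : ∀ a b, a + b < N → ∃ Y : ℕ, triangleOf N C a b = Y ∧ Y < N := by
    intro a b hab
    obtain ⟨Y, hY⟩ := Int.eq_ofNat_of_zero_le (IsCornerSum.triangleOf_nonneg N C a b)
    refine ⟨Y, hY, ?_⟩
    have := (h.triangleOf_lt_iff hab le_rfl).2 (by rw [h.right _ (by omega)]; push_cast; omega)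
    omega
  refine ⟨fun a b hab => ?_, fun a b hab => ?_, fun a b hab => ?_, fun a b hab => ?_,
    fun a b hab => by simp [triangleOf, hab]⟩
  · obtain ⟨Y, hY, hYN⟩ := bound a b (by omega)
    have h1 := h.triangleOf_lt_iff (a := a) (b := b) (m := Y + 1) (by omega) (by omega)
    have h2 := h.triangleOf_lt_iff (a := a) (b := b + 1) (m := Y + 1) (by omega) (by omega)
    have h3 := h.ver (a + b + 1) (by omega) (Y + 1) (by omega)
    rw [← add_assoc] at h2
    push_cast at *
    omega
  · obtain ⟨Y, hY, hYN⟩ := bound (a + 1) b (by omega)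
    have h1 := h.triangleOf_lt_iff (a := a) (b := b) (m := Y + 1) (by omega) (by omega)
    have h2 := h.triangleOf_lt_iff (a := a + 1) (b := b) (m := Y + 1) (by omega) (by omega)
    have h3 := h.ver (a + b + 1) (by omega) (Y + 1) (by omega)
    rw [show a + 1 + b + 1 = a + b + 1 + 1 by omega] at h2
    push_cast at *
    omega
  · obtain ⟨Y, hY, hYN⟩ := bound (a + 1) b (by omega)
    have h1 := h.triangleOf_lt_iff (a := a) (b := b + 1) (m := Y) (by omega) (by omega)
    have h2 := h.triangleOf_lt_iff (a := a + 1) (b := b) (m := Y + 1) (by omega) (by omega)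
    have h3 := h.hor (a + b + 1 + 1) (by omega) Y (by omega)
    rw [show a + 1 + b + 1 = a + b + 1 + 1 by omega] at h2
    rw [← add_assoc] at h1
    push_cast at *
    omega
  · have h1 := h.triangleOf_lt_iff (a := a) (b := b) (m := a) (by omega) (by omega)
    have h2 := h.triangleOf_lt_iff (a := a) (b := b) (m := a + 1) (by omega) (by omega)
    rw [hab, h.bot _ (by omega)] at h1 h2
    push_cast at *
    omega

namespace IsMonotoneTriangle

variable {N : ℕ} {X : ℕ → ℕ → ℤ}

theorem le_and_lt (h : IsMonotoneTriangle N X) {a b : ℕ} (hab : a + b < N) :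
    (a : ℤ) ≤ X a b ∧ X a b + b + 1 ≤ N := by
  induction hk : N - (a + b) generalizing a b with
  | zero => omega
  | succ k ih =>
    rcases Nat.lt_or_ge (a + b + 1) N with h1 | h1
    · have e1 := ih (a := a) (b := b + 1) (by omega) (by omega)
      have e2 := ih (a := a + 1) (b := b) (by omega) (by omega)
      have e3 := h.le_left a b h1
      have e4 := h.le_right a b h1
      omega
    · have := h.bot a b (by omega)
      omega

theorem lt_succ (h : IsMonotoneTriangle N X) {j p : ℕ} (hj : j ≤ N) (hp : p + 1 < j) :
    X p (j - 1 - p) < X (p + 1) (j - 1 - (p + 1)) := by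
  have := h.lt p (j - 1 - (p + 1)) (by omega)
  rwa [show j - 1 - (p + 1) + 1 = j - 1 - p by omega] at this

end IsMonotoneTriangle

/-- The corner sum matrix of a monotone triangle. -/
def cornerOfTriangle (N : ℕ) (X : ℕ → ℕ → ℤ) (j m : ℕ) : ℤ :=
  if j ≤ N ∧ m ≤ N then ((Finset.range j).filter fun p => X p (j - 1 - p) < m).card else 0

namespace IsMonotoneTriangle

variable {N : ℕ} {X : ℕ → ℕ → ℤ}

theorem lt_cornerOfTriangle_iff (h : IsMonotoneTriangle N X) {j m p : ℕ} (hj : j ≤ N) (hm : m ≤ N)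
    (hp : p < j) : (p : ℤ) < cornerOfTriangle N X j m ↔ X p (j - 1 - p) < m := by
  rw [cornerOfTriangle, if_pos ⟨hj, hm⟩, Nat.cast_lt]
  refine lt_card_filter_range_iff (P := fun p => X p (j - 1 - p) < m) (fun p hp h' => ?_) hp
  have := h.lt_succ hj hp
  omega

theorem _root_.cornerOfTriangle_mem (X : ℕ → ℕ → ℤ) {j m : ℕ} (hj : j ≤ N) (hm : m ≤ N) :
    ∃ c : ℕ, cornerOfTriangle N X j m = c ∧ c ≤ j := by
  rw [cornerOfTriangle, if_pos ⟨hj, hm⟩]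
  exact ⟨_, rfl, (Finset.card_filter_le _ _).trans (Finset.card_range j).le⟩

theorem isCornerSum (h : IsMonotoneTriangle N X) : IsCornerSum N (cornerOfTriangle N X) := by
  have key := @h.lt_cornerOfTriangle_iff
  have mem := @cornerOfTriangle_mem N X
  refine ⟨fun j => ?_, fun m => ?_, fun j hj => ?_, fun m hm => ?_, fun j hj m hm => ?_,
    fun j hj m hm => ?_, fun j m hjm => ?_⟩
  · by_cases hj : j ≤ N
    · obtain ⟨c, hc, hcj⟩ := mem hj (Nat.zero_le N)
      rcases c with _ | c
      · simpa using hc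
      · have h1 := key hj (Nat.zero_le N) (p := c) (by omega)
        have h2 := h.le_and_lt (a := c) (b := j - 1 - c) (by omega)
        push_cast at *
        omega
    · simp [cornerOfTriangle, hj]
  · simp [cornerOfTriangle]
  · obtain ⟨c, hc, hcj⟩ := mem hj le_rfl
    by_contra hne
    have h1 := key hj le_rfl (p := c) (by omega)
    have h2 := h.le_and_lt (a := c) (b := j - 1 - c) (by omega)
    omega
  · obtain ⟨c, hc, hcN⟩ := mem le_rfl hm
    have h1 : c ≤ m := by
      by_contra hlt
      have h1 := key le_rfl hm (p := m) (by omega)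
      have h2 := h.bot m (N - 1 - m) (by omega)
      omega
    by_contra hne
    have h1 := key le_rfl hm (p := c) (by omega)
    have h2 := h.bot c (N - 1 - c) (by omega)
    omega
  · obtain ⟨c, hc, hcj⟩ := mem hj hm.le
    obtain ⟨d, hd, hdj⟩ := mem hj (m := m + 1) (by omega)
    have h1 : c ≤ d := by
      by_contra hlt
      have h1 := key hj (m := m + 1) (by omega) (p := d) (by omega)
      have h2 := key hj hm.le (p := d) (by omega)
      push_cast at *
      omega
    have h2 : d ≤ c + 1 := by
      by_contra hlt
      have h1 := key hj (m := m + 1) (by omega) (p := c + 1) (by omega)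
      have h2 := key hj hm.le (p := c) (by omega)
      have h3 := h.lt_succ hj (p := c) (by omega)
      push_cast at *
      omega
    omega
  · obtain ⟨c, hc, hcj⟩ := mem hj.le hm
    obtain ⟨d, hd, hdj⟩ := mem (j := j + 1) (by omega) hm
    have h1 : c ≤ d := by
      by_contra hlt
      have h1 := key (j := j + 1) (by omega) hm (p := d) (by omega)
      have h2 := key hj.le hm (p := d) (by omega)
      have h3 := h.le_left d (j - 1 - d) (by omega)
      rw [show j - 1 - d + 1 = j + 1 - 1 - d by omega] at h3
      omega
    have h2 : d ≤ c + 1 := by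
      by_contra hlt
      have h1 := key (j := j + 1) (by omega) hm (p := c + 1) (by omega)
      have h2 := key hj.le hm (p := c) (by omega)
      have h3 := h.le_right c (j - 1 - c) (by omega)
      rw [show j + 1 - 1 - (c + 1) = j - 1 - c by omega] at h1
      push_cast at *
      omega
    omega
  · rw [cornerOfTriangle, if_neg (by omega)]

theorem triangleOf_cornerOfTriangle (h : IsMonotoneTriangle N X) :
    triangleOf N (cornerOfTriangle N X) = X := by
  funext a b
  by_cases hab : a + b < N
  · have h1 := h.le_and_lt hab
    obtain ⟨Y, hY⟩ := Int.eq_ofNat_of_zero_le (a := X a b) (by omega)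
    have e : a + b + 1 - 1 - a = b := by omega
    have k1 := h.isCornerSum.triangleOf_lt_iff hab (m := Y) (by omega)
    have k2 := h.isCornerSum.triangleOf_lt_iff hab (m := Y + 1) (by omega)
    rw [h.lt_cornerOfTriangle_iff (by omega) (by omega) (by omega), e] at k1 k2
    push_cast at *
    omega
  · rw [triangleOf, if_neg hab, h.out a b (by omega)]

end IsMonotoneTriangle

theorem triangleOf_injOn (N : ℕ) : Set.InjOn (triangleOf N) {C | IsCornerSum N C} := by
  intro C hC C' hC' e
  have key : ∀ C C' : ℕ → ℕ → ℤ, IsCornerSum N C → IsCornerSum N C' →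
      triangleOf N C = triangleOf N C' → ∀ j m, j ≤ N → m ≤ N → C j m ≤ C' j m := by
    intro C C' hC hC' e j m hj hm
    by_contra! hlt
    obtain ⟨c, hc⟩ := Int.eq_ofNat_of_zero_le (hC'.nonneg hj hm)
    have := hC.le hj hm
    have h1 := hC.triangleOf_lt_iff (a := c) (b := j - 1 - c) (by omega) hm
    have h2 := hC'.triangleOf_lt_iff (a := c) (b := j - 1 - c) (by omega) hm
    rw [e, h2, show c + (j - 1 - c) + 1 = j by omega] at h1
    omega
  funext j m
  by_cases h : j ≤ N ∧ m ≤ N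
  · exact le_antisymm (key _ _ hC hC' e j m h.1 h.2) (key _ _ hC' hC e.symm j m h.1 h.2)
  · rw [IsCornerSum.out hC j m (by omega), IsCornerSum.out hC' j m (by omega)]

open Classical in
/-- The finite set of monotone triangles of size `N`. -/
noncomputable def triangles (N : ℕ) : Finset (ℕ → ℕ → ℤ) := (corners N).image (triangleOf N)

theorem mem_triangles {N : ℕ} {X : ℕ → ℕ → ℤ} : X ∈ triangles N ↔ IsMonotoneTriangle N X := by
  simp only [triangles, Finset.mem_image, mem_corners]
  constructor
  · rintro ⟨C, hC, rfl⟩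
    exact hC.isMonotoneTriangle
  · exact fun h => ⟨_, h.isCornerSum, h.triangleOf_cornerOfTriangle⟩

theorem sum_triangles {N : ℕ} {R : Type*} [AddCommMonoid R] (f : (ℕ → ℕ → ℤ) → R) :
    ∑ X ∈ triangles N, f X = ∑ C ∈ corners N, f (triangleOf N C) := by
  classical
  rw [triangles, Finset.sum_image]
  intro C hC C' hC' e
  exact triangleOf_injOn N (mem_corners.1 hC) (mem_corners.1 hC') e

theorem card_triangles (N : ℕ) : (triangles N).card = (corners N).card := by
  rw [Finset.card_eq_sum_ones, Finset.card_eq_sum_ones, sum_triangles]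

theorem IsCornerSum.sum_eq {N : ℕ} {C : ℕ → ℕ → ℤ} (h : IsCornerSum N C) {j : ℕ} (hj : j ≤ N) :
    ∑ m ∈ Finset.range N, C j m =
      ∑ p ∈ Finset.range j, ((N : ℤ) - 1 - triangleOf N C p (j - 1 - p)) := by
  have h1 : ∀ m ∈ Finset.range N, C j m =
      ∑ p ∈ Finset.range j, if triangleOf N C p (j - 1 - p) < m then 1 else 0 := by
    intro m hm
    have hm := Finset.mem_range.1 hm
    obtain ⟨c, hc⟩ := Int.eq_ofNat_of_zero_le (h.nonneg hj hm.le)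
    have hcj := h.le hj hm.le
    rw [hc, Finset.sum_boole]
    have : (Finset.range j).filter (fun p => triangleOf N C p (j - 1 - p) < m) =
        Finset.range c := by
      ext p
      simp only [Finset.mem_filter, Finset.mem_range]
      constructor
      · rintro ⟨h1, h2⟩
        rw [h.triangleOf_lt_iff (by omega) hm.le, show p + (j - 1 - p) + 1 = j by omega] at h2
        omega
      · intro h1
        refine ⟨by omega, ?_⟩
        rw [h.triangleOf_lt_iff (by omega) hm.le, show p + (j - 1 - p) + 1 = j by omega]
        omega
    rw [this, Finset.card_range]
  rw [Finset.sum_congr rfl h1, Finset.sum_comm]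
  refine Finset.sum_congr rfl fun p hp => ?_
  have hp := Finset.mem_range.1 hp
  have hb := h.isMonotoneTriangle.le_and_lt (a := p) (b := j - 1 - p) (by omega)
  obtain ⟨Y, hY⟩ := Int.eq_ofNat_of_zero_le (a := triangleOf N C p (j - 1 - p)) (by omega)
  have : (Finset.range N).filter (fun m : ℕ => triangleOf N C p (j - 1 - p) < m) =
      Finset.Ico (Y + 1) N := by
    ext m
    simp only [Finset.mem_filter, Finset.mem_range, Finset.mem_Ico]
    omega
  rw [Finset.sum_boole, this, Nat.card_Ico, hY]
  omega

theorem one_sub_ge_exp {u : ℝ} (h0 : 0 ≤ u) (h1 : u ≤ 1 / 2) : Real.exp (-(2 * u)) ≤ 1 - u := by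
  rw [Real.exp_neg, inv_le_comm₀ (Real.exp_pos _) (by linarith)]
  refine le_trans ?_ (Real.add_one_le_exp (2 * u))
  rw [inv_le_iff_one_le_mul₀ (by linarith)]
  nlinarith

theorem dwPart_cons_eq {n : ℕ} (f : (ℕ → ℕ → ℤ) → Fin (n + 1))
    (hf : ∀ C ∈ corners (n + 1), ∀ i ≤ n + 1, C i 1 = if i ≤ f C then 0 else 1) (y : ℂ) :
    dwPart (Fin.cons y (0 : Fin n → ℂ)) (List.ofFn (0 : Fin (n + 1) → ℂ)) =
      wtC ^ ((n + 1) * n + 1) * ∑ C ∈ corners (n + 1),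
        wtA (-y) ^ (f C : ℕ) * wtB (-y) ^ (n - f C) := by
  rw [dwPart_eq_sum, Finset.mul_sum]
  refine Finset.sum_congr rfl fun C hC => ?_
  have h0 : ∀ s t h, vertexWt wtC wtC wtC s t h = wtC := by simp [vertexWt]
  have hA : wtA 0 = wtC := by simp [wtA, wtC]
  have hB : wtB 0 = wtC := by simp [wtB, wtC]
  have e : ∀ i : Fin (n + 1), (∏ l : Fin (n + 1),
      vertexWt (wtA ((0 : Fin (n + 1) → ℂ) i - (Fin.cons y (0 : Fin n → ℂ) : Fin (n + 1) → ℂ) l))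
        (wtB ((0 : Fin (n + 1) → ℂ) i - (Fin.cons y (0 : Fin n → ℂ) : Fin (n + 1) → ℂ) l)) wtC
        (cornerV C i l) (cornerV C (i + 1) l) (cornerH C i l)) =
      (if i < f C then wtA (-y) else if i = f C then wtC else wtB (-y)) * wtC ^ n := by
    intro i
    rw [Fin.prod_univ_succ, Fin.val_zero, vertexWt_first (mem_corners.1 hC) (hf C hC)]
    simp [h0, hA, hB]
  rw [cornerWt, Finset.prod_congr rfl fun i _ => e i, Finset.prod_mul_distrib]
  have e2 : ∏ i : Fin (n + 1), (if i < f C then wtA (-y) else if i = f C then wtC else wtB (-y)) =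
      wtA (-y) ^ (f C : ℕ) * wtB (-y) ^ (n - f C) * wtC := by
    have h1 := Finset.prod_ite (s := Finset.univ) (p := fun i => i < f C)
      (fun _ => wtA (-y)) fun i => if i = f C then wtC else wtB (-y)
    rw [h1, Finset.prod_const]
    have h2 : Finset.univ.filter (fun i => ¬ i < f C) = insert (f C) (Finset.Ioi (f C)) := by
      ext i
      simp only [Finset.mem_filter, Finset.mem_univ, true_and, Finset.mem_insert, Finset.mem_Ioi,
        not_lt, le_iff_eq_or_lt, eq_comm]
    have h3 : Finset.univ.filter (fun i => i < f C) = Finset.Iio (f C) := by ext; simp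
    rw [h2, h3, Finset.prod_insert (by simp), Fin.card_Iio, if_pos rfl,
      Finset.prod_congr rfl fun i hi => if_neg (Finset.mem_Ioi.1 hi).ne', Finset.prod_const,
      Fin.card_Ioi]
    simp only [Nat.add_sub_cancel]
    ring
  rw [e2, Finset.prod_const, Finset.card_univ, Fintype.card_fin]
  ring

theorem exists_first (n : ℕ) : ∃ f : (ℕ → ℕ → ℤ) → Fin (n + 1),
    ∀ C ∈ corners (n + 1), ∀ i ≤ n + 1, C i 1 = if i ≤ f C then 0 else 1 := by
  classical
  refine ⟨fun C => if h : C ∈ corners (n + 1) then (mem_corners.1 h).exists_first.choose else 0,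
    fun C hC => ?_⟩
  simp only [dif_pos hC]
  exact (mem_corners.1 hC).exists_first.choose_spec

theorem sum_first_pow_le {n : ℕ} (f : (ℕ → ℕ → ℤ) → Fin (n + 1))
    (hf : ∀ C ∈ corners (n + 1), ∀ i ≤ n + 1, C i 1 = if i ≤ f C then 0 else 1) {τ : ℝ}
    (h0 : 0 < τ) (h1 : τ ≤ 1 / 2) :
    ∑ C ∈ corners (n + 1), (1 - τ) ^ (f C : ℕ) * (1 + τ) ^ (n - f C) ≤
      (corners (n + 1)).card * Real.exp (6 * (n + 1) * τ ^ 2) := by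
  set y := Real.arctan (√3 * τ) with hy
  have h3 : √3 ^ 2 = 3 := Real.sq_sqrt (by norm_num)
  have h3' : 0 < √3 := by positivity
  have hy0 : 0 < y := by rw [hy, Real.arctan_pos]; positivity
  have hyle : y ≤ √3 * τ := by
    have := Real.le_tan hy0.le (Real.arctan_lt_pi_div_two _)
    rwa [Real.tan_arctan] at this
  have hysq : y ^ 2 ≤ 3 * τ ^ 2 := by
    have := pow_le_pow_left₀ hy0.le hyle 2
    rwa [mul_pow, h3] at this
  have hy1 : y ≤ 1 := by nlinarith
  have hcos : 0 < Real.cos y := Real.cos_arctan_pos _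
  have htan : Real.sin y = √3 * τ * Real.cos y := by
    have := Real.tan_arctan (√3 * τ)
    rw [← hy, Real.tan_eq_sin_div_cos] at this
    field_simp at this
    linarith
  have hsin0 : 0 < Real.sin y := by rw [htan]; positivity
  set s : ℝ := √3 / 2 with hs
  have hsC : wtC = (s : ℂ) := by
    rw [wtC, show (Real.pi : ℂ) / 3 = ((Real.pi / 3 : ℝ) : ℂ) by push_cast; ring,
      ← Complex.ofReal_sin, Real.sin_pi_div_three]
  have hwA : wtA (-y) = ((s * Real.cos y * (1 - τ) : ℝ) : ℂ) := by
    rw [wtA, show (Real.pi : ℂ) / 3 + -y = ((Real.pi / 3 - y : ℝ) : ℂ) by push_cast; ring,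
      ← Complex.ofReal_sin, Real.sin_sub, Real.sin_pi_div_three, Real.cos_pi_div_three, htan]
    congr 1; ring
  have hwB : wtB (-y) = ((s * Real.cos y * (1 + τ) : ℝ) : ℂ) := by
    rw [wtB, show (Real.pi : ℂ) / 3 - -y = ((Real.pi / 3 + y : ℝ) : ℂ) by push_cast; ring,
      ← Complex.ofReal_sin, Real.sin_add, Real.sin_pi_div_three, Real.cos_pi_div_three, htan]
    congr 1; ring
  have hA0 : wtA 0 = (s : ℂ) := by simpa [wtA, wtC] using hsC
  have hB0 : wtB 0 = (s : ℂ) := by simpa [wtB, wtC] using hsC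
  have hs0 : 0 < s := by positivity
  have key := norm_dwPart_mul_le n hy0.le
  set S := ∑ C ∈ corners (n + 1), (1 - τ) ^ (f C : ℕ) * (1 + τ) ^ (n - f C) with hS
  have hS0 : 0 ≤ S := Finset.sum_nonneg fun C _ =>
    mul_nonneg (pow_nonneg (by linarith) _) (pow_nonneg (by linarith) _)
  have hZ : dwPart (Fin.cons (y : ℂ) (0 : Fin n → ℂ)) (List.ofFn (0 : Fin (n + 1) → ℂ)) =
      ((s ^ ((n + 1) * n + 1) * ((s * Real.cos y) ^ n * S) : ℝ) : ℂ) := by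
    rw [dwPart_cons_eq f hf, hwA, hwB, hsC, hS, Finset.mul_sum]
    push_cast
    rw [← Finset.mul_sum, Finset.mul_sum _ _ ((s * Complex.cos y : ℂ) ^ n)]
    congr 1
    refine Finset.sum_congr rfl fun C _ => ?_
    have : (f C : ℕ) + (n - f C) = n := by omega
    rw [mul_pow, mul_pow _ (1 + (τ : ℂ))]
    rw [mul_mul_mul_comm, ← pow_add, this]
  have hZ0 : dwPart (Fin.cons 0 (0 : Fin n → ℂ)) (List.ofFn (0 : Fin (n + 1) → ℂ)) =
      ((s ^ ((n + 1) * n + 1) * (s ^ n * (corners (n + 1)).card) : ℝ) : ℂ) := by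
    rw [dwPart_cons_eq f hf, neg_zero, hA0, hB0, hsC]
    have : ∀ C ∈ corners (n + 1), (s : ℂ) ^ (f C : ℕ) * (s : ℂ) ^ (n - f C) = (s : ℂ) ^ n :=
      fun C _ => by rw [← pow_add]; congr 1; omega
    rw [Finset.sum_congr rfl this, Finset.sum_const, nsmul_eq_mul]
    push_cast
    ring
  rw [hZ, hZ0, Complex.norm_real, Complex.norm_real, Real.norm_of_nonneg (by positivity),
    Real.norm_of_nonneg (by positivity), abs_of_pos hsin0, mul_pow] at key
  have key2 : S * (Real.cos y ^ n * Real.sin y ^ (2 * n + 1)) ≤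
      (corners (n + 1)).card * y ^ (2 * n + 1) := by
    refine le_of_mul_le_mul_left ?_ (show 0 < s ^ ((n + 1) * n + 1) * s ^ n by positivity)
    linarith
  have hsin : y * Real.exp (-(y ^ 2 / 2)) ≤ Real.sin y := by
    have e1 := Real.sin_gt_sub_cube hy0
    have e3 : 0 < y ^ 3 := by positivity
    have e2 := one_sub_ge_exp (u := y ^ 2 / 4) (by positivity) (by nlinarith)
    rw [show 2 * (y ^ 2 / 4) = y ^ 2 / 2 by ring] at e2
    nlinarith
  have hcos' : Real.exp (-y ^ 2) ≤ Real.cos y := by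
    have e1 := Real.one_sub_sq_div_two_le_cos (x := y)
    have e2 := one_sub_ge_exp (u := y ^ 2 / 2) (by positivity) (by nlinarith)
    rw [show -(2 * (y ^ 2 / 2)) = -y ^ 2 by ring] at e2
    linarith
  have hlow : y ^ (2 * n + 1) * Real.exp (-(6 * (n + 1) * τ ^ 2)) ≤
      Real.cos y ^ n * Real.sin y ^ (2 * n + 1) := by
    have e1 := pow_le_pow_left₀ (by positivity) hsin (2 * n + 1)
    have e2 := pow_le_pow_left₀ (by positivity) hcos' n
    refine le_trans ?_ (mul_le_mul e2 e1 (by positivity) (by positivity))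
    rw [mul_pow, ← Real.exp_nat_mul, ← Real.exp_nat_mul, mul_left_comm, ← Real.exp_add]
    refine mul_le_mul_of_nonneg_left (Real.exp_le_exp.2 ?_) (by positivity)
    push_cast
    nlinarith [sq_nonneg y]
  have key3 := (mul_le_mul_of_nonneg_left hlow hS0).trans key2
  have hyp : 0 < y ^ (2 * n + 1) := by positivity
  rw [mul_left_comm, mul_comm ((corners (n + 1)).card : ℝ)] at key3
  have key4 := le_of_mul_le_mul_left key3 hyp
  rw [Real.exp_neg, ← div_eq_mul_inv, div_le_iff₀ (Real.exp_pos _)] at key4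
  exact key4

theorem sum_exp_first_le {n : ℕ} (f : (ℕ → ℕ → ℤ) → Fin (n + 1))
    (hf : ∀ C ∈ corners (n + 1), ∀ i ≤ n + 1, C i 1 = if i ≤ f C then 0 else 1) {τ : ℝ}
    (h0 : 0 ≤ τ) (h1 : τ ≤ 1 / 2) :
    ∑ C ∈ corners (n + 1), Real.exp (τ * (n - 2 * (f C : ℕ))) ≤
      (corners (n + 1)).card * Real.exp (8 * (n + 1) * τ ^ 2) := by
  rcases h0.eq_or_lt with rfl | h0
  · simp
  have key := sum_first_pow_le f hf h0 h1
  have e1 : Real.exp (τ - 2 * τ ^ 2) ≤ 1 + τ := by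
    rw [← neg_sub, Real.exp_neg, inv_le_comm₀ (Real.exp_pos _) (by linarith)]
    refine le_trans ?_ (Real.add_one_le_exp _)
    rw [inv_le_iff_one_le_mul₀ (by linarith)]
    nlinarith [mul_nonneg h0.le (sq_nonneg τ)]
  have e2 : Real.exp (-τ - 2 * τ ^ 2) ≤ 1 - τ := by
    rw [← neg_add', Real.exp_neg, inv_le_comm₀ (Real.exp_pos _) (by linarith)]
    refine le_trans ?_ (Real.add_one_le_exp _)
    rw [inv_le_iff_one_le_mul₀ (by linarith)]
    nlinarith [mul_nonneg (sq_nonneg τ) (show 0 ≤ 1 - 2 * τ by linarith)]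
  have e3 : ∀ C ∈ corners (n + 1), Real.exp (τ * (n - 2 * (f C : ℕ))) ≤
      Real.exp (2 * n * τ ^ 2) * ((1 - τ) ^ (f C : ℕ) * (1 + τ) ^ (n - f C)) := by
    intro C _
    have h2 := mul_le_mul (pow_le_pow_left₀ (Real.exp_pos _).le e2 (f C : ℕ))
      (pow_le_pow_left₀ (Real.exp_pos _).le e1 (n - f C)) (by positivity)
      (pow_nonneg (by linarith) _)
    refine le_trans (le_of_eq ?_) (mul_le_mul_of_nonneg_left h2 (Real.exp_pos _).le)
    rw [← Real.exp_nat_mul, ← Real.exp_nat_mul, ← Real.exp_add, ← Real.exp_add,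
      Nat.cast_sub (by omega)]
    congr 1
    ring
  refine (Finset.sum_le_sum e3).trans ?_
  rw [← Finset.mul_sum]
  refine (mul_le_mul_of_nonneg_left key (Real.exp_pos _).le).trans ?_
  rw [mul_left_comm, ← Real.exp_add]
  refine mul_le_mul_of_nonneg_left (Real.exp_le_exp.2 ?_) (by positivity)
  nlinarith [sq_nonneg τ]

/-- The reflection of a monotone triangle. -/
def reflect (N : ℕ) (X : ℕ → ℕ → ℤ) (a b : ℕ) : ℤ := if a + b < N then N - 1 - X b a else 0

namespace IsMonotoneTriangle

variable {N : ℕ} {X : ℕ → ℕ → ℤ}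

theorem reflect (h : IsMonotoneTriangle N X) : IsMonotoneTriangle N (reflect N X) := by
  refine ⟨fun a b hab => ?_, fun a b hab => ?_, fun a b hab => ?_, fun a b hab => ?_,
    fun a b hab => if_neg (by omega)⟩
  · rw [_root_.reflect, _root_.reflect, if_pos (by omega), if_pos (by omega)]
    have := h.le_right b a (by omega)
    omega
  · rw [_root_.reflect, _root_.reflect, if_pos (by omega), if_pos (by omega)]
    have := h.le_left b a (by omega)
    omega
  · rw [_root_.reflect, _root_.reflect, if_pos (by omega), if_pos (by omega)]
    have := h.lt b a (by omega)
    omega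
  · rw [_root_.reflect, if_pos (by omega), h.bot b a (by omega)]
    omega

theorem reflect_reflect (h : IsMonotoneTriangle N X) :
    _root_.reflect N (_root_.reflect N X) = X := by
  funext a b
  by_cases hab : a + b < N
  · rw [_root_.reflect, if_pos hab, _root_.reflect, if_pos (by omega)]
    omega
  · rw [_root_.reflect, if_neg hab, h.out a b (by omega)]

end IsMonotoneTriangle

theorem sum_triangles_reflect {R : Type*} [AddCommMonoid R] (N : ℕ) (f : (ℕ → ℕ → ℤ) → R) :
    ∑ X ∈ triangles N, f (reflect N X) = ∑ X ∈ triangles N, f X := by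
  refine Finset.sum_nbij' (reflect N) (reflect N) ?_ ?_ ?_ ?_ ?_
  · exact fun X hX => mem_triangles.2 (mem_triangles.1 hX).reflect
  · exact fun X hX => mem_triangles.2 (mem_triangles.1 hX).reflect
  · exact fun X hX => (mem_triangles.1 hX).reflect_reflect
  · exact fun X hX => (mem_triangles.1 hX).reflect_reflect
  · exact fun X hX => rfl

theorem sum_corners_transpose {R : Type*} [AddCommMonoid R] (N : ℕ) (f : (ℕ → ℕ → ℤ) → R) :
    ∑ C ∈ corners N, f (fun i l => C l i) = ∑ C ∈ corners N, f C := by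
  refine Finset.sum_nbij' (fun C i l => C l i) (fun C i l => C l i) ?_ ?_ ?_ ?_ ?_
  · exact fun X hX => mem_corners.2 (mem_corners.1 hX).transpose
  · exact fun X hX => mem_corners.2 (mem_corners.1 hX).transpose
  · exact fun X hX => rfl
  · exact fun X hX => rfl
  · exact fun X hX => rfl

theorem sum_exp_apex_le_of_nonneg {N : ℕ} (hN : 1 ≤ N) {τ : ℝ} (h0 : 0 ≤ τ) (h1 : τ ≤ 1 / 2) :
    ∑ X ∈ triangles N, Real.exp (τ * (N - 1 - 2 * X 0 0)) ≤
      (triangles N).card * Real.exp (8 * N * τ ^ 2) := by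
  obtain ⟨n, rfl⟩ := Nat.exists_eq_add_of_le' hN
  obtain ⟨f, hf⟩ := exists_first n
  have key := sum_exp_first_le f hf h0 h1
  rw [sum_triangles, ← sum_corners_transpose, card_triangles]
  convert key using 2 with C hC
  · have hC' := mem_corners.1 hC
    have : triangleOf (n + 1) (fun i l => C l i) 0 0 = (f C : ℕ) := by
      have k1 := hC'.transpose.triangleOf_lt_iff (a := 0) (b := 0) (m := f C) (by omega) (by omega)
      have k2 := hC'.transpose.triangleOf_lt_iff (a := 0) (b := 0) (m := f C + 1) (by omega)
        (by omega)
      have k3 := hf C hC (f C) (by omega)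
      have k4 := hf C hC (f C + 1) (by omega)
      simp only [le_refl, if_true, if_neg (by omega : ¬ (f C : ℕ) + 1 ≤ f C)] at k3 k4
      simp only [zero_add] at k1 k2
      rw [k3] at k1
      rw [k4] at k2
      simp only [Nat.cast_add, Nat.cast_one, Nat.cast_zero, lt_irrefl, zero_lt_one, iff_false,
        iff_true] at k1 k2
      omega
    rw [this]
    push_cast
    ring_nf
  · push_cast
    ring_nf

/-- The apex of a uniformly random monotone triangle is sub-Gaussian on the scale `√N`. -/
theorem sum_exp_apex_le {N : ℕ} (hN : 1 ≤ N) {τ : ℝ} (h1 : |τ| ≤ 1 / 2) :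
    ∑ X ∈ triangles N, Real.exp (τ * (N - 1 - 2 * X 0 0)) ≤
      (triangles N).card * Real.exp (8 * N * τ ^ 2) := by
  rcases le_total 0 τ with h0 | h0
  · exact sum_exp_apex_le_of_nonneg hN h0 (by rwa [abs_of_nonneg h0] at h1)
  · rw [abs_of_nonpos h0] at h1
    have := sum_exp_apex_le_of_nonneg hN (neg_nonneg.2 h0) h1
    rw [neg_sq, ← sum_triangles_reflect] at this
    convert this using 3 with X _
    rw [reflect, if_pos (by omega)]
    push_cast
    ring

theorem triangles_nonempty (N : ℕ) : (triangles N).Nonempty := by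
  refine ⟨fun a b => if a + b < N then a else 0, mem_triangles.2 ⟨?_, ?_, ?_, ?_, ?_⟩⟩ <;>
    intro a b hab <;> split_ifs <;> push_cast <;> omega

theorem card_triangles_mul_exp_le (N : ℕ) :
    ((triangles N).card : ℝ) * Real.exp (((N : ℝ) - 1) / 32) ≤ (triangles (N + 1)).card := by
  have key := sum_exp_apex_le (N := N + 1) (by omega) (τ := -(1 / 16)) (by norm_num [abs_le])
  set φ : (ℕ → ℕ → ℤ) → ℕ → ℕ → ℤ := fun Y a b =>
    Nat.casesOn b (if a < N + 1 then (N : ℤ) else 0) fun b => Y a b with hφ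
  have hφ0 : ∀ Y a, φ Y a 0 = if a < N + 1 then (N : ℤ) else 0 := fun _ _ => rfl
  have hφ1 : ∀ Y a b, φ Y a (b + 1) = Y a b := fun _ _ _ => rfl
  have hinj : Function.Injective φ := fun Y Y' e => by
    funext a b
    exact congrFun (congrFun e a) (b + 1)
  classical
  have hsub : (triangles N).image φ ⊆ (triangles (N + 1)) := by
    intro X hX
    obtain ⟨Y, hY, rfl⟩ := Finset.mem_image.1 hX
    have hY := mem_triangles.1 hY
    refine mem_triangles.2 ⟨fun a b hab => ?_, fun a b hab => ?_, fun a b hab => ?_,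
      fun a b hab => ?_, fun a b hab => ?_⟩ <;> rcases b with _ | b <;> simp only [hφ0, hφ1]
    · have := hY.le_and_lt (a := a) (b := 0) (by omega)
      rw [if_pos (by omega)]
      omega
    · exact hY.le_left a b (by omega)
    · rw [if_pos (by omega), if_pos (by omega)]
    · exact hY.le_right a b (by omega)
    · have := hY.le_and_lt (a := a) (b := 0) (by omega)
      rw [if_pos (by omega)]
      omega
    · exact hY.lt a b (by omega)
    · rw [if_pos (by omega)]
      omega
    · exact hY.bot a b (by omega)
    · rw [if_neg (by omega)]
    · exact hY.out a b (by omega)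
  have h1 : ((triangles N).card : ℝ) * Real.exp ((1 / 16) * N) ≤
      ∑ X ∈ triangles (N + 1), Real.exp (-(1 / 16) * ((N + 1 : ℕ) - 1 - 2 * X 0 0)) := by
    refine le_trans (le_of_eq ?_) (Finset.sum_le_sum_of_subset_of_nonneg hsub fun _ _ _ =>
      (Real.exp_pos _).le)
    rw [Finset.sum_image fun _ _ _ _ e => hinj e, ← nsmul_eq_mul, ← Finset.sum_const]
    refine Finset.sum_congr rfl fun Y _ => ?_
    congr 1
    simp [hφ0]
    ring
  have h2 := h1.trans key
  rw [show (1 / 16 : ℝ) * N = (N - 1) / 32 + 8 * (N + 1 : ℕ) * (-(1 / 16)) ^ 2 by push_cast; ring,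
    Real.exp_add, ← mul_assoc] at h2
  exact le_of_mul_le_mul_right h2 (Real.exp_pos _)

theorem exp_le_card_triangles (N : ℕ) :
    Real.exp (((N : ℝ) - 1) * (N - 2) / 64 - 1 / 32) ≤ (triangles N).card := by
  induction N with
  | zero =>
    have := (triangles_nonempty 0).card_pos
    have : (1 : ℝ) ≤ (triangles 0).card := by exact_mod_cast this
    refine le_trans (le_of_eq ?_) this
    norm_num
  | succ N ih =>
    refine le_trans ?_ (card_triangles_mul_exp_le N)
    refine le_trans (le_of_eq ?_) (mul_le_mul_of_nonneg_right ih (Real.exp_pos _).le)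
    rw [← Real.exp_add]
    congr 1
    push_cast
    ring

/-! ### Row statistics -/

/-- The number of nonzero entries of row `i` of the alternating sign matrix. -/
def rowC (N : ℕ) (C : ℕ → ℕ → ℤ) (i : ℕ) : ℕ :=
  (Finset.univ.filter fun l : Fin N => cornerV C i l ≠ cornerV C (i + 1) l).card

/-- The number of vertices of the first kind in row `i`. -/
def rowA (N : ℕ) (C : ℕ → ℕ → ℤ) (i : ℕ) : ℕ :=
  (Finset.univ.filter fun l : Fin N => cornerV C i l = cornerV C (i + 1) l ∧
    cornerH C i l = cornerV C i l).card

/-- The number of vertices of the second kind in row `i`. -/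
def rowB (N : ℕ) (C : ℕ → ℕ → ℤ) (i : ℕ) : ℕ :=
  (Finset.univ.filter fun l : Fin N => cornerV C i l = cornerV C (i + 1) l ∧
    cornerH C i l ≠ cornerV C i l).card

theorem prod_vertexWt (N : ℕ) (C : ℕ → ℕ → ℤ) (i : ℕ) (a b c : ℂ) :
    ∏ l : Fin N, vertexWt a b c (cornerV C i l) (cornerV C (i + 1) l) (cornerH C i l) =
      a ^ rowA N C i * b ^ rowB N C i * c ^ rowC N C i := by
  simp only [vertexWt, Finset.prod_ite, Finset.prod_const, Finset.filter_filter, rowA, rowB, rowC,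
    ne_eq]

theorem rowA_add_rowB_add_rowC (N : ℕ) (C : ℕ → ℕ → ℤ) (i : ℕ) :
    rowA N C i + rowB N C i + rowC N C i = N := by
  have h1 := Finset.card_filter_add_card_filter_not (s := (Finset.univ : Finset (Fin N)))
    (fun l : Fin N => cornerV C i l = cornerV C (i + 1) l)
  have h2 := Finset.card_filter_add_card_filter_not
    (s := Finset.univ.filter fun l : Fin N => cornerV C i l = cornerV C (i + 1) l)
    (fun l : Fin N => cornerH C i l = cornerV C i l)
  rw [Finset.filter_filter, Finset.filter_filter] at h2
  rw [Finset.card_univ, Fintype.card_fin] at h1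
  rw [rowA, rowB, rowC, h2, h1]

theorem IsCornerSum.card_cornerV {N : ℕ} {C : ℕ → ℕ → ℤ} (h : IsCornerSum N C) {i : ℕ}
    (hi : i ≤ N) : (Finset.univ.filter fun l : Fin N => cornerV C i l = true).card = i := by
  have h1 : ∀ l : Fin N, (if cornerV C i l = true then (1 : ℤ) else 0) = C i (l + 1) - C i l := by
    intro l
    rw [← cornerV_toInt h hi l.2]
    cases cornerV C i l <;> rfl
  have h2 : ((Finset.univ.filter fun l : Fin N => cornerV C i l = true).card : ℤ) = i := by
    rw [← Finset.sum_boole, Finset.sum_congr rfl fun l _ => h1 l,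
      Fin.sum_univ_eq_sum_range (fun l => C i (l + 1) - C i l), Finset.sum_range_sub, h.left,
      h.right i hi, sub_zero]
  exact_mod_cast h2

theorem IsCornerSum.card_cornerV_or {N : ℕ} {C : ℕ → ℕ → ℤ} (h : IsCornerSum N C) {i : ℕ}
    (hi : i < N) : (Finset.univ.filter fun l : Fin N =>
      cornerV C i l = true ∨ cornerV C (i + 1) l = true).card ≤ 2 * i + 1 := by
  rw [Finset.filter_or]
  refine (Finset.card_union_le _ _).trans ?_
  rw [h.card_cornerV hi.le, h.card_cornerV (i := i + 1) (by omega)]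
  omega

theorem IsCornerSum.rowC_le {N : ℕ} {C : ℕ → ℕ → ℤ} (h : IsCornerSum N C) {i : ℕ} (hi : i < N) :
    rowC N C i ≤ 2 * i + 1 := by
  refine (Finset.card_le_card fun l hl => ?_).trans (h.card_cornerV_or hi)
  simp only [Finset.mem_filter, Finset.mem_univ, true_and] at *
  revert hl
  cases cornerV C i l <;> cases cornerV C (i + 1) l <;> simp

theorem IsCornerSum.cornerH_toInt {N : ℕ} {C : ℕ → ℕ → ℤ} (h : IsCornerSum N C) {i l : ℕ}
    (hi : i < N) (hl : l ≤ N) : (cornerH C i l).toInt = C (i + 1) l - C i l := by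
  rcases h.ver i hi l hl with e | e <;> simp [cornerH, e, Bool.toInt]

theorem IsCornerSum.abs_rowA_sub_rowB {N : ℕ} {C : ℕ → ℕ → ℤ} (h : IsCornerSum N C) {i : ℕ}
    (hi : i < N) : |((rowA N C i : ℤ) - rowB N C i) - (N - 2 * (∑ l ∈ Finset.range N, C (i + 1) l -
      ∑ l ∈ Finset.range N, C i l))| ≤ 2 * (2 * i + 1) := by
  have e : ((rowA N C i : ℤ) - rowB N C i) - (N - 2 * (∑ l ∈ Finset.range N, C (i + 1) l -
      ∑ l ∈ Finset.range N, C i l)) = ∑ l : Fin N,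
        ((if cornerV C i l = cornerV C (i + 1) l ∧ cornerH C i l = cornerV C i l then 1 else 0) -
        (if cornerV C i l = cornerV C (i + 1) l ∧ cornerH C i l ≠ cornerV C i l then 1 else 0) -
          (1 - 2 * (cornerH C i l).toInt)) := by
    rw [Finset.sum_sub_distrib, Finset.sum_sub_distrib, Finset.sum_sub_distrib, Finset.sum_boole,
      Finset.sum_boole, ← Finset.mul_sum, Finset.sum_congr rfl fun l _ =>
        h.cornerH_toInt hi (Fin.is_lt l).le,
      Fin.sum_univ_eq_sum_range (fun l => C (i + 1) l - C i l), Finset.sum_sub_distrib]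
    simp [rowA, rowB]
  rw [e]
  refine (Finset.abs_sum_le_sum_abs _ _).trans ?_
  have h1 : ∀ l : Fin N, |(if cornerV C i l = cornerV C (i + 1) l ∧ cornerH C i l = cornerV C i l
        then (1 : ℤ) else 0) -
        (if cornerV C i l = cornerV C (i + 1) l ∧ cornerH C i l ≠ cornerV C i l then 1 else 0) -
          (1 - 2 * (cornerH C i l).toInt)| ≤
      2 * if cornerV C i l = true ∨ cornerV C (i + 1) l = true then 1 else 0 := by
    intro l
    cases cornerV C i l <;> cases cornerV C (i + 1) l <;> cases cornerH C i l <;>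
      simp [Bool.toInt]
  refine (Finset.sum_le_sum fun l _ => h1 l).trans ?_
  rw [← Finset.mul_sum, Finset.sum_boole]
  have := h.card_cornerV_or hi
  omega

/-- The positions of the nonzero entries determine an alternating sign matrix. -/
theorem sum_pow_rowC_le (N : ℕ) {r : ℝ} (hr : 0 ≤ r) :
    ∑ C ∈ corners N, r ^ (∑ i ∈ Finset.range N, rowC N C i) ≤ (r + 1) ^ (N * N) := by
  classical
  set T : (ℕ → ℕ → ℤ) → Finset (Fin N × Fin N) := fun C => Finset.univ.filter fun p =>
    cornerV C p.1 p.2 ≠ cornerV C (p.1 + 1) p.2 with hT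
  have hcard : ∀ C, (T C).card = ∑ i ∈ Finset.range N, rowC N C i := by
    intro C
    rw [← Fin.sum_univ_eq_sum_range (fun i => rowC N C i), hT]
    simp only [rowC, Finset.card_filter]
    rw [Fintype.sum_prod_type]
  have hinj : Set.InjOn T (corners N) := by
    intro C hC C' hC' e
    have hC := mem_corners.1 hC
    have hC' := mem_corners.1 hC'
    refine hC.ext_vertical hC' fun i => ?_
    induction i with
    | zero =>
      intro _ l hl
      simp [cornerV, hC.top, hC'.top]
    | succ i ih =>
      intro hi l hl
      have h1 := ih (by omega) l hl
      have h2 := Finset.ext_iff.1 e (⟨i, hi⟩, ⟨l, hl⟩)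
      simp only [hT, Finset.mem_filter, Finset.mem_univ, true_and] at h2
      revert h1 h2
      cases cornerV C i l <;> cases cornerV C (i + 1) l <;> cases cornerV C' i l <;>
        cases cornerV C' (i + 1) l <;> simp
  have h1 := Finset.sum_pow_mul_eq_add_pow r 1 (Finset.univ : Finset (Fin N × Fin N))
  simp only [one_pow, mul_one, Finset.card_univ, Fintype.card_prod, Fintype.card_fin] at h1
  rw [← h1, Finset.sum_congr rfl fun C _ => by rw [← hcard C],
    ← Finset.sum_image (f := fun t => r ^ t.card) hinj]
  exact Finset.sum_le_sum_of_subset_of_nonneg (fun t _ => by simp) fun _ _ _ => by positivity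

/-- A uniformly random alternating sign matrix has a positive density of nonzero entries. -/
theorem le_sum_rowC {N : ℕ} (hN : 8 ≤ N) : (N : ℝ) ^ 2 / 65536 * (corners N).card ≤
    ∑ C ∈ corners N, ((∑ i ∈ Finset.range N, rowC N C i : ℕ) : ℝ) := by
  have hA := exp_le_card_triangles N
  rw [card_triangles] at hA
  set A : ℝ := ((corners N).card : ℝ) with hAdef
  have hA0 : 0 < A := (Real.exp_pos _).trans_le hA
  set c : (ℕ → ℕ → ℤ) → ℕ := fun C => ∑ i ∈ Finset.range N, rowC N C i with hc
  set m := (∑ C ∈ corners N, (c C : ℝ)) / A with hm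
  have hmA : ∑ C ∈ corners N, (c C : ℝ) = m * A := by rw [hm]; field_simp
  change _ ≤ ∑ C ∈ corners N, (c C : ℝ)
  rw [hmA]
  refine mul_le_mul_of_nonneg_right ?_ hA0.le
  set L := Real.log 256 with hL
  have h1 := sum_pow_rowC_le N (r := 1 / 256) (by norm_num)
  have hr : ∀ C, (1 / 256 : ℝ) ^ c C = Real.exp (-(L * c C)) := by
    intro C
    rw [one_div, inv_pow, Real.exp_neg, mul_comm, Real.exp_nat_mul, hL,
      Real.exp_log (by norm_num)]
  have h2 : ∀ C ∈ corners N, Real.exp (-(L * m)) * (1 + (L * m - L * c C)) ≤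
      (1 / 256 : ℝ) ^ c C := by
    intro C _
    rw [hr, show -(L * (c C : ℝ)) = -(L * m) + (L * m - L * c C) by ring, Real.exp_add]
    refine mul_le_mul_of_nonneg_left ?_ (Real.exp_pos _).le
    rw [add_comm]
    exact Real.add_one_le_exp _
  have h3 := (Finset.sum_le_sum h2).trans h1
  rw [← Finset.mul_sum, Finset.sum_add_distrib, Finset.sum_sub_distrib, ← Finset.mul_sum,
    ← Finset.mul_sum, hmA, Finset.sum_const, Finset.sum_const, nsmul_eq_mul, nsmul_eq_mul, ← hAdef,
    show A * 1 + (L * (A * m) - L * (m * A)) = A by ring] at h3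
  have h4 : ((1 / 256 : ℝ) + 1) ^ (N * N) ≤ Real.exp (1 / 256 * (N * N)) := by
    have := pow_le_pow_left₀ (by norm_num) (Real.add_one_le_exp (1 / 256 : ℝ)) (N * N)
    rw [← Real.exp_nat_mul] at this
    refine this.trans (le_of_eq ?_)
    push_cast
    ring_nf
  have h5 := (mul_le_mul_of_nonneg_left hA (Real.exp_pos (-(L * m))).le).trans (h3.trans h4)
  rw [← Real.exp_add, Real.exp_le_exp] at h5
  have hL256 : L ≤ 255 := by
    have := Real.log_le_sub_one_of_pos (x := 256) (by norm_num)
    linarith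
  have hm0 : 0 ≤ m := div_nonneg (Finset.sum_nonneg fun _ _ => by positivity) hA0.le
  have hN' : (8 : ℝ) ≤ N := by exact_mod_cast hN
  have h6 : L * m ≤ 255 * m := mul_le_mul_of_nonneg_right hL256 hm0
  nlinarith

/-- Two adjacent rows get opposite spectral parameters. -/
noncomputable def pairParam (N i : ℕ) (x : ℂ) (l : Fin N) : ℂ :=
  if (l : ℕ) = i then x else if (l : ℕ) = i + 1 then -x else 0

theorem exists_perm_apply_eq {α : Type*} [DecidableEq α] {p q p' q' : α} (h : p ≠ q)
    (h' : p' ≠ q') : ∃ σ : Equiv.Perm α, σ p = p' ∧ σ q = q' := by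
  refine ⟨Equiv.swap (Equiv.swap p p' q) q' * Equiv.swap p p', ?_, ?_⟩
  · rw [Equiv.Perm.mul_apply, Equiv.swap_apply_left, Equiv.swap_apply_of_ne_of_ne _ h']
    intro e
    have := congrArg (Equiv.swap p p') e
    rw [Equiv.swap_apply_right, Equiv.swap_apply_self] at this
    exact h this
  · rw [Equiv.Perm.mul_apply, Equiv.swap_apply_left]

theorem pairParam_perm {N i j : ℕ} (hi : i + 1 < N) (hj : j + 1 < N) (x : ℂ) :
    (List.ofFn (pairParam N i x)).Perm (List.ofFn (pairParam N j x)) := by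
  obtain ⟨σ, h1, h2⟩ := exists_perm_apply_eq (p := (⟨i, by omega⟩ : Fin N)) (q := ⟨i + 1, hi⟩)
    (p' := ⟨j, by omega⟩) (q' := ⟨j + 1, hj⟩) (by simp) (by simp)
  have e : pairParam N i x = pairParam N j x ∘ σ := by
    funext l
    have e1 : (l : ℕ) = i ↔ (σ l : ℕ) = j := by
      have := σ.injective.eq_iff (a := l) (b := ⟨i, by omega⟩)
      rw [h1] at this
      simpa [Fin.ext_iff] using this.symm
    have e2 : (l : ℕ) = i + 1 ↔ (σ l : ℕ) = j + 1 := by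
      have := σ.injective.eq_iff (a := l) (b := ⟨i + 1, hi⟩)
      rw [h2] at this
      simpa [Fin.ext_iff] using this.symm
    simp only [pairParam, Function.comp_apply, e1, e2]
  rw [e]
  exact Equiv.Perm.ofFn_comp_perm σ _

theorem wtA_mul_I (t : ℝ) : wtA (t * Complex.I) =
    wtC * (Real.cosh t + (Real.sinh t / √3 : ℝ) * Complex.I) := by
  have h3 : (√3 : ℂ) ^ 2 = 3 := by
    rw [← Complex.ofReal_pow, Real.sq_sqrt (by norm_num)]; norm_num
  have h0 : (√3 : ℂ) ≠ 0 := by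
    intro h; rw [h] at h3; norm_num at h3
  rw [wtA, wtC, show (Real.pi : ℂ) / 3 = ((Real.pi / 3 : ℝ) : ℂ) by push_cast; ring,
    Complex.sin_add,
    Complex.cos_mul_I, Complex.sin_mul_I, ← Complex.ofReal_sin, ← Complex.ofReal_cos,
    Real.sin_pi_div_three, Real.cos_pi_div_three]
  push_cast
  field_simp

theorem wtB_eq (z : ℂ) : wtB z = wtA (-z) := by rw [wtA, wtB, sub_eq_add_neg]

theorem wtA_mul_I_ne_zero (t : ℝ) : wtA (t * Complex.I) ≠ 0 := by
  rw [wtA_mul_I, wtC, show (Real.pi : ℂ) / 3 = ((Real.pi / 3 : ℝ) : ℂ) by push_cast; ring,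
    ← Complex.ofReal_sin, Real.sin_pi_div_three]
  refine mul_ne_zero (by simp) fun h => ?_
  have := congrArg Complex.re h
  simp [(Real.cosh_pos t).ne'] at this

theorem wtC_ne_zero : wtC ≠ 0 := by
  have := wtA_mul_I_ne_zero 0
  rwa [wtA_mul_I, Real.cosh_zero, Real.sinh_zero, zero_div, Complex.ofReal_zero, zero_mul, add_zero,
    Complex.ofReal_one, mul_one] at this

/-- The partition function with two adjacent perturbed rows. -/
noncomputable def pairSum (N i : ℕ) (β β' : ℂ) : ℂ :=
  ∑ C ∈ corners N, β ^ (rowA N C i + rowB N C (i + 1)) * β' ^ (rowB N C i + rowA N C (i + 1))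

theorem dwPart_pairParam {N i : ℕ} (hi : i + 1 < N) {x β β' : ℂ} (hβ : wtA x = wtC * β)
    (hβ' : wtA (-x) = wtC * β') :
    dwPart (0 : Fin N → ℂ) (List.ofFn (pairParam N i x)) = wtC ^ (N * N) * pairSum N i β β' := by
  rw [dwPart_eq_sum, pairSum, Finset.mul_sum]
  refine Finset.sum_congr rfl fun C _ => ?_
  rw [cornerWt]
  simp only [Pi.zero_apply, sub_zero]
  have hA0 : wtA 0 = wtC := by simp [wtA, wtC]
  have key : ∀ l : Fin N,
      wtA (pairParam N i x l) ^ rowA N C l * wtB (pairParam N i x l) ^ rowB N C l *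
      wtC ^ rowC N C l = wtC ^ N * (if (l : ℕ) = i then β ^ rowA N C l * β' ^ rowB N C l
        else if (l : ℕ) = i + 1 then β' ^ rowA N C l * β ^ rowB N C l else 1) := by
    intro l
    have h := rowA_add_rowB_add_rowC N C l
    have h' : ∀ γ γ' : ℂ, (wtC * γ) ^ rowA N C l * (wtC * γ') ^ rowB N C l * wtC ^ rowC N C l =
        wtC ^ N * (γ ^ rowA N C l * γ' ^ rowB N C l) := by
      intro γ γ'
      have e : wtC ^ N = wtC ^ rowA N C l * wtC ^ rowB N C l * wtC ^ rowC N C l := by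
        rw [← pow_add, ← pow_add, h]
      rw [e]
      ring
    rw [wtB_eq, pairParam]
    split_ifs with h1 h2
    · rw [hβ, hβ', h']
    · rw [neg_neg, hβ, hβ', h']
    · have := h' 1 1
      simpa [hA0] using this
  rw [Finset.prod_congr rfl fun (l : Fin N) _ => (prod_vertexWt N C l _ _ _).trans (key l),
    Finset.prod_mul_distrib, Finset.prod_const, Finset.card_univ, Fintype.card_fin, ← pow_mul]
  congr 1
  rw [Finset.prod_eq_mul (⟨i, by omega⟩ : Fin N) ⟨i + 1, hi⟩ (by simp)]
  · simp only [if_true, Nat.succ_ne_self, if_false]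
    ring
  · rintro l - ⟨h1, h2⟩
    rw [if_neg (by simpa [Fin.ext_iff] using h1), if_neg (by simpa [Fin.ext_iff] using h2)]
  · simp
  · simp

theorem pairSum_eq {N i j : ℕ} (hi : i + 1 < N) (hj : j + 1 < N) (t : ℝ) {β β' : ℂ}
    (hβ : β = Real.cosh t + (Real.sinh t / √3 : ℝ) * Complex.I)
    (hβ' : β' = Real.cosh t - (Real.sinh t / √3 : ℝ) * Complex.I) :
    pairSum N i β β' = pairSum N j β β' := by
  have h1 : wtA (t * Complex.I) = wtC * β := by rw [wtA_mul_I, hβ]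
  have h2 : wtA (-(t * Complex.I)) = wtC * β' := by
    have := wtA_mul_I (-t)
    rw [Complex.ofReal_neg, neg_mul] at this
    rw [this, hβ', Real.cosh_neg, Real.sinh_neg]
    push_cast
    ring
  have key := dwPart_perm (0 : Fin N → ℂ) (pairParam_perm hi hj (t * Complex.I)) (by
    intro x hx x' hx'
    have : ∀ y ∈ List.ofFn (pairParam N i (t * Complex.I)), ∃ s : ℝ, y = s * Complex.I := by
      intro y hy
      obtain ⟨l, rfl⟩ := (List.mem_ofFn' _ _).1 hy
      rw [pairParam]
      split_ifs
      exacts [⟨t, rfl⟩, ⟨-t, by push_cast; ring⟩, ⟨0, by simp⟩]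
    obtain ⟨s, rfl⟩ := this x hx
    obtain ⟨s', rfl⟩ := this x' hx'
    rw [← sub_mul, ← Complex.ofReal_sub]
    exact wtA_mul_I_ne_zero _)
  rw [dwPart_pairParam hi h1 h2, dwPart_pairParam hj h1 h2] at key
  exact mul_left_cancel₀ (pow_ne_zero _ wtC_ne_zero) key

theorem norm_pow_sub_one_le {u : ℂ} (hu : ‖u‖ = 1) (n : ℕ) : ‖u ^ n - 1‖ ≤ n * ‖u - 1‖ := by
  induction n with
  | zero => simp
  | succ n ih =>
    have e : u ^ (n + 1) - 1 = u ^ n * (u - 1) + (u ^ n - 1) := by ring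
    rw [e]
    refine (norm_add_le _ _).trans ?_
    rw [norm_mul, norm_pow, hu, one_pow, one_mul]
    push_cast
    linarith

theorem norm_pow_sub_pow_le {u : ℂ} (hu : ‖u‖ = 1) (p q : ℕ) :
    ‖u ^ p - u ^ q‖ ≤ |(p : ℝ) - q| * ‖u - 1‖ := by
  wlog h : q ≤ p generalizing p q
  · rw [norm_sub_rev, abs_sub_comm]
    exact this q p (by omega)
  obtain ⟨n, rfl⟩ := Nat.exists_eq_add_of_le h
  have := norm_pow_sub_one_le hu n
  rw [pow_add, ← mul_sub_one, norm_mul, norm_pow, hu, one_pow, one_mul]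
  simpa using this

theorem re_pow_mul_conj_pow_ge {u : ℂ} (hu : ‖u‖ = 1) (p q : ℕ) :
    1 - |(p : ℝ) - q| * ‖u - 1‖ ≤ (u ^ p * (starRingEnd ℂ u) ^ q).re := by
  have h1 : u * starRingEnd ℂ u = 1 := by rw [Complex.mul_conj, Complex.normSq_eq_norm_sq, hu]; simp
  have h2 : u ^ p * (starRingEnd ℂ u) ^ q - 1 = (u ^ p - u ^ q) * (starRingEnd ℂ u) ^ q := by
    rw [sub_mul, ← mul_pow u, h1, one_pow]
  have h3 := norm_pow_sub_pow_le hu p q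
  have h4 := (Complex.abs_re_le_norm (u ^ p * (starRingEnd ℂ u) ^ q - 1))
  rw [h2, norm_mul, norm_pow, Complex.norm_conj, hu, one_pow, mul_one, ← h2, Complex.sub_re,
    Complex.one_re] at h4
  linarith [(abs_le.1 (h4.trans h3)).1]

theorem norm_sub_one_le {u : ℂ} (hu : ‖u‖ = 1) (h0 : 0 ≤ u.re) : ‖u - 1‖ ≤ 2 * |u.im| := by
  refine abs_le_of_sq_le_sq' ?_ (by positivity) |>.2
  have h1 := Complex.sq_norm u
  rw [hu, Complex.normSq_apply] at h1
  rw [Complex.sq_norm, Complex.normSq_apply, mul_pow, sq_abs]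
  simp only [Complex.sub_re, Complex.sub_im, Complex.one_re, Complex.one_im]
  nlinarith

set_option maxHeartbeats 1000000 in
/-- Adjacent rows of a uniformly random alternating sign matrix differ at scale `√N`. -/
theorem le_sum_abs_row_sub {N j : ℕ} (hN : 131072 ≤ N) (hj : j + 1 < N) :
    √N * (1 / 1048576 - (4 * j + 4) / N) * (corners N).card ≤ ∑ C ∈ corners N,
      |((rowA N C j + rowB N C (j + 1) : ℕ) : ℝ) - (rowB N C j + rowA N C (j + 1) : ℕ)| := by
  have hN0 : (131072 : ℝ) ≤ N := by exact_mod_cast hN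
  have hsN : 0 < √(N : ℝ) := Real.sqrt_pos.2 (by linarith)
  have hsN2 : √(N : ℝ) ^ 2 = N := Real.sq_sqrt (by linarith)
  set v : ℝ := 1 / (2 * √N) with hv
  have hv0 : 0 < v := by positivity
  have hv2 : v ^ 2 = 1 / (4 * N) := by rw [hv, div_pow, mul_pow, hsN2]; norm_num
  have h3 : √3 ^ 2 = 3 := Real.sq_sqrt (by norm_num)
  have h30 : 0 < √3 := by positivity
  set t := Real.arsinh (√3 * v) with ht
  have hsinh : Real.sinh t / √3 = v := by rw [ht, Real.sinh_arsinh]; field_simp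
  have hcosh : Real.cosh t ^ 2 = 1 + 3 * v ^ 2 := by
    rw [Real.cosh_sq, ht, Real.sinh_arsinh, mul_pow, h3]; ring
  have hc0 := Real.cosh_pos t
  set r : ℝ := √(1 + 1 / N) with hr
  have hr2 : r ^ 2 = 1 + 1 / N := Real.sq_sqrt (by positivity)
  have hr1 : 1 ≤ r := Real.one_le_sqrt.2 (by simp)
  have hr0 : 0 < r := by linarith
  set u : ℂ := ⟨Real.cosh t / r, v / r⟩ with hu
  have hun : ‖u‖ = 1 := by
    have : ‖u‖ ^ 2 = 1 := by
      rw [Complex.sq_norm, Complex.normSq_apply, hu]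
      have : Real.cosh t ^ 2 + v ^ 2 = r ^ 2 := by
        rw [hcosh, hr2, add_assoc, ← add_one_mul, hv2]; congr 1; field_simp; norm_num
      field_simp
      linarith
    exact (pow_eq_one_iff_of_nonneg (norm_nonneg _) two_ne_zero).1 this
  have hu1 : ‖u - 1‖ ≤ 1 / √N := by
    refine (norm_sub_one_le hun (by positivity)).trans ?_
    rw [abs_of_pos (by positivity)]
    have : v / r ≤ v := div_le_self hv0.le hr1
    calc 2 * (v / r) ≤ 2 * v := by linarith
      _ = 1 / √N := by rw [hv]; field_simp
  set β : ℂ := r * u with hβ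
  set β' : ℂ := r * starRingEnd ℂ u with hβ'
  have eβ : β = Real.cosh t + (Real.sinh t / √3 : ℝ) * Complex.I := by
    rw [hsinh]
    apply Complex.ext <;> simp [hβ, hu] <;> field_simp
  have eβ' : β' = Real.cosh t - (Real.sinh t / √3 : ℝ) * Complex.I := by
    rw [hsinh]
    apply Complex.ext <;> simp [hβ', hu] <;> field_simp
  have hexp : ∀ C i, (rowA N C i + rowB N C (i + 1)) + (rowB N C i + rowA N C (i + 1)) +
      (rowC N C i + rowC N C (i + 1)) = 2 * N := by
    intro C i
    have := rowA_add_rowB_add_rowC N C i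
    have := rowA_add_rowB_add_rowC N C (i + 1)
    omega
  set ρ := r⁻¹ with hρ
  have hρ0 : 0 < ρ := by positivity
  have hrρ : r * ρ = 1 := mul_inv_cancel₀ hr0.ne'
  have hrow : ∀ C i, r ^ ((rowA N C i + rowB N C (i + 1)) + (rowB N C i + rowA N C (i + 1))) =
      r ^ (2 * N) * ρ ^ (rowC N C i + rowC N C (i + 1)) := by
    intro C i
    rw [← hexp C i, pow_add r (_ + _) (rowC _ _ _ + _), mul_assoc, ← mul_pow, hrρ, one_pow, mul_one]
  have hρ1 : ρ ≤ 1 := inv_le_one_of_one_le₀ hr1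
  have hρlow : 1 - 1 / N ≤ ρ := by
    have : r ≤ 1 + 1 / N := by
      have := le_self_pow₀ hr1 two_ne_zero
      rwa [hr2] at this
    rw [hρ, le_inv_comm₀ (by rw [sub_pos, div_lt_one (by linarith)]; linarith) hr0]
    refine this.trans ?_
    rw [← one_div, le_div_iff₀ (by rw [sub_pos, div_lt_one (by linarith)]; linarith)]
    have : (0 : ℝ) ≤ (1 / N) ^ 2 := by positivity
    nlinarith
  have hρup : ρ ≤ 1 - 1 / (4 * N) := by
    have h4 : (0 : ℝ) < 1 - 1 / (4 * N) := by
      rw [sub_pos, div_lt_one (by linarith)]; linarith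
    rw [hρ, inv_le_comm₀ hr0 h4]
    rw [← pow_le_pow_iff_left₀ (inv_nonneg.2 h4.le) hr0.le two_ne_zero, hr2, inv_pow,
      inv_le_iff_one_le_mul₀ (by positivity),
      show 1 + 1 / (N : ℝ) = 1 + 4 * (1 / (4 * N)) by field_simp]
    have h5 : 1 / (4 * (N : ℝ)) ≤ 1 / 8 := by
      rw [div_le_div_iff₀ (by linarith) (by norm_num)]; linarith
    have h6 : 0 < 1 / (4 * (N : ℝ)) := by positivity
    nlinarith [pow_pos h6 3]
  have hρc : ∀ c : ℕ, c ≤ N → ρ ^ c ≤ 1 - c / (8 * N) := by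
    intro c hc
    have hc' : (c : ℝ) ≤ N := by exact_mod_cast hc
    have h1 : ρ ≤ Real.exp (-(1 / (4 * N))) := by
      have := Real.add_one_le_exp (-(1 / (4 * (N : ℝ))))
      linarith
    have h2 := pow_le_pow_left₀ hρ0.le h1 c
    rw [← Real.exp_nat_mul] at h2
    have h3 := one_sub_ge_exp (u := c / (8 * N)) (by positivity)
      (by rw [div_le_iff₀ (by linarith)]; linarith)
    refine h2.trans (le_trans (le_of_eq ?_) h3)
    congr 1
    field_simp
    ring
  have hρc' : ∀ c : ℕ, 1 - c / N ≤ ρ ^ c := by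
    intro c
    have := one_add_mul_le_pow (a := ρ - 1) (by linarith) c
    rw [add_sub_cancel] at this
    refine le_trans ?_ this
    have : (c : ℝ) * (1 - 1 / N) ≤ c * ρ := by gcongr
    have e : (c : ℝ) / N = c * (1 / N) := by ring
    rw [e]
    linarith
  set A : ℝ := ((corners N).card : ℝ) with hA
  set W := r ^ (2 * N) with hW
  have hW0 : 0 < W := by positivity
  have hup : ∀ i, ‖pairSum N i β β'‖ ≤ W * ∑ C ∈ corners N, (1 - (rowC N C i : ℝ) / (8 * N)) := by
    intro i
    rw [Finset.mul_sum]
    refine norm_sum_le_of_le _ fun C _ => ?_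
    rw [norm_mul, norm_pow, norm_pow, hβ, hβ', norm_mul, norm_mul, Complex.norm_conj, hun, mul_one,
      ← pow_add, Complex.norm_real, Real.norm_of_nonneg hr0.le, hrow]
    refine mul_le_mul_of_nonneg_left ?_ hW0.le
    refine (pow_le_pow_of_le_one hρ0.le hρ1 (Nat.le_add_right _ _)).trans (hρc _ ?_)
    have := rowA_add_rowB_add_rowC N C i
    omega
  have hlow : W * ∑ C ∈ corners N, ((1 - (4 * j + 4) / N) -
      |((rowA N C j + rowB N C (j + 1) : ℕ) : ℝ) - (rowB N C j + rowA N C (j + 1) : ℕ)| * (1 / √N)) ≤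
      (pairSum N j β β').re := by
    rw [pairSum, Complex.re_sum, Finset.mul_sum]
    refine Finset.sum_le_sum fun C hC => ?_
    have hC' := mem_corners.1 hC
    rw [hβ, hβ', mul_pow, mul_pow, mul_mul_mul_comm, ← pow_add, ← Complex.ofReal_pow,
      Complex.re_ofReal_mul, hrow, mul_assoc]
    refine mul_le_mul_of_nonneg_left ?_ hW0.le
    set p := rowA N C j + rowB N C (j + 1)
    set q := rowB N C j + rowA N C (j + 1)
    have h1 := re_pow_mul_conj_pow_ge hun p q
    have h2 : |(p : ℝ) - q| * ‖u - 1‖ ≤ |(p : ℝ) - q| * (1 / √N) := by gcongr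
    have h3 := hρc' (rowC N C j + rowC N C (j + 1))
    have h4 : ((rowC N C j + rowC N C (j + 1) : ℕ) : ℝ) ≤ 4 * j + 4 := by
      have := hC'.rowC_le (i := j) (by omega)
      have := hC'.rowC_le (i := j + 1) hj
      have : rowC N C j + rowC N C (j + 1) ≤ 4 * j + 4 := by omega
      exact_mod_cast this
    have h5 : ((rowC N C j + rowC N C (j + 1) : ℕ) : ℝ) / N ≤ (4 * j + 4) / N := by gcongr
    have h6 : ρ ^ (rowC N C j + rowC N C (j + 1)) ≤ 1 := pow_le_one₀ hρ0.le hρ1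
    have h7 : 0 < ρ ^ (rowC N C j + rowC N C (j + 1)) := by positivity
    have h8 : 0 ≤ |(p : ℝ) - q| * (1 / √N) := by positivity
    nlinarith
  have havg : ((N : ℝ) - 1) * ‖pairSum N j β β'‖ ≤
      W * (((N : ℝ) - 1) * (A * (1 - 1 / 1048576))) := by
    obtain ⟨n, rfl⟩ : ∃ n, N = n + 1 := ⟨N - 1, by omega⟩
    have h1 : ((n + 1 : ℕ) - 1 : ℝ) * ‖pairSum (n + 1) j β β'‖ =
        ∑ i ∈ Finset.range n, ‖pairSum (n + 1) i β β'‖ := by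
      rw [Finset.sum_congr rfl fun i hi => by
        rw [pairSum_eq (by have := Finset.mem_range.1 hi; omega) hj t eβ eβ'], Finset.sum_const,
        nsmul_eq_mul, Finset.card_range]
      push_cast
      ring
    rw [h1]
    refine (Finset.sum_le_sum fun i _ => hup i).trans ?_
    rw [← Finset.mul_sum]
    refine mul_le_mul_of_nonneg_left ?_ hW0.le
    have h2 := le_sum_rowC (N := n + 1) (by omega)
    rw [Finset.sum_comm]
    have h3 : ∀ C ∈ corners (n + 1), ∑ i ∈ Finset.range n,
        (1 - (rowC (n + 1) C i : ℝ) / (8 * (n + 1 : ℕ))) ≤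
        n + 1 / 8 - ((∑ i ∈ Finset.range (n + 1), rowC (n + 1) C i : ℕ) : ℝ) * (1 / (8 * (n + 1 : ℕ))) := by
      intro C _
      have h4 : rowC (n + 1) C n ≤ n + 1 := by
        have := rowA_add_rowB_add_rowC (n + 1) C n
        omega
      have h5 : (rowC (n + 1) C n : ℝ) * (1 / (8 * (n + 1 : ℕ))) ≤ 1 / 8 := by
        have : (rowC (n + 1) C n : ℝ) ≤ (n + 1 : ℕ) := by exact_mod_cast h4
        rw [mul_one_div, div_le_div_iff₀ (by positivity) (by norm_num)]
        linarith
      rw [Finset.sum_sub_distrib, Finset.sum_const, Finset.card_range, nsmul_eq_mul, mul_one,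
        Finset.sum_range_succ]
      push_cast at h5 ⊢
      rw [add_mul, Finset.sum_mul]
      simp only [mul_one_div] at h5 ⊢
      linarith
    refine (Finset.sum_le_sum h3).trans ?_
    rw [Finset.sum_sub_distrib, Finset.sum_const, nsmul_eq_mul, ← hA, ← Finset.sum_mul]
    have h4 := mul_le_mul_of_nonneg_right h2 (show (0 : ℝ) ≤ 1 / (8 * (n + 1 : ℕ)) by positivity)
    refine (sub_le_sub_left h4 _).trans ?_
    rw [← hA]
    have e : ((n + 1 : ℕ) : ℝ) ^ 2 / 65536 * A * (1 / (8 * (n + 1 : ℕ))) =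
      (n + 1 : ℕ) / 524288 * A := by field_simp; ring
    rw [e]
    have hA0 : 0 ≤ A := by positivity
    have hn : (131071 : ℝ) ≤ n := by push_cast at hN0; linarith
    clear_value A
    push_cast
    have := mul_nonneg hA0 (sub_nonneg.2 hn)
    ring_nf at this ⊢
    linarith only [this, hA0]
  have hG : ‖pairSum N j β β'‖ ≤ W * (A * (1 - 1 / 1048576)) := by
    rw [mul_left_comm] at havg
    exact le_of_mul_le_mul_left havg (by linarith)
  have key := hlow.trans ((Complex.re_le_norm _).trans hG)
  have key2 := le_of_mul_le_mul_left key hW0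
  rw [Finset.sum_sub_distrib, Finset.sum_const, nsmul_eq_mul, ← hA, ← Finset.sum_mul, mul_one_div,
    sub_le_iff_le_add', ← sub_le_iff_le_add, le_div_iff₀ hsN] at key2
  refine le_trans (le_of_eq ?_) key2
  ring

/-- The sum of the entries of level `j` minus the sum of the entries of level `j - 1`. -/
def levelDiff (X : ℕ → ℕ → ℤ) (j : ℕ) : ℤ :=
  ∑ p ∈ Finset.range (j + 1), X p (j - p) - ∑ p ∈ Finset.range j, X p (j - 1 - p)

theorem IsCornerSum.abs_rowA_sub_rowB_le {N : ℕ} {C : ℕ → ℕ → ℤ} (h : IsCornerSum N C) {j : ℕ}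
    (hj : j < N) : |((rowA N C j : ℤ) - rowB N C j) -
      (2 * levelDiff (triangleOf N C) j - N + 2)| ≤ 2 * (2 * j + 1) := by
  have h1 := h.abs_rowA_sub_rowB hj
  rw [h.sum_eq (j := j + 1) (by omega), h.sum_eq (j := j) hj.le] at h1
  refine le_of_eq_of_le ?_ h1
  congr 2
  simp only [levelDiff, Finset.sum_sub_distrib, Finset.sum_const, Finset.card_range,
    nsmul_eq_mul, Nat.add_sub_cancel]
  push_cast
  ring

theorem le_sum_abs_levelDiff {N j : ℕ} (hN : 131072 ≤ N) (hj : j + 1 < N) :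
    (√N * (1 / 2097152 - (2 * j + 2) / N) - (4 * j + 4)) * (triangles N).card ≤
      ∑ X ∈ triangles N, |(levelDiff X (j + 1) : ℝ) - levelDiff X j| := by
  rw [card_triangles, sum_triangles]
  have h := le_sum_abs_row_sub hN hj
  have h1 : ∀ C ∈ corners N,
      |((rowA N C j + rowB N C (j + 1) : ℕ) : ℝ) - (rowB N C j + rowA N C (j + 1) : ℕ)| ≤
        2 * |(levelDiff (triangleOf N C) (j + 1) : ℝ) - levelDiff (triangleOf N C) j| +
          (8 * j + 8) := by
    intro C hC
    have h2 := (mem_corners.1 hC).abs_rowA_sub_rowB_le (j := j) (by omega)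
    have h3 := (mem_corners.1 hC).abs_rowA_sub_rowB_le (j := j + 1) hj
    have h4 : |((rowA N C j + rowB N C (j + 1) : ℕ) : ℤ) - (rowB N C j + rowA N C (j + 1) : ℕ)| ≤
        2 * |levelDiff (triangleOf N C) (j + 1) - levelDiff (triangleOf N C) j| +
          (8 * j + 8) := by
      rw [abs_le] at h2 h3
      push_cast at h2 h3 ⊢
      rcases abs_cases (levelDiff (triangleOf N C) (j + 1) - levelDiff (triangleOf N C) j) with e | e
      · rw [e.1, abs_le]
        constructor <;> linarith
      · rw [e.1, abs_le]
        constructor <;> linarith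
    exact_mod_cast h4
  have h2 := h.trans (Finset.sum_le_sum h1)
  rw [Finset.sum_add_distrib, Finset.sum_const, nsmul_eq_mul, ← Finset.mul_sum] at h2
  have e : (4 * (j : ℝ) + 4) / N = 2 * ((2 * j + 2) / N) := by ring
  rw [e] at h2
  linarith

theorem exists_le_expect_levelDiff : ∃ c : ℝ, 0 < c ∧ ∀ j : ℕ, ∀ᶠ N : ℕ in Filter.atTop,
    c * √N ≤ (triangles N).expect fun X => |(levelDiff X (j + 1) : ℝ) - levelDiff X j| := by
  refine ⟨1 / 4194304, by norm_num, fun j => ?_⟩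
  have h1 : Filter.Tendsto (fun N : ℕ => √(N : ℝ)) Filter.atTop Filter.atTop :=
    Real.tendsto_sqrt_atTop.comp tendsto_natCast_atTop_atTop
  filter_upwards [h1.eventually_ge_atTop (4194304 * (6 * j + 6)), Filter.eventually_ge_atTop 131072,
    Filter.eventually_gt_atTop (j + 1)] with N h2 hN hj
  have hc : (0 : ℝ) < (triangles N).card := by exact_mod_cast (triangles_nonempty N).card_pos
  rw [Finset.expect_eq_sum_div_card, le_div_iff₀ hc]
  refine le_trans (mul_le_mul_of_nonneg_right ?_ hc.le) (le_sum_abs_levelDiff hN hj)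
  have hj0 : (0 : ℝ) ≤ j := by positivity
  have h3 : √(N : ℝ) * ((2 * j + 2) / N) ≤ 2 * j + 2 := by
    have hN0 : (0 : ℝ) < N := by positivity
    rw [mul_div_assoc', div_le_iff₀ hN0, mul_comm]
    refine mul_le_mul_of_nonneg_left ?_ (by positivity)
    nth_rewrite 2 [← Real.sq_sqrt hN0.le]
    nlinarith
  rw [mul_sub]
  linarith

open scoped FinsetFamily in
theorem card_mul_card_le_of_shift {P Q R S : Finset (ℕ → ℕ → ℤ)} (r : ℤ)
    (h : ∀ x ∈ P, ∀ y ∈ Q, (fun a b => min (x a b + r) (y a b)) ∈ R ∧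
      (fun a b => max (x a b) (y a b - r)) ∈ S) : P.card * Q.card ≤ R.card * S.card := by
  classical
  set sh : (ℕ → ℕ → ℤ) ↪ (ℕ → ℕ → ℤ) := ⟨fun x a b => x a b + r, fun x y e => by
    funext a b
    simpa using congrFun (congrFun e a) b⟩ with hsh
  have key := Finset.le_card_infs_mul_card_sups (P.map sh) Q
  rw [Finset.card_map] at key
  refine key.trans (Nat.mul_le_mul (Finset.card_le_card ?_) ?_)
  · intro z hz
    obtain ⟨x, hx, y, hy, rfl⟩ := Finset.mem_infs.1 hz
    obtain ⟨x, hx', rfl⟩ := Finset.mem_map.1 hx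
    exact (h x hx' y hy).1
  · rw [← Finset.card_map sh (s := S)]
    refine Finset.card_le_card fun z hz => ?_
    obtain ⟨x, hx, y, hy, rfl⟩ := Finset.mem_sups.1 hz
    obtain ⟨x, hx', rfl⟩ := Finset.mem_map.1 hx
    refine Finset.mem_map.2 ⟨_, (h x hx' y hy).2, ?_⟩
    funext a b
    change max (x a b) (y a b - r) + r = max (x a b + r) (y a b)
    omega

theorem sum_card_filter_le {α β : Type*} [DecidableEq β] (T : Finset α) (I : Finset ℤ) (v : α → β)
    (f : ℤ → β) (hf : Function.Injective f) :
    ∑ p ∈ I, (T.filter fun x => v x = f p).card ≤ T.card := by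
  have h := Finset.sum_card_bipartiteAbove_eq_sum_card_bipartiteBelow (s := I) (t := T)
    fun p x => v x = f p
  simp only [Finset.bipartiteAbove, Finset.bipartiteBelow] at h
  rw [h, Finset.card_eq_sum_ones]
  refine Finset.sum_le_sum fun x _ => Finset.card_le_one.2 fun p hp q hq => hf ?_
  rw [← (Finset.mem_filter.1 hp).2, ← (Finset.mem_filter.1 hq).2]

/-- A family of height functions that is closed under shifted lattice operations. -/
def ShiftClosed (Ω : Finset (ℕ → ℕ → ℤ)) : Prop :=
  ∀ x ∈ Ω, ∀ y ∈ Ω, ∀ r : ℤ, 0 ≤ r → (fun a b => min (x a b + r) (y a b)) ∈ Ω ∧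
    (fun a b => max (x a b) (y a b - r)) ∈ Ω

/-- The members of `Ω` whose values at `u` and `v` differ by `i`. -/
def gapSet (Ω : Finset (ℕ → ℕ → ℤ)) (u v : ℕ × ℕ) (i : ℤ) : Finset (ℕ → ℕ → ℤ) :=
  Ω.filter fun x => x u.1 u.2 - x v.1 v.2 = i

/-- The distribution of a gap is log-concave up to a factor of two. -/
theorem ShiftClosed.gapSet_mul_le {Ω : Finset (ℕ → ℕ → ℤ)} (h : ShiftClosed Ω) (u v : ℕ × ℕ)
    (i : ℤ) (m n : ℕ) : (gapSet Ω u v i).card * (gapSet Ω u v (i + m + n)).card ≤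
      2 * ((gapSet Ω u v (i + m)).card * (gapSet Ω u v (i + n)).card) := by
  classical
  set I := Ω.image fun x => x v.1 v.2 with hI
  set G : ℤ → ℤ → Finset (ℕ → ℕ → ℤ) := fun i p =>
    (gapSet Ω u v i).filter fun x => x v.1 v.2 = p with hG
  have hmem : ∀ {i p x}, x ∈ G i p ↔ x ∈ Ω ∧ x u.1 u.2 - x v.1 v.2 = i ∧ x v.1 v.2 = p := by
    intro i p x
    simp only [hG, gapSet, Finset.mem_filter, and_assoc]
  have htot : ∀ i, (gapSet Ω u v i).card = ∑ p ∈ I, (G i p).card := by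
    intro i
    refine Finset.card_eq_sum_card_fiberwise fun x hx => ?_
    exact Finset.mem_image_of_mem _ (Finset.mem_filter.1 hx).1
  have h1 : ∀ p q : ℤ, p - q ≤ m → (G i p).card * (G (i + m + n) q).card ≤
      (G (i + m) q).card * (G (i + n) p).card := by
    intro p q hpq
    refine card_mul_card_le_of_shift (q - p + m) fun x hx y hy => ?_
    rw [hmem] at hx hy
    rw [hmem, hmem]
    have := h x hx.1 y hy.1 (q - p + m) (by omega)
    refine ⟨⟨this.1, ?_, ?_⟩, this.2, ?_, ?_⟩ <;> omega
  have h2 : ∀ p q : ℤ, m ≤ p - q → (G i p).card * (G (i + m + n) q).card ≤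
      (G (i + m) (p - m)).card * (G (i + n) (q + m)).card := by
    intro p q hpq
    rw [mul_comm]
    refine card_mul_card_le_of_shift (p - q - m) fun y hy x hx => ?_
    rw [hmem] at hx hy
    rw [hmem, hmem]
    have := h y hy.1 x hx.1 (p - q - m) (by omega)
    refine ⟨⟨this.1, ?_, ?_⟩, this.2, ?_, ?_⟩ <;> omega
  calc (gapSet Ω u v i).card * (gapSet Ω u v (i + m + n)).card
      = ∑ p ∈ I, ∑ q ∈ I, (G i p).card * (G (i + m + n) q).card := by
        rw [htot, htot, Finset.sum_mul_sum]
    _ ≤ ∑ p ∈ I, ∑ q ∈ I, ((G (i + m) q).card * (G (i + n) p).card +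
          (G (i + m) (p - m)).card * (G (i + n) (q + m)).card) := by
        refine Finset.sum_le_sum fun p _ => Finset.sum_le_sum fun q _ => ?_
        rcases le_total (p - q) m with hpq | hpq
        · exact (h1 p q hpq).trans (Nat.le_add_right _ _)
        · exact (h2 p q hpq).trans (Nat.le_add_left _ _)
    _ = (∑ q ∈ I, (G (i + m) q).card) * (∑ p ∈ I, (G (i + n) p).card) +
          (∑ p ∈ I, (G (i + m) (p - m)).card) * (∑ q ∈ I, (G (i + n) (q + m)).card) := by
        simp only [Finset.sum_add_distrib]
        rw [Finset.sum_comm, Finset.sum_mul_sum, Finset.sum_mul_sum]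
    _ ≤ (gapSet Ω u v (i + m)).card * (gapSet Ω u v (i + n)).card +
          (gapSet Ω u v (i + m)).card * (gapSet Ω u v (i + n)).card := by
        refine Nat.add_le_add (Nat.mul_le_mul ?_ ?_) (Nat.mul_le_mul ?_ ?_)
        · exact (htot _).ge
        · exact (htot _).ge
        · exact sum_card_filter_le _ _ _ _ (sub_left_injective (b := (m : ℤ)))
        · exact sum_card_filter_le _ _ _ _ (add_left_injective (m : ℤ))
    _ = _ := (two_mul _).symm

theorem ShiftClosed.gapSet_mul_sum_le {Ω : Finset (ℕ → ℕ → ℤ)} (h : ShiftClosed Ω) (u v : ℕ × ℕ)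
    (i : ℤ) : ((gapSet Ω u v i).card : ℤ) * ∑ x ∈ Ω, (x u.1 u.2 - x v.1 v.2 - i + 1) ≤
      2 * Ω.card ^ 2 := by
  classical
  obtain ⟨L, hL⟩ : ∃ L : ℕ, ∀ x ∈ Ω, x u.1 u.2 - x v.1 v.2 - i < L := by
    refine ⟨∑ x ∈ Ω, ((x u.1 u.2 - x v.1 v.2 - i).toNat + 1), fun x hx => ?_⟩
    have := Finset.single_le_sum (f := fun x : ℕ → ℕ → ℤ => (x u.1 u.2 - x v.1 v.2 - i).toNat + 1)
      (fun _ _ => Nat.zero_le _) hx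
    omega
  set p : ℕ → ℕ := fun k => (gapSet Ω u v (i + k)).card with hp
  have hp' : ∀ (K : ℕ), ∑ k ∈ Finset.range K, p k ≤ Ω.card := by
    intro K
    have h1 := sum_card_filter_le Ω ((Finset.range K).map Nat.castEmbedding)
      (fun x => x u.1 u.2 - x v.1 v.2) (fun k => i + k) (add_right_injective i)
    rwa [Finset.sum_map] at h1
  have h1 : ∑ x ∈ Ω, (x u.1 u.2 - x v.1 v.2 - i + 1) ≤
      ∑ k ∈ Finset.range L, (((k + 1) * p k : ℕ) : ℤ) := by
    have e : ∀ k ∈ Finset.range L, (((k + 1) * p k : ℕ) : ℤ) =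
        ∑ x ∈ Ω, if x u.1 u.2 - x v.1 v.2 = i + k then (k + 1 : ℤ) else 0 := by
      intro k _
      rw [← Finset.sum_filter, Finset.sum_const, nsmul_eq_mul]
      push_cast
      rw [mul_comm]
      rfl
    rw [Finset.sum_congr rfl e, Finset.sum_comm]
    refine Finset.sum_le_sum fun x hx => ?_
    by_cases hx0 : x u.1 u.2 - x v.1 v.2 - i + 1 ≤ 0
    · refine hx0.trans (Finset.sum_nonneg fun k _ => ?_)
      split_ifs <;> positivity
    · have h2 := hL x hx
      have h3 := Finset.single_le_sum
        (f := fun k : ℕ => if x u.1 u.2 - x v.1 v.2 = i + k then (k + 1 : ℤ) else 0)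
        (fun k _ => by split_ifs <;> positivity)
        (Finset.mem_range.2 (show (x u.1 u.2 - x v.1 v.2 - i).toNat < L by omega))
      refine le_trans ?_ h3
      rw [if_pos (by omega)]
      omega
  have h2 : p 0 * ∑ k ∈ Finset.range L, (k + 1) * p k ≤ 2 * Ω.card ^ 2 := by
    calc p 0 * ∑ k ∈ Finset.range L, (k + 1) * p k
        = ∑ k ∈ Finset.range L, ∑ m ∈ Finset.range (k + 1), p 0 * p k := by
          rw [Finset.mul_sum]
          refine Finset.sum_congr rfl fun k _ => ?_
          rw [Finset.sum_const, Finset.card_range, smul_eq_mul]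
          ring
      _ ≤ ∑ k ∈ Finset.range L, ∑ m ∈ Finset.range (k + 1), 2 * (p m * p (k - m)) := by
          refine Finset.sum_le_sum fun k _ => Finset.sum_le_sum fun m hm => ?_
          have := h.gapSet_mul_le u v i m (k - m)
          have hm' : m ≤ k := by have := Finset.mem_range.1 hm; omega
          rw [add_assoc i, ← Nat.cast_add, Nat.add_sub_cancel' hm'] at this
          simpa [hp] using this
      _ = 2 * ∑ k ∈ Finset.range L, ∑ m ∈ Finset.range (k + 1), p m * p (k - m) := by
          simp only [Finset.mul_sum]
      _ ≤ 2 * ∑ m ∈ Finset.range L, ∑ n ∈ Finset.range L, p m * p n := by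
          refine Nat.mul_le_mul_left _ ?_
          rw [Finset.sum_sigma', ← Finset.sum_product']
          rw [← Finset.sum_image (s := (Finset.range L).sigma fun k => Finset.range (k + 1))
            (g := fun z => (z.2, z.1 - z.2)) (f := fun z : ℕ × ℕ => p z.1 * p z.2)]
          · refine Finset.sum_le_sum_of_subset fun z hz => ?_
            simp only [Finset.mem_image, Finset.mem_sigma, Finset.mem_range, Sigma.exists,
              Finset.mem_product] at hz ⊢
            obtain ⟨a, b, h1, rfl⟩ := hz
            dsimp only at h1 ⊢
            omega
          · rintro ⟨a, b⟩ hz ⟨a', b'⟩ hz' e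
            simp only [Finset.coe_sigma, Set.mem_sigma_iff, Finset.mem_coe, Finset.mem_range,
              Prod.mk.injEq] at hz hz' e
            obtain ⟨rfl, e⟩ := e
            have : a = a' := by omega
            rw [this]
      _ ≤ 2 * Ω.card ^ 2 := by
          rw [← Finset.sum_mul_sum, sq]
          exact Nat.mul_le_mul_left _ (Nat.mul_le_mul (hp' L) (hp' L))
  have h3 : ((gapSet Ω u v i).card : ℤ) = p 0 := by simp [hp]
  rw [h3]
  refine (mul_le_mul_of_nonneg_left h1 (by positivity)).trans ?_
  exact_mod_cast h2

theorem shiftClosed_triangles (N : ℕ) : ShiftClosed (triangles N) := by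
  intro x hx y hy r hr
  rw [mem_triangles] at hx hy
  rw [mem_triangles, mem_triangles]
  refine ⟨⟨fun a b h => ?_, fun a b h => ?_, fun a b h => ?_, fun a b h => ?_, fun a b h => ?_⟩,
    ⟨fun a b h => ?_, fun a b h => ?_, fun a b h => ?_, fun a b h => ?_, fun a b h => ?_⟩⟩
  · have := hx.le_left a b h; have := hy.le_left a b h; omega
  · have := hx.le_right a b h; have := hy.le_right a b h; omega
  · have := hx.lt a b h; have := hy.lt a b h; omega
  · have := hx.bot a b h; have := hy.bot a b h; omega
  · have := hx.out a b h; have := hy.out a b h; omega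
  · have := hx.le_left a b h; have := hy.le_left a b h; omega
  · have := hx.le_right a b h; have := hy.le_right a b h; omega
  · have := hx.lt a b h; have := hy.lt a b h; omega
  · have := hx.bot a b h; have := hy.bot a b h; omega
  · have := hx.out a b h; have := hy.out a b h; omega

open Filter

theorem card_triangles_pos (N : ℕ) : (0 : ℝ) < (triangles N).card := by
  exact_mod_cast (triangles_nonempty N).card_pos

/-- A gap with a large mean is unlikely to be small. -/
theorem card_gap_le_mul_le (N : ℕ) (u v : ℕ × ℕ) (L : ℕ)
    (h : ∀ X ∈ triangles N, X v.1 v.2 ≤ X u.1 u.2) :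
    (((triangles N).filter fun X => X u.1 u.2 - X v.1 v.2 ≤ (L : ℤ)).card : ℝ) *
      ((triangles N).expect (fun X => (X u.1 u.2 : ℝ) - X v.1 v.2) - L) ≤
        2 * (L + 1) * (triangles N).card := by
  have hc := card_triangles_pos N
  set A : ℝ := ((triangles N).card : ℝ) with hA
  set e := (triangles N).expect (fun X => (X u.1 u.2 : ℝ) - X v.1 v.2) with he
  have hsum : ∑ X ∈ triangles N, ((X u.1 u.2 : ℝ) - X v.1 v.2) = A * e := by
    rw [he, Finset.expect_eq_sum_div_card, ← hA, mul_div_cancel₀ _ hc.ne']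
  have h1 : ∀ i ∈ Finset.range (L + 1),
      ((gapSet (triangles N) u v i).card : ℝ) * (e - L) ≤ 2 * A := by
    intro i hi
    have h2 := (shiftClosed_triangles N).gapSet_mul_sum_le u v i
    have h3 : ((gapSet (triangles N) u v i).card : ℝ) * ∑ X ∈ triangles N,
        (((X u.1 u.2 : ℝ) - X v.1 v.2) - i + 1) ≤ 2 * ((triangles N).card : ℝ) ^ 2 := by
      exact_mod_cast h2
    rw [← hA, Finset.sum_add_distrib, Finset.sum_sub_distrib, hsum] at h3
    simp only [Finset.sum_const, nsmul_eq_mul, ← hA] at h3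
    have hi' : (i : ℝ) ≤ L := by exact_mod_cast Finset.mem_range_succ_iff.1 hi
    refine le_of_mul_le_mul_right (le_trans ?_ (h3.trans_eq (by ring : _ = 2 * A * A))) hc
    rw [mul_assoc]
    refine mul_le_mul_of_nonneg_left ?_ (by positivity)
    nlinarith
  have h2 : ((triangles N).filter fun X => X u.1 u.2 - X v.1 v.2 ≤ (L : ℤ)).card ≤
      ∑ i ∈ Finset.range (L + 1), (gapSet (triangles N) u v i).card := by
    classical
    refine (Finset.card_le_card fun X hX => ?_).trans Finset.card_biUnion_le
    rw [Finset.mem_filter] at hX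
    have := h X hX.1
    rw [Finset.mem_biUnion]
    refine ⟨(X u.1 u.2 - X v.1 v.2).toNat, Finset.mem_range.2 (by omega), ?_⟩
    exact Finset.mem_filter.2 ⟨hX.1, by omega⟩
  have h3 : (((triangles N).filter fun X => X u.1 u.2 - X v.1 v.2 ≤ (L : ℤ)).card : ℝ) ≤
      ∑ i ∈ Finset.range (L + 1), ((gapSet (triangles N) u v i).card : ℝ) := by exact_mod_cast h2
  rcases le_total 0 (e - L) with h0 | h0
  · refine (mul_le_mul_of_nonneg_right h3 h0).trans ?_
    rw [Finset.sum_mul]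
    refine (Finset.sum_le_sum h1).trans (le_of_eq ?_)
    rw [Finset.sum_const, Finset.card_range, nsmul_eq_mul]
    push_cast
    ring
  · exact (mul_nonpos_of_nonneg_of_nonpos (by positivity) h0).trans (by positivity)

/-- The expectation of `f` over monotone triangles of size `N` stays bounded along `F`. -/
def ExpectBounded (F : Filter ℕ) (f : (ℕ → ℕ → ℤ) → ℝ) : Prop :=
  ∃ M : ℝ, ∀ᶠ N in F, (triangles N).expect f ≤ M

theorem ExpectBounded.mono {F : Filter ℕ} {f g : (ℕ → ℕ → ℤ) → ℝ} (h : ExpectBounded F f)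
    (hgf : ∀ᶠ N in F, ∀ X ∈ triangles N, g X ≤ f X) : ExpectBounded F g := by
  obtain ⟨M, hM⟩ := h
  refine ⟨M, ?_⟩
  filter_upwards [hM, hgf] with N h1 h2
  exact (Finset.expect_le_expect h2).trans h1

theorem ExpectBounded.add {F : Filter ℕ} {f g : (ℕ → ℕ → ℤ) → ℝ} (hf : ExpectBounded F f)
    (hg : ExpectBounded F g) : ExpectBounded F fun X => f X + g X := by
  obtain ⟨M, hM⟩ := hf
  obtain ⟨M', hM'⟩ := hg
  refine ⟨M + M', ?_⟩
  filter_upwards [hM, hM'] with N h1 h2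
  rw [Finset.expect_add_distrib]
  exact add_le_add h1 h2

theorem expectBounded_const (F : Filter ℕ) (c : ℝ) : ExpectBounded F fun _ => c :=
  ⟨c, .of_forall fun N => (Finset.expect_const (triangles_nonempty N) c).le⟩

theorem ExpectBounded.sum {ι : Type*} {F : Filter ℕ} {s : Finset ι}
    {f : ι → (ℕ → ℕ → ℤ) → ℝ} (h : ∀ i ∈ s, ExpectBounded F (f i)) :
    ExpectBounded F fun X => ∑ i ∈ s, f i X := by
  classical
  induction s using Finset.induction_on with
  | empty => simpa using expectBounded_const F 0
  | insert a s ha ih =>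
    simp only [Finset.sum_insert ha]
    exact (h a (Finset.mem_insert_self _ _)).add
      (ih fun i hi => h i (Finset.mem_insert_of_mem hi))

theorem eventually_lt_of_not_expectBounded {F : Ultrafilter ℕ} {f : (ℕ → ℕ → ℤ) → ℝ}
    (h : ¬ ExpectBounded F f) (M : ℝ) : ∀ᶠ N in F, M < (triangles N).expect f := by
  have h1 : ¬ ∀ᶠ N in F, (triangles N).expect f ≤ M := fun hM => h ⟨M, hM⟩
  rw [← Ultrafilter.eventually_not] at h1
  simpa using h1

/-- If the minimum of two gaps has bounded mean, then one of them has. -/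
theorem ExpectBounded.or_of_min {F : Ultrafilter ℕ} {u v u' v' : ℕ × ℕ}
    (h : ExpectBounded F fun X => min ((X u.1 u.2 : ℝ) - X v.1 v.2) (X u'.1 u'.2 - X v'.1 v'.2))
    (h1 : ∀ᶠ N in F, ∀ X ∈ triangles N, X v.1 v.2 ≤ X u.1 u.2)
    (h2 : ∀ᶠ N in F, ∀ X ∈ triangles N, X v'.1 v'.2 ≤ X u'.1 u'.2) :
    ExpectBounded F (fun X => (X u.1 u.2 : ℝ) - X v.1 v.2) ∨
      ExpectBounded F (fun X => (X u'.1 u'.2 : ℝ) - X v'.1 v'.2) := by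
  by_contra! hn
  obtain ⟨M, hM⟩ := h
  obtain ⟨L, hL⟩ := exists_nat_ge (2 * M)
  obtain ⟨N, h1, h2, hM, h3, h4⟩ := (h1.and (h2.and (hM.and
    ((eventually_lt_of_not_expectBounded hn.1 (L + 16 * (L + 1))).and
      (eventually_lt_of_not_expectBounded hn.2 (L + 16 * (L + 1))))))).exists
  have hc := card_triangles_pos N
  have small : ∀ u v : ℕ × ℕ, (∀ X ∈ triangles N, X v.1 v.2 ≤ X u.1 u.2) →
      (L + 16 * (L + 1) : ℝ) < (triangles N).expect (fun X => (X u.1 u.2 : ℝ) - X v.1 v.2) →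
      (((triangles N).filter fun X => X u.1 u.2 - X v.1 v.2 ≤ (L : ℤ)).card : ℝ) ≤
        (triangles N).card / 8 := by
    intro u v h h'
    have key := card_gap_le_mul_le N u v L h
    have : (((triangles N).filter fun X => X u.1 u.2 - X v.1 v.2 ≤ (L : ℤ)).card : ℝ) *
        (16 * (L + 1)) ≤ 2 * (L + 1) * (triangles N).card :=
      le_trans (mul_le_mul_of_nonneg_left (by linarith) (by positivity)) key
    refine le_of_mul_le_mul_right (this.trans_eq ?_) (by positivity : (0 : ℝ) < 16 * (L + 1))
    ring
  have s1 := small u v h1 h3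
  have s2 := small u' v' h2 h4
  set T := (triangles N).filter fun X =>
    (L : ℤ) + 1 ≤ min (X u.1 u.2 - X v.1 v.2) (X u'.1 u'.2 - X v'.1 v'.2) with hT
  have s3 : (T.card : ℝ) * (L + 1) ≤ M * (triangles N).card := by
    rw [Finset.expect_eq_sum_div_card, div_le_iff₀ hc] at hM
    refine le_trans ?_ hM
    rw [← nsmul_eq_mul, ← Finset.sum_const]
    refine (Finset.sum_le_sum fun X hX => ?_).trans
      (Finset.sum_le_sum_of_subset_of_nonneg (Finset.filter_subset _ _) fun X hX _ => ?_)
    · have := (Finset.mem_filter.1 hX).2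
      exact_mod_cast this
    · have e1 := h1 X hX
      have e2 := h2 X hX
      refine le_min ?_ ?_ <;> rw [sub_nonneg] <;> assumption_mod_cast
  have s4 : (triangles N).card ≤
      ((triangles N).filter fun X => X u.1 u.2 - X v.1 v.2 ≤ (L : ℤ)).card +
      ((triangles N).filter fun X => X u'.1 u'.2 - X v'.1 v'.2 ≤ (L : ℤ)).card + T.card := by
    classical
    refine le_trans (Finset.card_le_card fun X hX => ?_) ((Finset.card_union_le _ _).trans
      (Nat.add_le_add_right (Finset.card_union_le _ _) _))
    simp only [hT, Finset.mem_union, Finset.mem_filter, hX, true_and]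
    omega
  have s5 : ((triangles N).card : ℝ) ≤
      ((triangles N).filter fun X => X u.1 u.2 - X v.1 v.2 ≤ (L : ℤ)).card +
      ((triangles N).filter fun X => X u'.1 u'.2 - X v'.1 v'.2 ≤ (L : ℤ)).card + T.card := by
    exact_mod_cast s4
  have hL0 : (0 : ℝ) ≤ L := by positivity
  have s6 : (T.card : ℝ) ≤ (triangles N).card / 2 := by
    refine le_of_mul_le_mul_right (s3.trans ?_) (by positivity : (0 : ℝ) < L + 1)
    nlinarith
  linarith

/-- Change the value of a height function at one site. -/
def setAt (X : ℕ → ℕ → ℤ) (a b : ℕ) (t : ℤ) (p q : ℕ) : ℤ := if p = a ∧ q = b then t else X p q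

theorem IsMonotoneTriangle.setAt {N : ℕ} {X : ℕ → ℕ → ℤ} (h : IsMonotoneTriangle N X) {a b : ℕ}
    (hab : a + b + 1 < N) {t : ℤ} (h1 : X a (b + 1) ≤ t) (h2 : t ≤ X (a + 1) b)
    (h3 : ∀ p, p + 1 = a → X p b ≤ t ∧ X p (b + 1) < t)
    (h4 : ∀ q, q + 1 = b → t ≤ X a q ∧ t < X (a + 1) q) : IsMonotoneTriangle N (setAt X a b t) := by
  refine ⟨fun p q hpq => ?_, fun p q hpq => ?_, fun p q hpq => ?_, fun p q hpq => ?_,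
    fun p q hpq => ?_⟩ <;> simp only [_root_.setAt]
  · have := h.le_left p q hpq
    split_ifs with e1 e2 e2
    · rfl
    · obtain ⟨rfl, rfl⟩ := e1
      exact (h4 q rfl).1
    · obtain ⟨rfl, rfl⟩ := e2
      exact h1
    · exact this
  · have := h.le_right p q hpq
    split_ifs with e1 e2 e2
    · rfl
    · obtain ⟨rfl, rfl⟩ := e1
      exact h2
    · obtain ⟨rfl, rfl⟩ := e2
      exact (h3 p rfl).1
    · exact this
  · have := h.lt p q hpq
    split_ifs with e1 e2 e2
    · omega
    · obtain ⟨rfl, rfl⟩ := e1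
      exact (h4 q rfl).2
    · obtain ⟨rfl, rfl⟩ := e2
      exact (h3 p rfl).2
    · exact this
  · rw [if_neg (by omega)]
    exact h.bot p q hpq
  · rw [if_neg (by omega)]
    exact h.out p q hpq

/-- The smallest admissible value at a site given the other values. -/
def loAt (X : ℕ → ℕ → ℤ) (a b : ℕ) : ℤ :=
  if a = 0 then X a (b + 1) else max (max (X (a - 1) b) (X a (b + 1))) (X (a - 1) (b + 1) + 1)

/-- The largest admissible value at a site given the other values. -/
def hiAt (X : ℕ → ℕ → ℤ) (a b : ℕ) : ℤ :=
  if b = 0 then X (a + 1) b else min (min (X a (b - 1)) (X (a + 1) b)) (X (a + 1) (b - 1) - 1)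

theorem IsMonotoneTriangle.loAt_le {N : ℕ} {X : ℕ → ℕ → ℤ} (h : IsMonotoneTriangle N X) {a b : ℕ}
    (hab : a + b + 1 < N) : loAt X a b ≤ X a b := by
  have := h.le_left a b hab
  rw [loAt]
  split_ifs with ha
  · exact this
  · obtain ⟨p, rfl⟩ := Nat.exists_eq_succ_of_ne_zero ha
    have := h.le_right p b (by omega)
    have := h.lt p b (by omega)
    simp only [Nat.succ_eq_add_one, Nat.add_sub_cancel] at *
    omega

theorem IsMonotoneTriangle.le_hiAt {N : ℕ} {X : ℕ → ℕ → ℤ} (h : IsMonotoneTriangle N X) {a b : ℕ}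
    (hab : a + b + 1 < N) : X a b ≤ hiAt X a b := by
  have := h.le_right a b hab
  rw [hiAt]
  split_ifs with hb
  · exact this
  · obtain ⟨q, rfl⟩ := Nat.exists_eq_succ_of_ne_zero hb
    have := h.le_left a q (by omega)
    have := h.lt a q (by omega)
    simp only [Nat.succ_eq_add_one, Nat.add_sub_cancel] at *
    omega

theorem setAt_of_ne {X : ℕ → ℕ → ℤ} {a b p q : ℕ} {t : ℤ} (h : ¬ (p = a ∧ q = b)) :
    setAt X a b t p q = X p q := if_neg h

theorem loAt_setAt (X : ℕ → ℕ → ℤ) (a b : ℕ) (t : ℤ) : loAt (setAt X a b t) a b = loAt X a b := by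
  simp only [loAt]
  split_ifs with ha
  · rw [setAt_of_ne (by omega)]
  · rw [setAt_of_ne (by omega), setAt_of_ne (by omega), setAt_of_ne (by omega)]

theorem hiAt_setAt (X : ℕ → ℕ → ℤ) (a b : ℕ) (t : ℤ) : hiAt (setAt X a b t) a b = hiAt X a b := by
  simp only [hiAt]
  split_ifs with hb
  · rw [setAt_of_ne (by omega)]
  · rw [setAt_of_ne (by omega), setAt_of_ne (by omega), setAt_of_ne (by omega)]

/-- The value at a site reflected inside its admissible interval. -/
def flipAt (X : ℕ → ℕ → ℤ) (a b : ℕ) : ℕ → ℕ → ℤ := setAt X a b (loAt X a b + hiAt X a b - X a b)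

theorem IsMonotoneTriangle.flipAt {N : ℕ} {X : ℕ → ℕ → ℤ} (h : IsMonotoneTriangle N X) {a b : ℕ}
    (hab : a + b + 1 < N) : IsMonotoneTriangle N (flipAt X a b) := by
  have h1 := h.loAt_le hab
  have h2 := h.le_hiAt hab
  have h3 : loAt X a b ≤ loAt X a b + hiAt X a b - X a b := by omega
  have h4 : loAt X a b + hiAt X a b - X a b ≤ hiAt X a b := by omega
  generalize hs : loAt X a b + hiAt X a b - X a b = s at h3 h4
  rw [_root_.flipAt, hs]
  rw [loAt] at h3
  rw [hiAt] at h4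
  refine h.setAt hab ?_ ?_ ?_ ?_
  · split_ifs at h3
    · exact h3
    · omega
  · split_ifs at h4
    · exact h4
    · omega
  · rintro p rfl
    rw [if_neg (by omega), Nat.add_sub_cancel] at h3
    omega
  · rintro q rfl
    rw [if_neg (by omega), Nat.add_sub_cancel] at h4
    omega

theorem flipAt_flipAt (X : ℕ → ℕ → ℤ) (a b : ℕ) : flipAt (flipAt X a b) a b = X := by
  funext p q
  simp only [flipAt, loAt_setAt, hiAt_setAt]
  simp only [setAt]
  by_cases h : p = a ∧ q = b
  · obtain ⟨rfl, rfl⟩ := h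
    simp
  · simp [h]

/-- Given the other values, the value at a site is uniform on an interval. -/
theorem expect_hiAt_sub (N : ℕ) {a b : ℕ} (hab : a + b + 1 < N) :
    (triangles N).expect (fun X => (hiAt X a b : ℝ) - X a b) =
      (triangles N).expect (fun X => (X a b : ℝ) - loAt X a b) := by
  rw [Finset.expect_eq_sum_div_card, Finset.expect_eq_sum_div_card]
  congr 1
  refine Finset.sum_nbij' (fun X => flipAt X a b) (fun X => flipAt X a b) ?_ ?_ ?_ ?_ ?_
  · exact fun X hX => mem_triangles.2 ((mem_triangles.1 hX).flipAt hab)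
  · exact fun X hX => mem_triangles.2 ((mem_triangles.1 hX).flipAt hab)
  · exact fun X hX => flipAt_flipAt X a b
  · exact fun X hX => flipAt_flipAt X a b
  · intro X hX
    rw [flipAt, loAt_setAt, setAt, if_pos ⟨rfl, rfl⟩]
    push_cast
    ring

/-- Two sites whose heights stay at bounded mean distance along `F`. -/
def Close (F : Filter ℕ) (u v : ℕ × ℕ) : Prop :=
  ExpectBounded F fun X => |(X u.1 u.2 : ℝ) - X v.1 v.2|

theorem Close.symm {F : Filter ℕ} {u v : ℕ × ℕ} (h : Close F u v) : Close F v u := by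
  simpa only [Close, abs_sub_comm] using h

theorem Close.trans {F : Filter ℕ} {u v w : ℕ × ℕ} (h : Close F u v) (h' : Close F v w) :
    Close F u w :=
  (h.add h').mono (.of_forall fun _ _ _ => abs_sub_le _ _ _)

theorem close_refl (F : Filter ℕ) (u : ℕ × ℕ) : Close F u u := by
  simpa [Close] using expectBounded_const F 0

theorem eventually_lt_size {F : Filter ℕ} (hF : F ≤ Filter.atTop) (n : ℕ) : ∀ᶠ N in F, n < N :=
  hF (Filter.eventually_gt_atTop n)

/-- Closeness propagates down to the left. -/
theorem Close.down {F : Ultrafilter ℕ} (hF : (F : Filter ℕ) ≤ Filter.atTop) {a b : ℕ}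
    (h : Close F (a, b) (a + 1, b) ∨ ∃ q, b = q + 1 ∧ Close F (a, b) (a, q)) :
    Close F (a, b) (a, b + 1) := by
  induction a with
  | zero =>
    have h1 : ExpectBounded F fun X => (hiAt X 0 b : ℝ) - X 0 b := by
      rcases h with h | ⟨q, rfl, h⟩
      · refine h.mono (.of_forall fun N X hX => ?_)
        have : hiAt X 0 b ≤ X (0 + 1) b := by rw [hiAt]; split_ifs <;> omega
        rw [abs_sub_comm]
        refine le_trans ?_ (le_abs_self _)
        have : (hiAt X 0 b : ℝ) ≤ X (0 + 1) b := by exact_mod_cast this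
        simpa using this
      · refine h.mono (.of_forall fun N X hX => ?_)
        have : hiAt X 0 (q + 1) ≤ X 0 q := by
          rw [hiAt, if_neg (by omega), Nat.add_sub_cancel]; omega
        rw [abs_sub_comm]
        refine le_trans ?_ (le_abs_self _)
        have : (hiAt X 0 (q + 1) : ℝ) ≤ X 0 q := by exact_mod_cast this
        simpa using this
    obtain ⟨M, hM⟩ := h1
    refine ⟨M, ?_⟩
    filter_upwards [hM, eventually_lt_size hF (0 + b + 1)] with N h2 hN
    rw [expect_hiAt_sub N hN] at h2
    refine le_trans (Finset.expect_le_expect fun X hX => ?_) h2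
    have := (mem_triangles.1 hX).le_left 0 b hN
    have : (X 0 (b + 1) : ℝ) ≤ X 0 b := by exact_mod_cast this
    rw [abs_of_nonneg (by simpa using this), loAt, if_pos rfl]
  | succ a ih =>
    have h1 : ExpectBounded F fun X => (hiAt X (a + 1) b : ℝ) - X (a + 1) b := by
      rcases h with h | ⟨q, rfl, h⟩
      · refine h.mono (.of_forall fun N X hX => ?_)
        have : hiAt X (a + 1) b ≤ X (a + 1 + 1) b := by rw [hiAt]; split_ifs <;> omega
        rw [abs_sub_comm]
        refine le_trans ?_ (le_abs_self _)
        have : (hiAt X (a + 1) b : ℝ) ≤ X (a + 1 + 1) b := by exact_mod_cast this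
        simpa using this
      · refine h.mono (.of_forall fun N X hX => ?_)
        have : hiAt X (a + 1) (q + 1) ≤ X (a + 1) q := by
          rw [hiAt, if_neg (by omega), Nat.add_sub_cancel]; omega
        rw [abs_sub_comm]
        refine le_trans ?_ (le_abs_self _)
        have : (hiAt X (a + 1) (q + 1) : ℝ) ≤ X (a + 1) q := by exact_mod_cast this
        simpa using this
    have h2 : ExpectBounded F fun X => (X (a + 1) b : ℝ) - loAt X (a + 1) b := by
      obtain ⟨M, hM⟩ := h1
      refine ⟨M, ?_⟩
      filter_upwards [hM, eventually_lt_size hF (a + 1 + b + 1)] with N h2 hN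
      rwa [expect_hiAt_sub N hN] at h2
    have h3 : ExpectBounded F fun X => min ((X (a + 1) b : ℝ) - X a b)
        (X (a + 1) b - X (a + 1) (b + 1)) := by
      refine (h2.add (expectBounded_const F 1)).mono ?_
      filter_upwards [eventually_lt_size hF (a + 1 + b + 1)] with N hN X hX
      have e := (mem_triangles.1 hX).le_left a b (by omega)
      have : min (X (a + 1) b - X a b) (X (a + 1) b - X (a + 1) (b + 1)) ≤
          X (a + 1) b - loAt X (a + 1) b + 1 := by
        rw [loAt, if_neg (by omega), Nat.add_sub_cancel]
        omega
      exact_mod_cast this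
    have h4 : Close F (a, b) (a + 1, b) → Close F (a + 1, b) (a + 1, b + 1) := by
      intro h4
      have h5 := h4.symm.trans (ih (Or.inl h4))
      refine h5.mono ?_
      filter_upwards [eventually_lt_size hF (a + 1 + b + 1)] with N hN X hX
      have e1 := (mem_triangles.1 hX).le_left (a + 1) b hN
      have e2 := (mem_triangles.1 hX).le_right a (b + 1) (by omega)
      have : |X (a + 1) b - X (a + 1) (b + 1)| ≤ |X (a + 1) b - X a (b + 1)| := by
        rw [abs_of_nonneg (by omega), abs_of_nonneg (by omega)]
        omega
      exact_mod_cast this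
    have h6 : ∀ᶠ N in (F : Filter ℕ), ∀ X ∈ triangles N, X a b ≤ X (a + 1) b := by
      filter_upwards [eventually_lt_size hF (a + 1 + b + 1)] with N hN X hX
      exact (mem_triangles.1 hX).le_right a b (by omega)
    have h7 : ∀ᶠ N in (F : Filter ℕ), ∀ X ∈ triangles N, X (a + 1) (b + 1) ≤ X (a + 1) b := by
      filter_upwards [eventually_lt_size hF (a + 1 + b + 1)] with N hN X hX
      exact (mem_triangles.1 hX).le_left (a + 1) b hN
    rcases ExpectBounded.or_of_min (u := (a + 1, b)) (v := (a, b)) (u' := (a + 1, b))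
      (v' := (a + 1, b + 1)) h3 h6 h7 with h5 | h5
    · refine h4 (h5.mono ?_)
      filter_upwards [eventually_lt_size hF (a + 1 + b + 1)] with N hN X hX
      have e1 := (mem_triangles.1 hX).le_right a b (by omega)
      have e1' : (X a b : ℝ) ≤ X (a + 1) b := by exact_mod_cast e1
      rw [abs_sub_comm, abs_of_nonneg (by simpa using e1')]
    · refine h5.mono ?_
      filter_upwards [eventually_lt_size hF (a + 1 + b + 1)] with N hN X hX
      have e1 := (mem_triangles.1 hX).le_left (a + 1) b hN
      have e1' : (X (a + 1) (b + 1) : ℝ) ≤ X (a + 1) b := by exact_mod_cast e1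
      rw [abs_of_nonneg (by simpa using e1')]

theorem Close.reflect {F : Filter ℕ} (hF : F ≤ Filter.atTop) {u v : ℕ × ℕ} (h : Close F u v) :
    Close F u.swap v.swap := by
  obtain ⟨M, hM⟩ := h
  refine ⟨M, ?_⟩
  filter_upwards [hM, eventually_lt_size hF (u.1 + u.2), eventually_lt_size hF (v.1 + v.2)] with
    N h1 h2 h3
  rw [Finset.expect_eq_sum_div_card] at h1 ⊢
  rw [← sum_triangles_reflect]
  refine le_of_eq_of_le ?_ h1
  congr 1
  refine Finset.sum_congr rfl fun X _ => ?_
  simp only [_root_.reflect, Prod.fst_swap, Prod.snd_swap]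
  rw [if_pos (by omega), if_pos (by omega), abs_sub_comm]
  push_cast
  congr 1
  ring

/-- Closeness propagates down to the right. -/
theorem Close.up {F : Ultrafilter ℕ} (hF : (F : Filter ℕ) ≤ Filter.atTop) {a b : ℕ}
    (h : Close F (a, b) (a, b + 1) ∨ ∃ p, a = p + 1 ∧ Close F (a, b) (p, b)) :
    Close F (a, b) (a + 1, b) := by
  refine (Close.down hF (a := b) (b := a) ?_).reflect hF
  rcases h with h | ⟨p, rfl, h⟩
  · exact Or.inl (h.reflect hF)
  · exact Or.inr ⟨p, rfl, h.reflect hF⟩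

theorem close_cone {F : Ultrafilter ℕ} (hF : (F : Filter ℕ) ≤ Filter.atTop) {a b : ℕ}
    (h : Close F (a, b) (a, b + 1) ∨ Close F (a, b) (a + 1, b)) (i l : ℕ) :
    Close F (a + i, b + l) (a, b) := by
  have h0 : Close F (a, b) (a + 1, b) ∧ Close F (a, b) (a, b + 1) := by
    rcases h with h | h
    · exact ⟨Close.up hF (Or.inl h), h⟩
    · exact ⟨h, Close.down hF (Or.inl h)⟩
  have hr : ∀ p q, Close F (p, q) (p + 1, q) ∧ Close F (p, q) (p, q + 1) →
      Close F (p + 1, q) (p + 1 + 1, q) ∧ Close F (p + 1, q) (p + 1, q + 1) := by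
    intro p q h
    have := Close.up hF (Or.inr ⟨p, rfl, h.1.symm⟩)
    exact ⟨this, Close.down hF (Or.inl this)⟩
  have hl : ∀ p q, Close F (p, q) (p + 1, q) ∧ Close F (p, q) (p, q + 1) →
      Close F (p, q + 1) (p + 1, q + 1) ∧ Close F (p, q + 1) (p, q + 1 + 1) := by
    intro p q h
    have := Close.down hF (Or.inr ⟨q, rfl, h.2.symm⟩)
    exact ⟨Close.up hF (Or.inl this), this⟩
  have h1 : ∀ i, (Close F (a + i, b) (a + i + 1, b) ∧ Close F (a + i, b) (a + i, b + 1)) ∧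
      Close F (a + i, b) (a, b) := by
    intro i
    induction i with
    | zero => exact ⟨h0, close_refl _ _⟩
    | succ i ih => exact ⟨hr _ _ ih.1, ih.1.1.symm.trans ih.2⟩
  have h2 : ∀ l, (Close F (a + i, b + l) (a + i + 1, b + l) ∧
      Close F (a + i, b + l) (a + i, b + l + 1)) ∧ Close F (a + i, b + l) (a, b) := by
    intro l
    induction l with
    | zero => exact h1 i
    | succ l ih => exact ⟨hl _ _ ih.1, ih.1.2.symm.trans ih.2⟩
  exact (h2 l).2

/-- Halve the distances of the first `n` right boundary values to the next one. -/
def halve (n : ℕ) (X : ℕ → ℕ → ℤ) (a b : ℕ) : ℤ :=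
  if b = 0 ∧ a < n then X n 0 - (X n 0 - X a 0) / 2 else X a b

theorem IsMonotoneTriangle.right_mono {N : ℕ} {X : ℕ → ℕ → ℤ} (h : IsMonotoneTriangle N X)
    {i n : ℕ} (hin : i ≤ n) (hn : n < N) : X i 0 ≤ X n 0 := by
  induction n, hin using Nat.le_induction with
  | base => exact le_rfl
  | succ n hin ih => exact (ih (by omega)).trans (h.le_right n 0 (by omega))

theorem IsMonotoneTriangle.halve {N : ℕ} {X : ℕ → ℕ → ℤ} (h : IsMonotoneTriangle N X) {n : ℕ}
    (hn : n < N) : IsMonotoneTriangle N (halve n X) := by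
  refine ⟨fun p q hpq => ?_, fun p q hpq => ?_, fun p q hpq => ?_, fun p q hpq => ?_,
    fun p q hpq => ?_⟩ <;> simp only [_root_.halve]
  · have := h.le_left p q hpq
    rw [if_neg (by omega)]
    split_ifs with e
    · obtain ⟨rfl, e⟩ := e
      have := h.right_mono e.le hn
      omega
    · exact this
  · have := h.le_right p q hpq
    split_ifs with e1 e2 e2
    · obtain ⟨rfl, e⟩ := e1
      omega
    · obtain ⟨rfl, e⟩ := e1
      have e3 := h.right_mono e.le hn
      obtain rfl : n = p + 1 := by omega
      omega
    · omega
    · exact this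
  · have := h.lt p q hpq
    rw [if_neg (by omega)]
    split_ifs with e
    · obtain ⟨rfl, e⟩ := e
      have := h.right_mono e.le hn
      omega
    · exact this
  · rw [if_neg (by omega)]
    exact h.bot p q hpq
  · rw [if_neg (by omega)]
    exact h.out p q hpq

theorem halve_injective (n : ℕ) : Function.Injective fun X : ℕ → ℕ → ℤ =>
    (halve n X, (Finset.range n).filter fun i => (X n 0 - X i 0) % 2 = 1) := by
  intro X Y h
  simp only [Prod.mk.injEq] at h
  obtain ⟨h1, h2⟩ := h
  have h3 : X n 0 = Y n 0 := by simpa [halve] using congrFun (congrFun h1 n) 0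
  funext a b
  have h4 := congrFun (congrFun h1 a) b
  simp only [halve] at h4
  split_ifs at h4 with e
  · obtain ⟨rfl, e⟩ := e
    have h5 := Finset.ext_iff.1 h2 a
    simp only [Finset.mem_filter, Finset.mem_range, e, true_and] at h5
    omega
  · exact h4

theorem sum_exp_right_add_apex_le {N n : ℕ} (hn : n < N) {τ : ℝ} (h0 : 0 ≤ τ) (h1 : τ ≤ 1 / 2) :
    ∑ X ∈ triangles N, Real.exp (τ * (X n 0 + X 0 0 - (N - 1))) ≤
      2 ^ n * ((triangles N).card * Real.exp (8 * N * τ ^ 2)) := by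
  classical
  have h2 := sum_exp_apex_le (N := N) (τ := -τ) (by omega) (by rwa [abs_neg, abs_of_nonneg h0])
  rw [neg_sq] at h2
  calc ∑ X ∈ triangles N, Real.exp (τ * (X n 0 + X 0 0 - (N - 1)))
      ≤ ∑ X ∈ triangles N, Real.exp (-τ * (N - 1 - 2 * (halve n X 0 0 : ℤ))) := by
        refine Finset.sum_le_sum fun X hX => Real.exp_le_exp.2 ?_
        have : X n 0 + X 0 0 ≤ 2 * halve n X 0 0 := by
          have := (mem_triangles.1 hX).right_mono n.zero_le hn
          rw [halve]
          split_ifs with e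
          · omega
          · obtain rfl : n = 0 := by omega
            omega
        have : (X n 0 + X 0 0 : ℝ) ≤ 2 * (halve n X 0 0 : ℤ) := by exact_mod_cast this
        nlinarith
    _ = ∑ p ∈ (triangles N).image (fun X => (halve n X,
          (Finset.range n).filter fun i => (X n 0 - X i 0) % 2 = 1)),
          Real.exp (-τ * (N - 1 - 2 * (p.1 0 0 : ℤ))) := by
        rw [Finset.sum_image (halve_injective n).injOn]
    _ ≤ ∑ p ∈ triangles N ×ˢ (Finset.range n).powerset,
          Real.exp (-τ * (N - 1 - 2 * (p.1 0 0 : ℤ))) := by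
        refine Finset.sum_le_sum_of_subset_of_nonneg ?_ fun _ _ _ => (Real.exp_pos _).le
        intro p hp
        obtain ⟨X, hX, rfl⟩ := Finset.mem_image.1 hp
        exact Finset.mem_product.2 ⟨mem_triangles.2 ((mem_triangles.1 hX).halve hn),
          Finset.mem_powerset.2 (Finset.filter_subset _ _)⟩
    _ = 2 ^ n * ∑ X ∈ triangles N, Real.exp (-τ * (N - 1 - 2 * (X 0 0 : ℤ))) := by
        rw [Finset.sum_product]
        simp [← Finset.mul_sum]
    _ ≤ _ := by gcongr

theorem expect_reflect (N : ℕ) (f : (ℕ → ℕ → ℤ) → ℝ) :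
    (triangles N).expect (fun X => f (reflect N X)) = (triangles N).expect f := by
  rw [Finset.expect_eq_sum_div_card, Finset.expect_eq_sum_div_card, sum_triangles_reflect]

theorem expect_reflected {N a b : ℕ} (h : a + b < N) :
    (triangles N).expect (fun X => (X a b : ℝ)) =
      N - 1 - (triangles N).expect (fun X => (X b a : ℝ)) := by
  rw [← expect_reflect N fun X => (X a b : ℝ)]
  simp only [reflect, if_pos h]
  push_cast
  rw [Finset.expect_sub_distrib, Finset.expect_const (triangles_nonempty N)]

/-- The extreme heights on a fixed level differ by `O(√N)` on average. -/
theorem expect_right_sub_left_le {N n : ℕ} (hN : 4 * (n + 1) ≤ N) :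
    (triangles N).expect (fun X => (X n 0 : ℝ) - X 0 n) ≤ 18 * (√(n + 1) * √N) := by
  have hn : (0 : ℝ) < n + 1 := by positivity
  have hN' : (4 * (n + 1) : ℝ) ≤ N := by exact_mod_cast hN
  have hNp : (0 : ℝ) < N := by linarith
  have hsn : 0 < √((n : ℝ) + 1) := Real.sqrt_pos.2 hn
  have hsN : 0 < √(N : ℝ) := Real.sqrt_pos.2 hNp
  have qn : √((n : ℝ) + 1) * √((n : ℝ) + 1) = n + 1 := Real.mul_self_sqrt hn.le
  have qN : √(N : ℝ) * √(N : ℝ) = N := Real.mul_self_sqrt hNp.le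
  set x := √((n : ℝ) + 1)
  set y := √(N : ℝ)
  set τ := x / y with hτ
  have hτ0 : 0 < τ := div_pos hsn hsN
  have hτy : τ * y = x := div_mul_cancel₀ _ hsN.ne'
  have hτ1 : τ ≤ 1 / 2 := by
    rw [hτ, div_le_iff₀ hsN]
    nlinarith
  have h1 := sum_exp_right_add_apex_le (n := n) (N := N) (by omega) hτ0.le hτ1
  set s := n * Real.log 2 + 8 * N * τ ^ 2 with hs
  have h2 : (2 : ℝ) ^ n * ((triangles N).card * Real.exp (8 * N * τ ^ 2)) =
      (triangles N).card * Real.exp s := by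
    rw [hs, Real.exp_add, Real.exp_nat_mul, Real.exp_log (by norm_num)]
    ring
  rw [h2] at h1
  have hc := card_triangles_pos N
  have h3 : ∑ X ∈ triangles N, (1 + (τ * (X n 0 + X 0 0 - (N - 1)) - s)) ≤ (triangles N).card := by
    have : ∑ X ∈ triangles N, Real.exp (τ * (X n 0 + X 0 0 - (N - 1)) - s) ≤
        (triangles N).card := by
      simp only [Real.exp_sub, ← Finset.sum_div]
      rwa [div_le_iff₀ (Real.exp_pos _)]
    refine le_trans (Finset.sum_le_sum fun X _ => ?_) this
    linarith [Real.add_one_le_exp (τ * (X n 0 + X 0 0 - (N - 1)) - s)]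
  have h4 : (triangles N).expect (fun X => 1 + (τ * ((X n 0 : ℝ) + X 0 0 - (N - 1)) - s)) ≤ 1 := by
    rw [Finset.expect_eq_sum_div_card]
    exact (div_le_one hc).2 h3
  simp only [Finset.expect_add_distrib, Finset.expect_sub_distrib, ← Finset.mul_expect,
    Finset.expect_const (triangles_nonempty N)] at h4
  have h5 := expect_reflected (N := N) (a := 0) (b := 0) (by omega)
  have h6 := expect_reflected (N := N) (a := 0) (b := n) (by omega)
  rw [Finset.expect_sub_distrib]
  set m := (triangles N).expect (fun X => (X n 0 : ℝ))
  have h7 : τ * (m + (triangles N).expect (fun X => (X 0 0 : ℝ)) - (N - 1)) ≤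
      9 * (τ * (x * y)) := by
    have e1 : τ * (x * y) = n + 1 := by rw [mul_left_comm, hτy, qn]
    have e2 : N * τ ^ 2 = n + 1 := by
      rw [← qN, ← qn]; linear_combination (τ * y + x) * hτy
    have e3 : n * Real.log 2 ≤ n * 1 :=
      mul_le_mul_of_nonneg_left (by linarith [Real.log_two_lt_d9]) n.cast_nonneg
    rw [e1]
    rw [hs] at h4
    nlinarith
  have h8 : m + (triangles N).expect (fun X => (X 0 0 : ℝ)) - (N - 1) ≤ 9 * (x * y) := by
    refine le_of_mul_le_mul_left ?_ hτ0
    linarith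
  linarith

def levelSum (X : ℕ → ℕ → ℤ) (n : ℕ) : ℤ := ∑ p ∈ Finset.range (n + 1), X p (n - p)

theorem levelDiff_succ (X : ℕ → ℕ → ℤ) (n : ℕ) :
    levelDiff X (n + 1) = levelSum X (n + 1) - levelSum X n := rfl

/-- The contribution of the cone below `(a, b)` to a level sum. -/
def coneSum (X : ℕ → ℕ → ℤ) (a b t : ℕ) : ℤ := ∑ i ∈ Finset.range (t + 1), X (a + i) (b + t - i)

/-- The contribution of the sites to the left of the cone below `(a, b)`. -/
def leftSum (X : ℕ → ℕ → ℤ) (a b t : ℕ) : ℤ := ∑ p ∈ Finset.range a, X p (a + b + t - p)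

/-- The contribution of the sites to the right of the cone below `(a, b)`. -/
def rightSum (X : ℕ → ℕ → ℤ) (a b t : ℕ) : ℤ := ∑ q ∈ Finset.range b, X (a + b + t - q) q

/-- The total deviation from the tip of a cone. -/
def coneDev (X : ℕ → ℕ → ℤ) (a b t : ℕ) : ℤ :=
  ∑ i ∈ Finset.range (t + 1), |X (a + i) (b + t - i) - X a b|

theorem levelSum_eq (X : ℕ → ℕ → ℤ) (a b t : ℕ) :
    levelSum X (a + b + t) = leftSum X a b t + coneSum X a b t + rightSum X a b t := by
  rw [levelSum, show a + b + t + 1 = a + (t + 1) + b by omega, Finset.sum_range_add,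
    Finset.sum_range_add, leftSum, coneSum, rightSum]
  congr 1
  · congr 1
    refine Finset.sum_congr rfl fun i hi => ?_
    rw [Finset.mem_range] at hi
    congr 1
    omega
  · rw [← Finset.sum_range_reflect]
    refine Finset.sum_congr rfl fun i hi => ?_
    rw [Finset.mem_range] at hi
    congr 1 <;> omega

theorem abs_coneSum_sub_le (X : ℕ → ℕ → ℤ) (a b t : ℕ) :
    |coneSum X a b t - (t + 1) * X a b| ≤ coneDev X a b t := by
  have : coneSum X a b t - (t + 1) * X a b =
      ∑ i ∈ Finset.range (t + 1), (X (a + i) (b + t - i) - X a b) := by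
    simp [coneSum, Finset.sum_sub_distrib]
  rw [this]
  exact Finset.abs_sum_le_sum_abs _ _

theorem IsMonotoneTriangle.left_anti {N : ℕ} {X : ℕ → ℕ → ℤ}
    (h : IsMonotoneTriangle N X) {q n : ℕ} (hqn : q ≤ n) (hn : n < N) : X 0 n ≤ X 0 q := by
  induction n, hqn using Nat.le_induction with
  | base => exact le_rfl
  | succ n hin ih => exact (h.le_left 0 n (by omega)).trans (ih (by omega))

theorem IsMonotoneTriangle.le_level_right {N : ℕ} {X : ℕ → ℕ → ℤ}
    (h : IsMonotoneTriangle N X) {a b : ℕ} (hab : a + b < N) : X a b ≤ X (a + b) 0 := by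
  induction b generalizing a with
  | zero => exact le_rfl
  | succ b ih =>
    have := ih (a := a + 1) (by omega)
    rw [show a + 1 + b = a + (b + 1) by omega] at this
    exact (h.lt a b (by omega)).le.trans this

theorem IsMonotoneTriangle.level_left_le {N : ℕ} {X : ℕ → ℕ → ℤ}
    (h : IsMonotoneTriangle N X) {a b : ℕ} (hab : a + b < N) : X 0 (a + b) ≤ X a b := by
  induction a generalizing b with
  | zero => simp
  | succ a ih =>
    have := ih (b := b + 1) (by omega)
    rw [show a + (b + 1) = a + 1 + b by omega] at this
    exact this.trans (h.lt a b (by omega)).le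

/-- Up to cone deviations, the level differences stay near the value at the tip of a cone, with a
total error controlled by the width of a level. -/
theorem IsMonotoneTriangle.sum_abs_levelDiff_sub_le {N : ℕ} {X : ℕ → ℕ → ℤ}
    (h : IsMonotoneTriangle N X) (a b K : ℕ) (hN : a + b + K < N) :
    ∑ t ∈ Finset.range K, |levelDiff X (a + b + t + 1) - X a b| ≤
      ∑ t ∈ Finset.range K, (coneDev X a b (t + 1) + coneDev X a b t) +
        (a + b) * (X (a + b + K) 0 - X 0 (a + b + K)) := by
  have h1 : ∀ t ∈ Finset.range K, |levelDiff X (a + b + t + 1) - X a b| ≤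
      (coneDev X a b (t + 1) + coneDev X a b t) +
        ((rightSum X a b (t + 1) - leftSum X a b (t + 1)) -
          (rightSum X a b t - leftSum X a b t)) := by
    intro t ht
    rw [Finset.mem_range] at ht
    have e1 := abs_coneSum_sub_le X a b (t + 1)
    have e2 := abs_coneSum_sub_le X a b t
    have e3 : leftSum X a b (t + 1) ≤ leftSum X a b t := by
      refine Finset.sum_le_sum fun p hp => ?_
      rw [Finset.mem_range] at hp
      have := h.le_left p (a + b + t - p) (by omega)
      rwa [show a + b + t - p + 1 = a + b + (t + 1) - p by omega] at this
    have e4 : rightSum X a b t ≤ rightSum X a b (t + 1) := by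
      refine Finset.sum_le_sum fun q hq => ?_
      rw [Finset.mem_range] at hq
      have := h.le_right (a + b + t - q) q (by omega)
      rwa [show a + b + t - q + 1 = a + b + (t + 1) - q by omega] at this
    rw [levelDiff_succ, levelSum_eq X a b t, add_assoc (a + b), levelSum_eq X a b (t + 1)]
    push_cast at e1
    rw [abs_le] at e1 e2 ⊢
    constructor <;> linarith [e1.1, e1.2, e2.1, e2.2]
  refine (Finset.sum_le_sum h1).trans ?_
  rw [Finset.sum_add_distrib, Finset.sum_range_sub fun t => rightSum X a b t - leftSum X a b t]
  have h2 : leftSum X a b 0 - leftSum X a b K ≤ a * (X (a + b + K) 0 - X 0 (a + b + K)) := by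
    rw [leftSum, leftSum, ← Finset.sum_sub_distrib]
    refine (Finset.sum_le_card_nsmul _ _ (X (a + b + K) 0 - X 0 (a + b + K)) ?_).trans_eq
      (by simp)
    intro p hp
    rw [Finset.mem_range] at hp
    have e1 := h.level_left_le (a := p) (b := a + b + K - p) (by omega)
    have e2 := h.le_level_right (a := p) (b := a + b + 0 - p) (by omega)
    have e3 := h.right_mono (i := p + (a + b + 0 - p)) (n := a + b + K) (by omega) (by omega)
    rw [show p + (a + b + K - p) = a + b + K by omega] at e1
    omega
  have h3 : rightSum X a b K - rightSum X a b 0 ≤ b * (X (a + b + K) 0 - X 0 (a + b + K)) := by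
    rw [rightSum, rightSum, ← Finset.sum_sub_distrib]
    refine (Finset.sum_le_card_nsmul _ _ (X (a + b + K) 0 - X 0 (a + b + K)) ?_).trans_eq
      (by simp)
    intro q hq
    rw [Finset.mem_range] at hq
    have e1 := h.level_left_le (a := a + b + 0 - q) (b := q) (by omega)
    have e2 := h.le_level_right (a := a + b + K - q) (b := q) (by omega)
    have e3 := h.left_anti (q := a + b + 0 - q + q) (n := a + b + K) (by omega) (by omega)
    rw [show a + b + K - q + q = a + b + K by omega] at e2
    omega
  linarith

theorem expectBounded_coneDev {F : Filter ℕ} {a b : ℕ}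
    (h : ∀ i l, Close F (a + i, b + l) (a, b)) (t : ℕ) :
    ExpectBounded F fun X => (coneDev X a b t : ℝ) := by
  simp only [coneDev]
  push_cast
  refine ExpectBounded.sum fun i hi => ?_
  rw [Finset.mem_range] at hi
  have := h i (t - i)
  rwa [show b + (t - i) = b + t - i by omega] at this

theorem exists_nat_sqrt_lt {c : ℝ} (hc : 0 < c) (A r : ℝ) (hr : 0 ≤ r) (hA : 0 ≤ A) :
    ∃ K : ℕ, A * √(r + K) + 1 ≤ K * c := by
  obtain ⟨K, hK⟩ := exists_nat_ge (((A + c * r + 1) / c) ^ 2 + 1)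
  refine ⟨K, ?_⟩
  have h1 : 0 ≤ (A + c * r + 1) / c := by positivity
  have h2 : (A + c * r + 1) / c ≤ √(r + K) := Real.le_sqrt_of_sq_le (by linarith)
  have h3 : 1 ≤ √(r + K) := Real.le_sqrt_of_sq_le (by nlinarith)
  have h4 : √(r + K) * √(r + K) = r + K := Real.mul_self_sqrt (by positivity)
  rw [div_le_iff₀ hc] at h2
  nlinarith [mul_nonneg hc.le hr]

/-- Neighbouring heights cannot stay at bounded mean distance. -/
theorem not_close {F : Ultrafilter ℕ} (hF : (F : Filter ℕ) ≤ Filter.atTop) (a b : ℕ) :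
    ¬ (Close F (a, b) (a, b + 1) ∨ Close F (a, b) (a + 1, b)) := by
  intro hcl
  have hcone := expectBounded_coneDev (close_cone hF hcl)
  obtain ⟨c, hc, hlow⟩ := exists_le_expect_levelDiff
  obtain ⟨K, hK⟩ := exists_nat_sqrt_lt hc (36 * (a + b)) (a + b + 2) (by positivity) (by positivity)
  obtain ⟨M, hM⟩ := ExpectBounded.sum (F := F) (s := Finset.range (K + 1))
    (f := fun t X => ((coneDev X a b (t + 1) : ℝ) + coneDev X a b t))
    fun t _ => (hcone (t + 1)).add (hcone t)
  have hlow' : ∀ᶠ N : ℕ in (F : Filter ℕ), ∀ t ∈ Finset.range K, c * √N ≤ (triangles N).expect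
      fun X => |(levelDiff X (a + b + t + 1 + 1) : ℝ) - levelDiff X (a + b + t + 1)| :=
    (Finset.eventually_all _).2 fun t _ => hF (hlow _)
  have hbig : ∀ᶠ N : ℕ in (F : Filter ℕ), 2 * M < √N :=
    hF ((Real.tendsto_sqrt_atTop.comp tendsto_natCast_atTop_atTop).eventually_gt_atTop _)
  obtain ⟨N, hM, hlow', hbig, hN⟩ := (hM.and (hlow'.and (hbig.and
    (eventually_lt_size hF (4 * (a + b + (K + 1) + 1)))))).exists
  have hw := expect_right_sub_left_le (N := N) (n := a + b + (K + 1)) (by omega)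
  have h1 : K * (c * √N) ≤ (triangles N).expect fun X => ∑ t ∈ Finset.range K,
      |(levelDiff X (a + b + t + 1 + 1) : ℝ) - levelDiff X (a + b + t + 1)| := by
    rw [Finset.expect_sum_comm]
    refine le_trans (by simp) (Finset.card_nsmul_le_sum _ _ _ hlow')
  have h2 : ∀ X ∈ triangles N, ∑ t ∈ Finset.range K,
      |(levelDiff X (a + b + t + 1 + 1) : ℝ) - levelDiff X (a + b + t + 1)| ≤
      2 * (∑ t ∈ Finset.range (K + 1), ((coneDev X a b (t + 1) : ℝ) + coneDev X a b t) +
        (a + b) * ((X (a + b + (K + 1)) 0 : ℝ) - X 0 (a + b + (K + 1)))) := by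
    intro X hX
    have e1 := (mem_triangles.1 hX).sum_abs_levelDiff_sub_le a b (K + 1) (by omega)
    have e2 : ∑ t ∈ Finset.range K, |levelDiff X (a + b + t + 1 + 1) - levelDiff X (a + b + t + 1)|
        ≤ 2 * ∑ t ∈ Finset.range (K + 1), |levelDiff X (a + b + t + 1) - X a b| := by
      rw [two_mul]
      nth_rw 1 [Finset.sum_range_succ']
      rw [Finset.sum_range_succ]
      have e3 : ∑ t ∈ Finset.range K,
          |levelDiff X (a + b + t + 1 + 1) - levelDiff X (a + b + t + 1)| ≤
          ∑ t ∈ Finset.range K, |levelDiff X (a + b + (t + 1) + 1) - X a b| +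
          ∑ t ∈ Finset.range K, |levelDiff X (a + b + t + 1) - X a b| := by
        rw [← Finset.sum_add_distrib]
        refine Finset.sum_le_sum fun t _ => ?_
        rw [abs_sub_comm _ (X a b), abs_sub_comm _ (X a b), ← add_assoc, abs_sub_comm (X a b)]
        exact abs_sub_le _ _ _
      linarith [abs_nonneg (levelDiff X (a + b + 0 + 1) - X a b),
        abs_nonneg (levelDiff X (a + b + K + 1) - X a b)]
    exact_mod_cast e2.trans (mul_le_mul_of_nonneg_left e1 two_pos.le)
  have h3 := h1.trans (Finset.expect_le_expect h2)
  rw [← Finset.mul_expect, Finset.expect_add_distrib, ← Finset.mul_expect] at h3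
  have h4 := mul_le_mul_of_nonneg_left hw (by positivity : (0 : ℝ) ≤ a + b)
  push_cast at h4
  rw [show (a + b + (K + 1) + 1 : ℝ) = a + b + 2 + K by ring] at h4
  have h5 := mul_le_mul_of_nonneg_right hK (Real.sqrt_nonneg N)
  linarith

theorem eventually_lt_expect_gap {u v : ℕ × ℕ}
    (hle : ∀ᶠ N in Filter.atTop, ∀ X ∈ triangles N, X v.1 v.2 ≤ X u.1 u.2)
    (hn : ∀ F : Ultrafilter ℕ, (F : Filter ℕ) ≤ Filter.atTop → ¬ Close F u v) (M : ℝ) :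
    ∀ᶠ N in Filter.atTop, M < (triangles N).expect fun X => (X u.1 u.2 : ℝ) - X v.1 v.2 := by
  by_contra hc
  have hc' : ∃ᶠ N in Filter.atTop,
      (triangles N).expect (fun X => (X u.1 u.2 : ℝ) - X v.1 v.2) ≤ M := by
    simpa [Filter.Frequently] using hc
  rw [Filter.frequently_iff_neBot] at hc'
  have hF := Ultrafilter.of_le (Filter.atTop ⊓ Filter.principal
    {N | (triangles N).expect (fun X => (X u.1 u.2 : ℝ) - X v.1 v.2) ≤ M})
  have hF' := hF.trans inf_le_left
  refine hn _ hF' ⟨M, ?_⟩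
  filter_upwards [hF' hle, hF.trans inf_le_right (Filter.mem_principal_self _)] with N h1 h2
  refine le_of_eq_of_le (Finset.expect_congr rfl fun X hX => abs_of_nonneg ?_) h2
  have : (X v.1 v.2 : ℝ) ≤ X u.1 u.2 := by exact_mod_cast h1 X hX
  linarith

theorem tendsto_prob_gap_eq_zero {u v : ℕ × ℕ}
    (hle : ∀ᶠ N in Filter.atTop, ∀ X ∈ triangles N, X v.1 v.2 ≤ X u.1 u.2)
    (hn : ∀ F : Ultrafilter ℕ, (F : Filter ℕ) ≤ Filter.atTop → ¬ Close F u v) :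
    Filter.Tendsto (fun N => (((triangles N).filter fun X => X u.1 u.2 ≤ X v.1 v.2).card : ℝ) /
      (triangles N).card) Filter.atTop (nhds 0) := by
  rw [Metric.tendsto_nhds]
  intro ε hε
  filter_upwards [hle, eventually_lt_expect_gap hle hn (2 / ε)] with N h1 h2
  have hc := card_triangles_pos N
  have h3 := card_gap_le_mul_le N u v 0 h1
  simp only [Nat.cast_zero, sub_zero, sub_nonpos, zero_add, mul_one] at h3
  rw [Real.dist_eq, sub_zero, abs_of_nonneg (by positivity), div_lt_iff₀ hc]
  have h4 : 0 < 2 / ε := by positivity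
  rw [div_lt_iff₀ hε] at h2
  set A : ℝ := (((triangles N).filter fun X => X u.1 u.2 ≤ X v.1 v.2).card : ℝ)
  set E := (triangles N).expect fun X => (X u.1 u.2 : ℝ) - X v.1 v.2
  have hA : 0 ≤ A := Nat.cast_nonneg _
  have hE : 0 < E := by
    by_contra! hE
    nlinarith
  refine lt_of_mul_lt_mul_right (lt_of_le_of_lt h3 ?_) hE.le
  nlinarith

/-- Consecutive rows among the first `k` of a monotone triangle interlace strictly. -/
def StrictTriangle (k : ℕ) (X : ℕ → ℕ → ℤ) : Prop :=
  ∀ a b, a + b + 2 ≤ k → X a (b + 1) < X a b ∧ X a b < X (a + 1) b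

open Classical in
theorem tendsto_prob_strictTriangle (k : ℕ) :
    Filter.Tendsto (fun N => (((triangles N).filter (StrictTriangle k)).card : ℝ) /
      (triangles N).card) Filter.atTop (nhds 1) := by
  set u : ℕ → ℕ × ℕ → ℝ := fun N p =>
    (((triangles N).filter fun X => X p.1 p.2 ≤ X p.1 (p.2 + 1)).card : ℝ) / (triangles N).card +
    (((triangles N).filter fun X => X (p.1 + 1) p.2 ≤ X p.1 p.2).card : ℝ) / (triangles N).card
    with hu
  have hu0 : ∀ p, Filter.Tendsto (fun N => u N p) Filter.atTop (nhds 0) := by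
    intro p
    rw [← add_zero (0 : ℝ)]
    refine (tendsto_prob_gap_eq_zero (u := (p.1, p.2)) (v := (p.1, p.2 + 1)) ?_ ?_).add
      (tendsto_prob_gap_eq_zero (u := (p.1 + 1, p.2)) (v := (p.1, p.2)) ?_ ?_)
    · filter_upwards [Filter.eventually_gt_atTop (p.1 + p.2 + 1)] with N hN X hX
      exact (mem_triangles.1 hX).le_left _ _ hN
    · exact fun F hF h => not_close hF _ _ (Or.inl h)
    · filter_upwards [Filter.eventually_gt_atTop (p.1 + p.2 + 1)] with N hN X hX
      exact (mem_triangles.1 hX).le_right _ _ hN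
    · exact fun F hF h => not_close hF _ _ (Or.inr h.symm)
  have hsum : Filter.Tendsto (fun N => 1 - ∑ p ∈ Finset.range k ×ˢ Finset.range k, u N p)
      Filter.atTop (nhds 1) := by
    simpa using (tendsto_const_nhds (x := (1 : ℝ))).sub (tendsto_finsetSum _ fun p _ => hu0 p)
  refine tendsto_of_tendsto_of_tendsto_of_le_of_le hsum tendsto_const_nhds (fun N => ?_)
    fun N => div_le_one_of_le₀ (Nat.cast_le.2 (Finset.card_filter_le _ _)) (Nat.cast_nonneg _)
  have hc := card_triangles_pos N
  have hbad : ((triangles N).filter fun X => ¬ StrictTriangle k X).card ≤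
      ∑ p ∈ Finset.range k ×ˢ Finset.range k,
        (((triangles N).filter fun X => X p.1 p.2 ≤ X p.1 (p.2 + 1)).card +
          ((triangles N).filter fun X => X (p.1 + 1) p.2 ≤ X p.1 p.2).card) := by
    refine (Finset.card_le_card (t := (Finset.range k ×ˢ Finset.range k).biUnion fun p =>
      ((triangles N).filter fun X => X p.1 p.2 ≤ X p.1 (p.2 + 1)) ∪
        ((triangles N).filter fun X => X (p.1 + 1) p.2 ≤ X p.1 p.2)) fun X hX => ?_).trans
      (Finset.card_biUnion_le.trans (Finset.sum_le_sum fun p _ => Finset.card_union_le _ _))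
    obtain ⟨hX, h⟩ := Finset.mem_filter.1 hX
    simp only [StrictTriangle, not_forall] at h
    obtain ⟨a, b, hab, h⟩ := h
    rw [not_and_or, not_lt, not_lt] at h
    simp only [Finset.mem_biUnion, Finset.mem_union, Finset.mem_filter, Finset.mem_product,
      Finset.mem_range, hX, true_and]
    exact ⟨(a, b), ⟨by omega, by omega⟩, h⟩
  have hadd := Finset.card_filter_add_card_filter_not (s := triangles N) (StrictTriangle k)
  simp only [hu, ← add_div, ← Finset.sum_div]
  rw [le_div_iff₀ hc, sub_mul, div_mul_cancel₀ _ hc.ne', one_mul, sub_le_iff_le_add]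
  exact_mod_cast hadd.symm.trans_le (by gcongr)

/-- The matrix with the given corner sums. -/
def asmOf (N : ℕ) (C : ℕ → ℕ → ℤ) : Matrix (Fin N) (Fin N) ℤ := fun i j =>
  (C (i + 1) (j + 1) - C (i + 1) j) - (C i (j + 1) - C i j)

theorem sum_filter_le_fin {N : ℕ} (f : ℕ → ℤ) (m : Fin N) :
    ∑ j ∈ Finset.univ.filter (fun j : Fin N => j ≤ m), f j = ∑ j ∈ Finset.range (m + 1), f j := by
  refine Finset.sum_nbij (fun j => (j : ℕ)) ?_ Fin.val_injective.injOn ?_ fun _ _ => rfl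
  · intro j hj
    have : j ≤ m := (Finset.mem_filter.1 hj).2
    exact Finset.mem_range.2 (Nat.lt_succ_of_le this)
  · intro j hj
    have hj := Finset.mem_range.1 (Finset.mem_coe.1 hj)
    refine ⟨⟨j, by omega⟩, ?_, rfl⟩
    simp only [Finset.coe_filter, Finset.mem_univ, true_and, Set.mem_ofPred_eq, Fin.le_def]
    omega

theorem asmOf_transpose (N : ℕ) (C : ℕ → ℕ → ℤ) (i j : Fin N) :
    asmOf N (fun i l => C l i) j i = asmOf N C i j := by
  simp only [asmOf]
  ring

theorem IsCornerSum.sum_asmOf_row {N : ℕ} {C : ℕ → ℕ → ℤ} (h : IsCornerSum N C) (i : Fin N) :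
    ∑ j, asmOf N C i j = 1 := by
  simp only [asmOf]
  rw [Fin.sum_univ_eq_sum_range
    fun j => (C (i + 1) (j + 1) - C (i + 1) j) - (C i (j + 1) - C i j), Finset.sum_sub_distrib,
    Finset.sum_range_sub, Finset.sum_range_sub, h.right _ i.2, h.right _ i.2.le, h.left, h.left]
  push_cast
  ring

theorem IsCornerSum.sum_asmOf_row_le {N : ℕ} {C : ℕ → ℕ → ℤ} (h : IsCornerSum N C) (i m : Fin N) :
    ∑ j ∈ Finset.univ.filter (fun j : Fin N => j ≤ m), asmOf N C i j = 0 ∨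
      ∑ j ∈ Finset.univ.filter (fun j : Fin N => j ≤ m), asmOf N C i j = 1 := by
  simp only [asmOf]
  rw [sum_filter_le_fin
    fun j => (C (i + 1) (j + 1) - C (i + 1) j) - (C i (j + 1) - C i j), Finset.sum_sub_distrib,
    Finset.sum_range_sub, Finset.sum_range_sub, h.left, h.left]
  have := h.ver i i.2 (m + 1) m.2
  omega

theorem IsCornerSum.isASM {N : ℕ} {C : ℕ → ℕ → ℤ} (h : IsCornerSum N C) : IsASM (asmOf N C) := by
  refine ⟨fun i j => ?_, h.sum_asmOf_row, fun j => ?_, h.sum_asmOf_row_le, fun j m => ?_⟩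
  · have h1 := h.hor (i + 1) i.2 j j.2
    have h2 := h.hor i i.2.le j j.2
    simp only [asmOf]
    omega
  · simpa only [asmOf_transpose] using h.transpose.sum_asmOf_row j
  · simpa only [asmOf_transpose] using h.transpose.sum_asmOf_row_le j m

theorem asmOf_injOn (N : ℕ) : Set.InjOn (asmOf N) {C | IsCornerSum N C} := by
  intro C (hC : IsCornerSum N C) D (hD : IsCornerSum N D) h
  funext i l
  induction i generalizing l with
  | zero => rw [hC.top, hD.top]
  | succ i ih =>
    induction l with
    | zero => rw [hC.left, hD.left]
    | succ l ih' =>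
      by_cases hil : i < N ∧ l < N
      · have h1 := congrFun (congrFun h ⟨i, hil.1⟩) ⟨l, hil.2⟩
        simp only [asmOf] at h1
        linarith [ih l, ih (l + 1)]
      · rw [hC.out _ _ (by omega), hD.out _ _ (by omega)]

/-- A matrix extended by zero. -/
def extendZero {N : ℕ} (M : Matrix (Fin N) (Fin N) ℤ) (p q : ℕ) : ℤ :=
  if h : p < N ∧ q < N then M ⟨p, h.1⟩ ⟨q, h.2⟩ else 0

theorem extendZero_coe {N : ℕ} (M : Matrix (Fin N) (Fin N) ℤ) (i j : Fin N) :
    extendZero M i j = M i j := dif_pos ⟨i.2, j.2⟩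

/-- The corner sums of a matrix. -/
def cornerSum {N : ℕ} (M : Matrix (Fin N) (Fin N) ℤ) (i l : ℕ) : ℤ :=
  if i ≤ N ∧ l ≤ N then ∑ p ∈ Finset.range i, ∑ q ∈ Finset.range l, extendZero M p q else 0

theorem extendZero_transpose {N : ℕ} (M : Matrix (Fin N) (Fin N) ℤ) (p q : ℕ) :
    extendZero M.transpose p q = extendZero M q p := by
  simp only [extendZero, and_comm, Matrix.transpose_apply]

theorem cornerSum_transpose {N : ℕ} (M : Matrix (Fin N) (Fin N) ℤ) (i l : ℕ) :
    cornerSum M.transpose i l = cornerSum M l i := by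
  simp only [cornerSum, extendZero_transpose, and_comm]
  rw [Finset.sum_comm]

theorem IsASM.transpose {N : ℕ} {M : Matrix (Fin N) (Fin N) ℤ} (h : IsASM M) :
    IsASM M.transpose :=
  ⟨fun i j => h.1 j i, h.2.2.1, h.2.1, h.2.2.2.2, h.2.2.2.1⟩

theorem IsASM.cornerSum_right {N : ℕ} {M : Matrix (Fin N) (Fin N) ℤ} (h : IsASM M) {i : ℕ}
    (hi : i ≤ N) : cornerSum M i N = i := by
  rw [cornerSum, if_pos ⟨hi, le_rfl⟩, Finset.sum_congr rfl (g := fun _ => 1)]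
  · simp
  · intro p hp
    have hp := Finset.mem_range.1 hp
    rw [← Fin.sum_univ_eq_sum_range, ← h.2.1 ⟨p, by omega⟩]
    exact Finset.sum_congr rfl fun q _ => extendZero_coe M ⟨p, by omega⟩ q

theorem IsASM.cornerSum_succ {N : ℕ} {M : Matrix (Fin N) (Fin N) ℤ} (h : IsASM M) {i l : ℕ}
    (hi : i < N) (hl : l ≤ N) :
    cornerSum M (i + 1) l = cornerSum M i l ∨ cornerSum M (i + 1) l = cornerSum M i l + 1 := by
  rw [cornerSum, cornerSum, if_pos ⟨hi, hl⟩, if_pos ⟨hi.le, hl⟩, Finset.sum_range_succ]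
  rcases l with _ | l
  · simp
  · have := h.2.2.2.1 ⟨i, hi⟩ ⟨l, hl⟩
    rw [← Finset.sum_congr rfl fun q _ => extendZero_coe M ⟨i, hi⟩ q,
      sum_filter_le_fin (fun q => extendZero M i q)] at this
    simp only at this
    omega

theorem IsASM.isCornerSum {N : ℕ} {M : Matrix (Fin N) (Fin N) ℤ} (h : IsASM M) :
    IsCornerSum N (cornerSum M) where
  left i := by simp [cornerSum]
  top l := by simp [cornerSum]
  right i hi := h.cornerSum_right hi
  bot l hl := by rw [← cornerSum_transpose]; exact h.transpose.cornerSum_right hl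
  hor i hi l hl := by
    rw [← cornerSum_transpose M, ← cornerSum_transpose M]; exact h.transpose.cornerSum_succ hl hi
  ver i hi l hl := h.cornerSum_succ hi hl
  out i l hil := if_neg (by omega)

theorem asmOf_cornerSum {N : ℕ} (M : Matrix (Fin N) (Fin N) ℤ) : asmOf N (cornerSum M) = M := by
  ext i j
  have hi := i.2
  have hj := j.2
  rw [asmOf, cornerSum, cornerSum, cornerSum, cornerSum, if_pos (by omega), if_pos (by omega),
    if_pos (by omega), if_pos (by omega), ← extendZero_coe M i j]
  simp only [Finset.sum_range_succ, Finset.sum_add_distrib]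
  ring

theorem image_asmOf (N : ℕ) : asmOf N '' {C | IsCornerSum N C} = {M | IsASM M} := by
  ext M
  constructor
  · rintro ⟨C, hC, rfl⟩
    exact hC.isASM
  · exact fun h => ⟨_, IsASM.isCornerSum h, asmOf_cornerSum M⟩

theorem card_isASM (N : ℕ) :
    Nat.card {M : Matrix (Fin N) (Fin N) ℤ // IsASM M} = (triangles N).card := by
  rw [card_triangles, ← Set.ncard_coe_finset, show (corners N : Set (ℕ → ℕ → ℤ)) =
    {C | IsCornerSum N C} from Set.ext fun _ => mem_corners, ← (asmOf_injOn N).ncard_image,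
    image_asmOf]
  exact Nat.card_coe_set_eq _

theorem IsCornerSum.triangleOf_eq {N : ℕ} {C : ℕ → ℕ → ℤ} (h : IsCornerSum N C) {i m : ℕ}
    (hi : i < N) (hm : m < N) {q : ℕ} (hq : C (i + 1) m = q) (hq' : C (i + 1) (m + 1) = q + 1) :
    q ≤ i ∧ triangleOf N C q (i - q) = m := by
  have h1 := h.le (j := i + 1) (m := m + 1) hi hm
  have hqi : q ≤ i := by omega
  have h2 := h.triangleOf_lt_iff (a := q) (b := i - q) (m := m) (by omega) hm.le
  have h3 := h.triangleOf_lt_iff (a := q) (b := i - q) (m := m + 1) (by omega) hm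
  rw [Nat.add_sub_cancel' hqi] at h2 h3
  rw [hq] at h2
  rw [hq'] at h3
  refine ⟨hqi, ?_⟩
  push_cast at h3
  omega

theorem IsCornerSum.not_both_of_strictTriangle {N k : ℕ} {C : ℕ → ℕ → ℤ} (h : IsCornerSum N C)
    (hs : StrictTriangle k (triangleOf N C)) {i m : ℕ} (hik : i < k) (hi : i < N) (hm : m < N) :
    ¬ (C i (m + 1) = C i m + 1 ∧ C (i + 1) (m + 1) = C (i + 1) m + 1) := by
  rintro ⟨h1, h2⟩
  rcases i with _ | i
  · simp [h.top] at h1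
  obtain ⟨q, hq⟩ := Int.eq_ofNat_of_zero_le (h.nonneg (j := i + 1) (m := m) hi.le hm.le)
  obtain ⟨s, hs'⟩ := Int.eq_ofNat_of_zero_le (h.nonneg (j := i + 1 + 1) (m := m) hi hm.le)
  obtain ⟨e1, e2⟩ := h.triangleOf_eq (by omega) hm hq (by omega)
  obtain ⟨e3, e4⟩ := h.triangleOf_eq (by omega) hm hs' (by omega)
  have e5 := hs q (i - q) (by omega)
  rcases h.ver (i + 1) hi m hm.le with e | e
  · obtain rfl : s = q := by omega
    rw [show i + 1 - s = i - s + 1 by omega] at e4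
    omega
  · obtain rfl : s = q + 1 := by omega
    rw [show i + 1 - (q + 1) = i - q by omega] at e4
    omega

theorem IsCornerSum.sum_hor {N : ℕ} {C : ℕ → ℕ → ℤ} (h : IsCornerSum N C) {i : ℕ} (hi : i ≤ N) :
    ∑ c : Fin N, (C i (c + 1) - C i c) = i := by
  rw [Fin.sum_univ_eq_sum_range fun c => C i (c + 1) - C i c, Finset.sum_range_sub, h.left,
    h.right i hi, sub_zero]

theorem IsCornerSum.card_filter_asmOf {N : ℕ} {C : ℕ → ℕ → ℤ} (h : IsCornerSum N C) (i : Fin N)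
    (hn : ∀ m < N, ¬ (C i (m + 1) = C i m + 1 ∧ C (i + 1) (m + 1) = C (i + 1) m + 1)) :
    (Finset.univ.filter (fun c : Fin N => asmOf N C i c = -1)).card = (i : ℕ) ∧
      (Finset.univ.filter (fun c : Fin N => asmOf N C i c = 1)).card = (i : ℕ) + 1 := by
  have h1 := h.sum_hor (i := i) i.2.le
  have h2 := h.sum_hor (i := i + 1) i.2
  constructor <;> zify
  · rw [← h1, Finset.card_filter]
    push_cast
    refine Finset.sum_congr rfl fun c _ => ?_
    have e1 := h.hor i i.2.le c c.2
    have e2 := h.hor (i + 1) i.2 c c.2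
    have e3 := hn c c.2
    simp only [asmOf]
    split_ifs <;> omega
  · push_cast at h2
    rw [← h2, Finset.card_filter]
    push_cast
    refine Finset.sum_congr rfl fun c _ => ?_
    have e1 := h.hor i i.2.le c c.2
    have e2 := h.hor (i + 1) i.2 c c.2
    have e3 := hn c c.2
    simp only [asmOf]
    split_ifs <;> omega

theorem finite_isASM (N : ℕ) : {M : Matrix (Fin N) (Fin N) ℤ | IsASM M}.Finite := by
  rw [← image_asmOf]
  refine Set.Finite.image _ ((corners N).finite_toSet.subset fun C hC => ?_)
  exact mem_corners.2 hC

open Classical in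
theorem card_strictTriangle_le (N k : ℕ) :
    ((triangles N).filter (StrictTriangle k)).card ≤
      Nat.card {M : Matrix (Fin N) (Fin N) ℤ // IsASM M ∧
        ∀ j : Fin N, (j : ℕ) < k →
          ((Finset.univ.filter (fun c : Fin N => M j c = -1)).card = (j : ℕ) ∧
           (Finset.univ.filter (fun c : Fin N => M j c = 1)).card = (j : ℕ) + 1)} := by
  rw [Finset.card_filter, sum_triangles, ← Finset.card_filter, ← Set.ncard_coe_finset,
    ← Set.InjOn.ncard_image (f := asmOf N) ((asmOf_injOn N).mono fun C hC =>
      mem_corners.1 (Finset.mem_filter.1 (Finset.mem_coe.1 hC)).1)]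
  refine (Set.ncard_le_ncard ?_ ((finite_isASM N).subset fun M hM => hM.1)).trans_eq
    (Nat.card_coe_set_eq _).symm
  rintro _ ⟨C, hC, rfl⟩
  obtain ⟨hC, hs⟩ := Finset.mem_filter.1 (Finset.mem_coe.1 hC)
  have hC := mem_corners.1 hC
  exact ⟨hC.isASM, fun j hj => hC.card_filter_asmOf j fun m hm =>
    hC.not_both_of_strictTriangle hs hj j.2 hm⟩

/-- For a uniformly random ASM of size `N`, the probability that for each `j = 1,…,k`
the `j`-th row contains exactly `j - 1` entries equal to `-1` (equivalently, exactly `j`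
entries equal to `1`) — the maximal possible number — tends to `1` as `N → ∞`.
(Rows are indexed by `Fin N`, so row `j : Fin N` is the `(j+1)`-st row.) -/
theorem asm_max_minus_ones_in_first_k_rows (k : ℕ) (hk : 1 ≤ k) :
    Filter.Tendsto
      (fun N : ℕ =>
        (Nat.card {M : Matrix (Fin N) (Fin N) ℤ // IsASM M ∧
            ∀ j : Fin N, (j : ℕ) < k →
              ((Finset.univ.filter (fun c : Fin N => M j c = -1)).card = (j : ℕ) ∧
               (Finset.univ.filter (fun c : Fin N => M j c = 1)).card = (j : ℕ) + 1)} : ℝ) /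
        (Nat.card {M : Matrix (Fin N) (Fin N) ℤ // IsASM M} : ℝ))
      Filter.atTop (nhds 1) := by
  classical
  refine tendsto_of_tendsto_of_tendsto_of_le_of_le (tendsto_prob_strictTriangle k)
    tendsto_const_nhds (fun N => ?_) fun N => ?_
  · simp only [card_isASM]
    gcongr
    exact card_strictTriangle_le N k
  · refine div_le_one_of_le₀ (Nat.cast_le.2 ?_) (Nat.cast_nonneg _)
    exact Set.ncard_le_ncard (fun M hM => hM.1) (finite_isASM N)
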